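/- Let n ∈ ℕ, E a complex Banach space, s ∈ ℝ, 0 < p < ∞, 0 < q ≤ ∞. Let k₀, k⁰ ∈ S(ℝ^n) with k̂₀(0) ≠ 0 and k̂⁰(0) ≠ 0, let N ∈ ℕ₀ with 2N > s, and set k^N := Δ^N k⁰ (the N-fold Laplacian) and k^N_j(x) := 2^{jn} k^N(2^j x). Then there exist constants c₁, c₂ > 0 such that for all f ∈ F^s_{p,q}(E): c₁ ‖f|F^s_{p,q}(E)‖ ≤ ‖k₀ * f|L_p(E)‖ + ‖ (Σ_{j≥1} 2^{jsq} ‖(k^N_j * f)(·)‖_E^q)^{1/q} |L_p‖ ≤ c₂ ‖f|F^s_{p,q}(E)‖ (supremum over j if q = ∞). Moreover, an f ∈ S'(ℝ^n,E) belongs to F^s_{p,q}(E) if and only if ‖k₀ * f|L_p(E)‖ + ‖ (Σ_{j≥1} 2^{jsq} ‖(k^N_j * f)(·)‖_E^q)^{1/q} |L_p‖ < ∞. -/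

import Mathlib

noncomputable section

open MeasureTheory Filter Metric Real Set SchwartzMap
open scoped ENNReal NNReal Topology FourierTransform

/-- Euclidean space ℝⁿ. -/
abbrev Rn (n : ℕ) : Type := EuclideanSpace ℝ (Fin n)

/-- The Schwartz space 𝓢(ℝⁿ, ℂ). -/
abbrev Sch (n : ℕ) : Type := SchwartzMap (Rn n) ℂ

/-- Partial derivative in the `i`-th coordinate direction. -/
def pd {F : Type*} [NormedAddCommGroup F] [NormedSpace ℝ F] {n : ℕ} (i : Fin n)
    (g : Rn n → F) : Rn n → F :=
  fun x => lineDeriv ℝ g x (EuclideanSpace.single i (1 : ℝ))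

/-- Multi-index derivative `D^α = ∂₁^{α₁} ⋯ ∂ₙ^{αₙ}`. -/
def mderiv {F : Type*} [NormedAddCommGroup F] [NormedSpace ℝ F] {n : ℕ} (α : Fin n → ℕ)
    (g : Rn n → F) : Rn n → F :=
  (List.finRange n).foldr (fun i h => (pd i)^[α i] h) g

/-- The order `|α|` of a multi-index. -/
def mdeg {n : ℕ} (α : Fin n → ℕ) : ℕ := ∑ i, α i

/-- The Schwartz seminorm `‖φ‖_{K,L} = sup_x (1+|x|²)^{K/2} ∑_{|α| ≤ L} |D^α φ(x)|`. -/
def schSemi {n : ℕ} (K L : ℕ) (φ : Sch n) : ℝ :=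
  ⨆ x : Rn n, (1 + ‖x‖ ^ 2) ^ ((K : ℝ) / 2) *
    ∑ α : Fin n → Fin (L + 1), if mdeg (fun i => (α i : ℕ)) ≤ L
      then ‖mderiv (fun i => (α i : ℕ)) (fun y => φ y) x‖ else 0

/-- `E`-valued tempered distributions: linear maps `𝓢(ℝⁿ) → E` bounded by some
Schwartz seminorm. -/
structure TDist (n : ℕ) (E : Type*) [NormedAddCommGroup E] [NormedSpace ℂ E] where
  toFun : Sch n →ₗ[ℂ] E
  bound : ∃ (c : ℝ) (K L : ℕ), ∀ φ : Sch n, ‖toFun φ‖ ≤ c * schSemi K L φ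

namespace Aux

lemma hasTemperateGrowth_sub_left {n : ℕ} (x : Rn n) :
    Function.HasTemperateGrowth (fun y : Rn n => x - y) := by
  apply Function.HasTemperateGrowth.of_fderiv (k := 1) (C := ‖x‖ + 1)
  · have h : (fderiv ℝ (fun y : Rn n => x - y)) =
        fun _ : Rn n => -(ContinuousLinearMap.id ℝ (Rn n)) := by
      ext1 y
      rw [fderiv_const_sub]
      simp
    rw [h]
    exact .const _
  · exact (differentiable_const x).sub differentiable_id
  · intro y
    have h1 : ‖x - y‖ ≤ ‖x‖ + ‖y‖ := norm_sub_le x y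
    have h2 : (0:ℝ) ≤ ‖y‖ := norm_nonneg y
    have h3 : (0:ℝ) ≤ ‖x‖ := norm_nonneg x
    calc ‖x - y‖ ≤ ‖x‖ + ‖y‖ := h1
      _ ≤ (‖x‖ + 1) * (1 + ‖y‖) ^ 1 := by nlinarith

lemma antilipschitz_sub_left {n : ℕ} (x : Rn n) :
    AntilipschitzWith 1 (fun y : Rn n => x - y) := by
  refine (Isometry.antilipschitz ?_)
  intro y z
  simp only [edist_dist, dist_eq_norm, sub_sub_sub_cancel_left, norm_sub_rev]

end Aux

/-- The Schwartz function `y ↦ ψ(x - y)`. -/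
def shiftReflect {n : ℕ} (ψ : Sch n) (x : Rn n) : Sch n :=
  SchwartzMap.compCLMOfAntilipschitz (𝕜 := ℝ)
    (Aux.hasTemperateGrowth_sub_left x) (Aux.antilipschitz_sub_left x) ψ

/-- The dilated Schwartz function `ψ(t ·)` (junk value `0` when `t = 0`). -/
def dilate {n : ℕ} (ψ : Sch n) (t : ℝ) : Sch n :=
  if h : t = 0 then 0 else
    SchwartzMap.compCLM (𝕜 := ℝ) (g := fun y : Rn n => t • y)
      (by
        have := (t • ContinuousLinearMap.id ℝ (Rn n)).hasTemperateGrowth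
        exact this)
      (⟨1, |t|⁻¹, fun y => by
        have ht : 0 < |t| := abs_pos.mpr h
        have : ‖t • y‖ = |t| * ‖y‖ := by rw [norm_smul]; simp [Real.norm_eq_abs]
        rw [pow_one, this]
        rw [mul_add, mul_one]
        have : |t|⁻¹ * (|t| * ‖y‖) = ‖y‖ := by field_simp
        nlinarith [norm_nonneg y, inv_pos.mpr ht]⟩) ψ

/-- Fourier transform on Schwartz space. -/
def fourierS {n : ℕ} (φ : Sch n) : Sch n := FourierTransform.fourierCLE ℂ (Sch n) φ

/-- Inverse Fourier transform on Schwartz space. -/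
def invFourierS {n : ℕ} (φ : Sch n) : Sch n := (FourierTransform.fourierCLE ℂ (Sch n)).symm φ

variable {n : ℕ} {E : Type*} [NormedAddCommGroup E] [NormedSpace ℂ E]

/-- Convolution `(ψ * f)(x) := (2π)^{-n/2} f(ψ(x - ·))` of a Schwartz function with an
`E`-valued tempered distribution. -/
def tdConv (ψ : Sch n) (f : TDist n E) : Rn n → E :=
  fun x => ((2 * π) ^ (-(n : ℝ) / 2) : ℝ) • f.toFun (shiftReflect ψ x)

/-- The operator `f ↦ (φ f̂)ˇ = φ̌ * f`. -/
def mOp (φ : Sch n) (f : TDist n E) : Rn n → E := tdConv (invFourierS φ) f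

/-- `L_p`-norm (in `[0,∞]`) of an `ℝ≥0∞`-valued function. -/
def lpNormENN {n : ℕ} (p : ℝ≥0∞) (g : Rn n → ℝ≥0∞) : ℝ≥0∞ :=
  if p = ∞ then essSup g volume else (∫⁻ x, (g x) ^ p.toReal) ^ (1 / p.toReal)

/-- `ℓ_q`-norm (in `[0,∞]`) of a sequence, with the usual modification for `q = ∞`. -/
def lqSum (q : ℝ≥0∞) (a : ℕ → ℝ≥0∞) : ℝ≥0∞ :=
  if q = ∞ then ⨆ j, a j else (∑' j, (a j) ^ q.toReal) ^ (1 / q.toReal)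

/-- A smooth dyadic resolution of unity. -/
structure SmoothResolution (n : ℕ) (φ : ℕ → Sch n) : Prop where
  supp0 : Function.support (φ 0) ⊆ {ξ : Rn n | ‖ξ‖ ≤ 2}
  suppj : ∀ j : ℕ, 0 < j →
    Function.support (φ j) ⊆ {ξ : Rn n | 2 ^ ((j : ℝ) - 1) ≤ ‖ξ‖ ∧ ‖ξ‖ ≤ 2 ^ ((j : ℝ) + 1)}
  sum_eq : ∀ ξ : Rn n, ∑' j : ℕ, φ j ξ = 1
  deriv_bound : ∀ α : Fin n → ℕ, ∃ c : ℝ, ∀ (j : ℕ) (ξ : Rn n),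
    ‖mderiv α (fun y => φ j y) ξ‖ ≤ c * 2 ^ (-(j : ℝ) * (mdeg α : ℝ))

/-- The Besov quasi-norm `‖f | B^s_{p,q}(E)‖` w.r.t. the resolution of unity `φ`. -/
def besovNorm (s : ℝ) (p q : ℝ≥0∞) (φ : ℕ → Sch n) (f : TDist n E) : ℝ≥0∞ :=
  lqSum q fun j => (2 : ℝ≥0∞) ^ ((j : ℝ) * s) * eLpNorm (mOp (φ j) f) p volume

/-- The Triebel–Lizorkin quasi-norm `‖f | F^s_{p,q}(E)‖` w.r.t. the resolution of unity `φ`. -/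
def triebelNorm (s : ℝ) (p q : ℝ≥0∞) (φ : ℕ → Sch n) (f : TDist n E) : ℝ≥0∞ :=
  lpNormENN p fun x =>
    lqSum q fun j => (2 : ℝ≥0∞) ^ ((j : ℝ) * s) * (‖mOp (φ j) f x‖₊ : ℝ≥0∞)

variable {n : ℕ} {E : Type*} [NormedAddCommGroup E] [NormedSpace ℂ E]

/-- The Laplacian on Schwartz space, `Δφ = ∑ᵢ ∂ᵢ²φ`. -/
def schLap {n : ℕ} (φ : Sch n) : Sch n :=
  ∑ i : Fin n, LineDeriv.lineDerivOpCLM ℝ (Sch n) (EuclideanSpace.single i (1 : ℝ))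
    (LineDeriv.lineDerivOpCLM ℝ (Sch n) (EuclideanSpace.single i (1 : ℝ)) φ)

/-- The local means norm
`‖k₀*f|L_p(E)‖ + (∑_{j≥1} 2^{jsq} ‖k^N_j*f|L_p(E)‖^q)^{1/q}`,
where `k^N_j(x) = 2^{jn} k^N(2^j x)`. -/
def localMeansB (s : ℝ) (p q : ℝ≥0∞) (k0 kN : Sch n) (f : TDist n E) : ℝ≥0∞ :=
  eLpNorm (tdConv k0 f) p volume +
    lqSum q fun j => (2 : ℝ≥0∞) ^ (((j : ℝ) + 1) * s) *
      eLpNorm (tdConv (((2 : ℝ) ^ (((j : ℝ) + 1) * (n : ℝ))) •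
        dilate kN ((2 : ℝ) ^ ((j : ℝ) + 1))) f) p volume

/-- The local means norm
`‖k₀*f|L_p(E)‖ + ‖(∑_{j≥1} 2^{jsq} ‖(k^N_j*f)(·)‖^q)^{1/q}|L_p‖`. -/
def localMeansF (s : ℝ) (p q : ℝ≥0∞) (k0 kN : Sch n) (f : TDist n E) : ℝ≥0∞ :=
  eLpNorm (tdConv k0 f) p volume +
    lpNormENN p fun x => lqSum q fun j => (2 : ℝ≥0∞) ^ (((j : ℝ) + 1) * s) *
      (‖tdConv (((2 : ℝ) ^ (((j : ℝ) + 1) * (n : ℝ))) •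
        dilate kN ((2 : ℝ) ^ ((j : ℝ) + 1))) f x‖₊ : ℝ≥0∞)

namespace LM

/-- normalized mean over a ball of radius `2^k` -/
def av {n : ℕ} (k : ℤ) (h : Rn n → ℝ≥0∞) (x : Rn n) : ℝ≥0∞ :=
  (ENNReal.ofReal (((2:ℝ) ^ k) ^ n))⁻¹ * ∫⁻ z in closedBall x ((2:ℝ) ^ k), h z

/-- maximal function -/
def Mx {n : ℕ} (h : Rn n → ℝ≥0∞) (x : Rn n) : ℝ≥0∞ := ⨆ k : ℤ, av k h x

/-- volume of the unit ball -/
def om (n : ℕ) : ℝ≥0∞ := volume (ball (0 : Rn n) 1)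

lemma om_ne_top (n : ℕ) : om n ≠ ∞ := measure_ball_lt_top.ne
lemma om_ne_zero (n : ℕ) : om n ≠ 0 := (measure_ball_pos _ _ one_pos).ne'

lemma ofR_pow_ne_zero (k : ℤ) (n : ℕ) : ENNReal.ofReal (((2:ℝ) ^ k) ^ n) ≠ 0 := by
  have : (0:ℝ) < ((2:ℝ) ^ k) ^ n := by positivity
  simpa using this

lemma measurable_av {n : ℕ} (k : ℤ) {h : Rn n → ℝ≥0∞} (hh : Measurable h) :
    Measurable (av k h) := by
  unfold av
  refine Measurable.const_mul ?_ _
  have : (fun x : Rn n => ∫⁻ z in closedBall x ((2:ℝ) ^ k), h z) =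
      fun x => ∫⁻ z, ({q : Rn n × Rn n | dist q.2 q.1 ≤ (2:ℝ)^k}).indicator (fun q => h q.2) (x, z) := by
    funext x
    rw [← lintegral_indicator measurableSet_closedBall]
    rfl
  rw [this]
  refine Measurable.lintegral_prod_right' (f := fun q : Rn n × Rn n => ({q : Rn n × Rn n | dist q.2 q.1 ≤ (2:ℝ)^k}).indicator (fun q => h q.2) q) ?_
  refine (hh.comp measurable_snd).indicator ?_
  exact measurableSet_le (measurable_snd.dist measurable_fst) measurable_const

lemma measurable_Mx {n : ℕ} {h : Rn n → ℝ≥0∞} (hh : Measurable h) : Measurable (Mx h) :=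
  Measurable.iSup fun k => measurable_av k hh

lemma weak_aux {n : ℕ} (I : ℕ) (h : Rn n → ℝ≥0∞) (l : ℝ≥0∞) :
    l * volume {x : Rn n | ∃ k : ℤ, k ≤ I ∧ l < av k h x} ≤ 5 ^ n * om n * ∫⁻ x, h x := by
  set t := {x : Rn n | ∃ k : ℤ, k ≤ I ∧ l < av k h x} with ht
  have H : ∀ x : Rn n, ∃ k : ℤ, x ∈ t → k ≤ I ∧ l < av k h x := by
    intro x
    by_cases hx : x ∈ t
    · obtain ⟨k, hk⟩ := hx
      exact ⟨k, fun _ => hk⟩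
    · exact ⟨0, fun h => absurd h hx⟩
  choose K hK using H
  obtain ⟨u, hut, hdis, hcov⟩ := Vitali.exists_disjoint_subfamily_covering_enlargement_closedBall t
    (fun x : Rn n => x) (fun x => (2:ℝ) ^ (K x)) ((2:ℝ) ^ (I : ℤ))
    (fun a ha => zpow_le_zpow_right₀ (by norm_num) (hK a ha).1) 5 (by norm_num)
  have hucount : u.Countable := by
    refine hdis.countable_of_nonempty_interior ?_
    intro x hx
    refine ⟨x, ?_⟩
    apply ball_subset_interior_closedBall
    exact mem_ball_self (by positivity)
  have hsub : t ⊆ ⋃ b ∈ u, closedBall b (5 * (2:ℝ) ^ (K b)) := by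
    intro x hx
    obtain ⟨b, hb, hxb⟩ := hcov x hx
    simp only [mem_iUnion]
    exact ⟨b, hb, hxb (mem_closedBall_self (by positivity))⟩
  haveI := hucount.to_subtype
  calc l * volume t ≤ l * ∑' b : u, volume (closedBall (b : Rn n) (5 * (2:ℝ) ^ (K b))) := by
        gcongr
        refine (measure_mono hsub).trans ?_
        exact measure_biUnion_le _ hucount _
    _ = ∑' b : u, l * volume (closedBall (b : Rn n) (5 * (2:ℝ) ^ (K b))) := by
        rw [ENNReal.tsum_mul_left]
    _ ≤ ∑' b : u, 5 ^ n * om n * ∫⁻ z in closedBall (b : Rn n) ((2:ℝ) ^ (K b)), h z := by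
        refine ENNReal.tsum_le_tsum fun b => ?_
        have h1 := (hK b (hut b.2)).2
        unfold av at h1
        rw [Measure.addHaar_closedBall _ _ (by positivity), finrank_euclideanSpace_fin, mul_pow,
          ENNReal.ofReal_mul (by positivity), ENNReal.ofReal_pow (by norm_num)]
        have h2 : l * ENNReal.ofReal (((2:ℝ) ^ (K b)) ^ n) ≤
            ∫⁻ z in closedBall (b : Rn n) ((2:ℝ) ^ (K b)), h z := by
          have h3 := mul_le_mul_left h1.le (ENNReal.ofReal (((2:ℝ) ^ (K b)) ^ n))
          rwa [mul_comm _ (lintegral _ _), mul_assoc, ENNReal.inv_mul_cancel (ofR_pow_ne_zero _ _)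
            ENNReal.ofReal_ne_top, mul_one] at h3
        calc _ = 5 ^ n * om n * (l * ENNReal.ofReal (((2:ℝ) ^ (K b)) ^ n)) := by
              unfold om
              rw [show ENNReal.ofReal 5 = 5 by norm_num]
              ring
          _ ≤ _ := by gcongr
    _ = 5 ^ n * om n * ∫⁻ z in ⋃ b ∈ u, closedBall (b : Rn n) ((2:ℝ) ^ (K b)), h z := by
        rw [ENNReal.tsum_mul_left, lintegral_biUnion hucount (fun _ _ => measurableSet_closedBall) hdis]
    _ ≤ _ := by
        gcongr
        exact Measure.restrict_le_self

lemma weak {n : ℕ} (h : Rn n → ℝ≥0∞) (l : ℝ≥0∞) :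
    l * volume {x : Rn n | l < Mx h x} ≤ 5 ^ n * om n * ∫⁻ x, h x := by
  have : {x : Rn n | l < Mx h x} = ⋃ I : ℕ, {x : Rn n | ∃ k : ℤ, k ≤ I ∧ l < av k h x} := by
    ext x
    simp only [mem_setOf_eq, mem_iUnion, Mx, lt_iSup_iff]
    constructor
    · rintro ⟨k, hk⟩
      exact ⟨k.toNat, k, Int.self_le_toNat k, hk⟩
    · rintro ⟨I, k, -, hk⟩
      exact ⟨k, hk⟩
  rw [this, Monotone.measure_iUnion, ENNReal.mul_iSup]
  · exact iSup_le fun I => weak_aux I h l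
  · intro I J hIJ x
    rintro ⟨k, hk, hk'⟩
    exact ⟨k, hk.trans (by exact_mod_cast hIJ), hk'⟩

/-- the indicator `1[2^k < y]` -/
def dk (k : ℤ) (y : ℝ≥0∞) : ℝ≥0∞ := if (2:ℝ≥0∞) ^ k < y then 1 else 0

lemma two_zpow_rpow (k : ℤ) (t : ℝ) : ((2:ℝ≥0∞) ^ k) ^ t = (2:ℝ≥0∞) ^ ((k:ℝ) * t) := by
  rw [ENNReal.rpow_mul, ENNReal.rpow_intCast]

lemma d1 (y : ℝ≥0∞) {t : ℝ} (ht : 0 < t) :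
    y ^ t ≤ 2 ^ t * ∑' k : ℤ, (2:ℝ≥0∞) ^ ((k:ℝ) * t) * dk k y := by
  rcases eq_or_ne y 0 with rfl | hy0
  · simp [ht]
  rcases eq_or_ne y ∞ with rfl | hy
  · have : ∑' k : ℤ, (2:ℝ≥0∞) ^ ((k:ℝ) * t) * dk k ∞ = ∞ := by
      refine ENNReal.eq_top_of_forall_nnreal_le fun r => ?_
      obtain ⟨m, hm⟩ := exists_nat_gt (r : ℝ)
      obtain ⟨m', hm'⟩ := exists_nat_gt ((m:ℝ) / t)
      refine le_trans ?_ (ENNReal.le_tsum (m' : ℤ))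
      have h1 : dk (m' : ℤ) ∞ = 1 := by
        unfold dk
        rw [if_pos]
        rw [zpow_natCast]
        exact (ENNReal.pow_ne_top (by norm_num)).lt_top
      rw [h1, mul_one]
      have h2 : (m:ℝ) ≤ ((m':ℤ):ℝ) * t := by
        rw [div_lt_iff₀ ht] at hm'
        simpa using hm'.le
      calc (r:ℝ≥0∞) ≤ (m : ℝ≥0∞) := by
            have : r ≤ (m : ℝ≥0) := by exact_mod_cast hm.le
            exact_mod_cast this
        _ ≤ (2:ℝ≥0∞) ^ m := by
            have : m ≤ 2 ^ m := Nat.lt_two_pow_self.le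
            exact_mod_cast this
        _ = (2:ℝ≥0∞) ^ (m : ℝ) := by rw [ENNReal.rpow_natCast]
        _ ≤ _ := ENNReal.rpow_le_rpow_of_exponent_le (by norm_num) h2
    rw [this]
    rw [ENNReal.mul_top]
    · exact le_top
    · simp [ht.le]
  · obtain ⟨k, hk1, hk2⟩ := ENNReal.exists_mem_Ioc_zpow hy0 hy (y := 2) (by norm_num) (by norm_num)
    have h1 : dk k y = 1 := by
      unfold dk
      rw [if_pos hk1]
    calc y ^ t ≤ ((2:ℝ≥0∞) ^ (k+1)) ^ t := by gcongr
      _ = 2 ^ t * ((2:ℝ≥0∞) ^ ((k:ℝ) * t) * dk k y) := by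
        rw [h1, mul_one, two_zpow_rpow, ← ENNReal.rpow_add _ _ (by norm_num) (by norm_num)]
        congr 1
        push_cast; ring
      _ ≤ _ := by
        gcongr
        exact ENNReal.le_tsum k

/-- geometric constant -/
def geo (a : ℝ) : ℝ≥0∞ := (1 - (2:ℝ≥0∞) ^ (-a))⁻¹

lemma geo_ne_top {a : ℝ} (ha : 0 < a) : geo a ≠ ∞ := by
  unfold geo
  have : (2:ℝ≥0∞) ^ (-a) < 1 := ENNReal.rpow_lt_one_of_one_lt_of_neg (by norm_num) (by linarith)
  simp only [ne_eq, ENNReal.inv_eq_top]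
  exact (tsub_pos_of_lt this).ne'

lemma tsum_geo (a : ℝ) : ∑' i : ℕ, (2:ℝ≥0∞) ^ (-(a * i)) = geo a := by
  unfold geo
  rw [← ENNReal.tsum_geometric]
  congr 1
  funext i
  rw [← neg_mul, ENNReal.rpow_mul, ENNReal.rpow_natCast]

lemma one_le_geo (a : ℝ) : 1 ≤ geo a := by
  rw [← tsum_geo]
  refine le_trans ?_ (ENNReal.le_tsum 0)
  simp

lemma d2 (y : ℝ≥0∞) {a : ℝ} (ha : 0 < a) :
    ∑' k : ℤ, (2:ℝ≥0∞) ^ ((k:ℝ) * a) * dk k y ≤ geo a * y ^ a := by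
  rcases eq_or_ne y 0 with rfl | hy0
  · simp [dk]
  rcases eq_or_ne y ∞ with rfl | hy
  · rw [ENNReal.top_rpow_of_pos ha, ENNReal.mul_top]
    · exact le_top
    · exact (lt_of_lt_of_le one_pos (one_le_geo a)).ne'
  obtain ⟨k, hk1, hk2⟩ := ENNReal.exists_mem_Ioc_zpow hy0 hy (y := 2) (by norm_num) (by norm_num)
  rw [← (Equiv.subLeft k).tsum_eq]
  rw [← (Nat.cast_injective (R := ℤ)).tsum_eq]
  · calc _ ≤ ∑' i : ℕ, (2:ℝ≥0∞) ^ (-(a * i)) * y ^ a := by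
          refine ENNReal.tsum_le_tsum fun i => ?_
          calc _ ≤ (2:ℝ≥0∞) ^ ((((Equiv.subLeft k) (i:ℤ) : ℤ):ℝ) * a) * 1 := by
                gcongr
                unfold dk
                split_ifs <;> simp
            _ = (2:ℝ≥0∞) ^ (-(a * i)) * ((2:ℝ≥0∞) ^ k) ^ a := by
                rw [two_zpow_rpow, mul_one, ← ENNReal.rpow_add _ _ (by norm_num) (by norm_num)]
                congr 1
                simp
                ring
            _ ≤ _ := by gcongr
      _ = _ := by rw [ENNReal.tsum_mul_right, tsum_geo]
  · intro i hi
    by_contra hc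
    apply hi
    have hneg : i < 0 := by
      by_contra h
      exact hc ⟨i.toNat, Int.toNat_of_nonneg (not_lt.mp h)⟩
    have : dk ((Equiv.subLeft k) i) y = 0 := by
      unfold dk
      rw [if_neg]
      rw [not_lt]
      refine hk2.trans ?_
      refine ENNReal.zpow_le_of_le (by norm_num) ?_
      simp
      omega
    show _ * dk _ y = 0
    rw [this, mul_zero]

lemma Mx_const_add {n : ℕ} (h g : Rn n → ℝ≥0∞) (c : ℝ≥0∞) (hg : ∀ x, h x ≤ g x + c)
    (hgm : Measurable g) (x : Rn n) :
    Mx h x ≤ Mx g x + c * om n := by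
  refine iSup_le fun k => ?_
  have : av k h x ≤ av k g x + c * om n := by
    unfold av
    calc _ ≤ (ENNReal.ofReal (((2:ℝ) ^ k) ^ n))⁻¹ * ∫⁻ z in closedBall x ((2:ℝ) ^ k), (g z + c) := by
          gcongr
          exact hg _
      _ = _ := by
          rw [lintegral_add_left hgm, mul_add]
          congr 1
          rw [lintegral_const, Measure.restrict_apply_univ, Measure.addHaar_closedBall _ _ (by positivity), finrank_euclideanSpace_fin]
          change _ * (c * (_ * om n)) = _
          calc _ = ((ENNReal.ofReal (((2:ℝ) ^ k) ^ n))⁻¹ * ENNReal.ofReal (((2:ℝ) ^ k) ^ n)) * (c * om n) := by ring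
            _ = _ := by rw [ENNReal.inv_mul_cancel (ofR_pow_ne_zero _ _) ENNReal.ofReal_ne_top, one_mul]
  exact this.trans (by gcongr; exact le_iSup (fun k => av k g x) k)

lemma dk_measurable (k : ℤ) : Measurable (dk k) :=
  Measurable.ite measurableSet_Ioi measurable_const measurable_const

lemma strong_level {n : ℕ} {h : Rn n → ℝ≥0∞} (hh : Measurable h) (k : ℤ) :
    (2:ℝ≥0∞) ^ k * ∫⁻ x, dk k (Mx h x) ≤
      2 * (5 ^ n * om n) * ∫⁻ x, h x * dk k (2 * om n * h x) := by
  set c : ℝ≥0∞ := (2 * om n)⁻¹ * 2 ^ k with hc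
  have hom : 2 * om n ≠ 0 := by simp [om_ne_zero]
  have hom' : 2 * om n ≠ ∞ := ENNReal.mul_ne_top (by norm_num) (om_ne_top n)
  set g : Rn n → ℝ≥0∞ := fun x => h x * dk k (2 * om n * h x) with hg
  have hgm : Measurable g := hh.mul ((dk_measurable k).comp (hh.const_mul _))
  have h1 : ∀ x, h x ≤ g x + c := by
    intro x
    simp only [hg, dk]
    split_ifs with hx
    · simp
    · rw [not_lt] at hx
      have : h x = (2 * om n)⁻¹ * (2 * om n * h x) := by
        rw [← mul_assoc, ENNReal.inv_mul_cancel hom hom', one_mul]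
      rw [this, hc]
      refine le_add_left ?_
      gcongr
  have h2 : c * om n = 2 ^ k / 2 := by
    rw [hc, ENNReal.mul_inv (by simp) (by simp)]
    rw [div_eq_mul_inv]
    calc _ = (2 ^ k * 2⁻¹) * ((om n)⁻¹ * om n) := by ring
      _ = _ := by rw [ENNReal.inv_mul_cancel (om_ne_zero n) (om_ne_top n), mul_one]
  have hfin : (2:ℝ≥0∞) ^ k ≠ ∞ := (ENNReal.zpow_lt_top (by norm_num) (by norm_num) k).ne
  have h3 : {x : Rn n | (2:ℝ≥0∞) ^ k < Mx h x} ⊆ {x | (2:ℝ≥0∞) ^ k / 2 < Mx g x} := by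
    intro x hx
    simp only [mem_setOf_eq] at hx ⊢
    by_contra hcon
    rw [not_lt] at hcon
    have := Mx_const_add h g c h1 hgm x
    rw [h2] at this
    have h5 := this.trans (add_le_add_left hcon _)
    rw [ENNReal.add_halves] at h5
    exact absurd hx (not_lt.mpr h5)
  have h4 : ∫⁻ x, dk k (Mx h x) = volume {x : Rn n | (2:ℝ≥0∞) ^ k < Mx h x} := by
    rw [← lintegral_indicator_one (measurableSet_lt measurable_const (measurable_Mx hh))]
    refine lintegral_congr fun x => ?_
    simp [dk, Set.indicator]
  rw [h4]
  calc _ ≤ (2:ℝ≥0∞) ^ k * volume {x | (2:ℝ≥0∞) ^ k / 2 < Mx g x} := by gcongr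
    _ = 2 * ((2:ℝ≥0∞) ^ k / 2 * volume {x | (2:ℝ≥0∞) ^ k / 2 < Mx g x}) := by
      rw [← mul_assoc, ENNReal.mul_div_cancel (by norm_num) (by norm_num)]
    _ ≤ 2 * (5 ^ n * om n * ∫⁻ x, g x) := by
      exact mul_le_mul' le_rfl (weak g _)
    _ = _ := by ring

/-- strong type bound for the maximal function -/
lemma strong (n : ℕ) {t : ℝ} (ht : 1 < t) : ∃ C : ℝ≥0∞, C ≠ ∞ ∧ ∀ h : Rn n → ℝ≥0∞, Measurable h →
    ∫⁻ x, (Mx h x) ^ t ≤ C * ∫⁻ x, (h x) ^ t := by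
  have ht1 : 0 < t - 1 := by linarith
  have hom' : 2 * om n ≠ ∞ := ENNReal.mul_ne_top (by norm_num) (om_ne_top n)
  refine ⟨2 ^ t * (2 * (5 ^ n * om n) * (geo (t-1) * (2 * om n) ^ (t-1))), ?_, fun h hh => ?_⟩
  · refine ENNReal.mul_ne_top (by simp) (ENNReal.mul_ne_top (ENNReal.mul_ne_top (by norm_num)
      (ENNReal.mul_ne_top (by simp) (om_ne_top n))) (ENNReal.mul_ne_top (geo_ne_top ht1) ?_))
    exact ENNReal.rpow_ne_top_of_nonneg ht1.le hom'
  calc _ ≤ ∫⁻ x, 2 ^ t * ∑' k : ℤ, (2:ℝ≥0∞) ^ ((k:ℝ) * t) * dk k (Mx h x) :=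
        lintegral_mono fun x => d1 _ (by linarith)
    _ = 2 ^ t * ∑' k : ℤ, (2:ℝ≥0∞) ^ ((k:ℝ) * t) * ∫⁻ x, dk k (Mx h x) := by
        rw [lintegral_const_mul' _ _ (by simp), lintegral_tsum]
        · congr 2
          funext k
          rw [lintegral_const_mul]
          exact (dk_measurable k).comp (measurable_Mx hh)
        · intro k
          exact (((dk_measurable k).comp (measurable_Mx hh)).const_mul _).aemeasurable
    _ ≤ 2 ^ t * ∑' k : ℤ, (2:ℝ≥0∞) ^ ((k:ℝ) * (t-1)) * (2 * (5 ^ n * om n) * ∫⁻ x, h x * dk k (2 * om n * h x)) := by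
        refine mul_le_mul' le_rfl (ENNReal.tsum_le_tsum fun k => ?_)
        have := strong_level hh k
        calc (2:ℝ≥0∞) ^ ((k:ℝ) * t) * ∫⁻ x, dk k (Mx h x) = (2:ℝ≥0∞) ^ ((k:ℝ) * (t-1)) * ((2:ℝ≥0∞) ^ k * ∫⁻ x, dk k (Mx h x)) := by
              rw [← mul_assoc]
              congr 1
              rw [← ENNReal.rpow_intCast, ← ENNReal.rpow_add _ _ (by norm_num) (by norm_num)]
              congr 1; ring
          _ ≤ _ := mul_le_mul' le_rfl this
    _ = 2 ^ t * (2 * (5 ^ n * om n) * ∫⁻ x, h x * ∑' k : ℤ, (2:ℝ≥0∞) ^ ((k:ℝ) * (t-1)) * dk k (2 * om n * h x)) := by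
        congr 1
        rw [show (fun x => h x * ∑' k : ℤ, (2:ℝ≥0∞) ^ ((k:ℝ) * (t-1)) * dk k (2 * om n * h x)) =
          fun x => ∑' k : ℤ, (2:ℝ≥0∞) ^ ((k:ℝ) * (t-1)) * (h x * dk k (2 * om n * h x)) by
            funext x; rw [← ENNReal.tsum_mul_left]; congr 1; funext k; ring]
        have hm : ∀ k : ℤ, Measurable fun x => h x * dk k (2 * om n * h x) := fun k =>
          hh.mul ((dk_measurable k).comp (hh.const_mul _))
        rw [lintegral_tsum fun k => ((hm k).const_mul _).aemeasurable, ← ENNReal.tsum_mul_left]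
        congr 1
        funext k
        rw [lintegral_const_mul _ (hm k)]
        ring
    _ ≤ 2 ^ t * (2 * (5 ^ n * om n) * ∫⁻ x, (geo (t-1) * (2 * om n) ^ (t-1)) * (h x) ^ t) := by
        refine mul_le_mul' le_rfl (mul_le_mul' le_rfl (lintegral_mono fun x => ?_))
        calc _ ≤ h x * (geo (t-1) * (2 * om n * h x) ^ (t-1)) := by
              exact mul_le_mul' le_rfl (d2 _ ht1)
          _ = (geo (t-1) * (2 * om n) ^ (t-1)) * (h x ^ (1:ℝ) * (h x) ^ (t-1)) := by
              rw [ENNReal.mul_rpow_of_nonneg _ _ ht1.le, ENNReal.rpow_one]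
              ring
          _ = _ := by
              rw [← ENNReal.rpow_add_of_nonneg _ _ (by norm_num) ht1.le, show 1 + (t - 1) = t by ring]
    _ = _ := by
        rw [lintegral_const_mul _ (hh.pow_const _)]
        ring


lemma two_rpow (t : ℝ) : (2:ℝ≥0∞) ^ t = ENNReal.ofReal ((2:ℝ) ^ t) := by
  rw [← ENNReal.ofReal_rpow_of_pos (by norm_num)]
  norm_num

/-- `1 + 2^l |x|` -/
def bb {n : ℕ} (l : ℕ) (x : Rn n) : ℝ≥0∞ := ENNReal.ofReal (1 + 2 ^ l * ‖x‖)

/-- kernel -/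
def ker {n : ℕ} (A : ℝ) (l : ℕ) (x : Rn n) : ℝ≥0∞ := (2:ℝ≥0∞) ^ (l * n) * (bb l x) ^ (-A)

/-- convolution with the kernel -/
def cv {n : ℕ} (A : ℝ) (l : ℕ) (h : Rn n → ℝ≥0∞) (x : Rn n) : ℝ≥0∞ := ∫⁻ z, ker A l (x - z) * h z

lemma one_le_bb {n : ℕ} (l : ℕ) (x : Rn n) : 1 ≤ bb l x := by
  unfold bb
  rw [← ENNReal.ofReal_one]
  apply ENNReal.ofReal_le_ofReal
  have : 0 ≤ 2 ^ l * ‖x‖ := by positivity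
  linarith

lemma bb_ne_zero {n : ℕ} (l : ℕ) (x : Rn n) : bb l x ≠ 0 := (lt_of_lt_of_le one_pos (one_le_bb l x)).ne'
lemma bb_ne_top {n : ℕ} (l : ℕ) (x : Rn n) : bb l x ≠ ∞ := ENNReal.ofReal_ne_top

lemma bb_neg {n : ℕ} (l : ℕ) (x : Rn n) : bb l (-x) = bb l x := by simp [bb]
lemma bb_comm {n : ℕ} (l : ℕ) (x y : Rn n) : bb l (x - y) = bb l (y - x) := by
  rw [← bb_neg, neg_sub]

lemma ker_comm {n : ℕ} (A : ℝ) (l : ℕ) (x y : Rn n) : ker A l (x - y) = ker A l (y - x) := by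
  rw [ker, ker, bb_comm]

lemma measurable_bb {n : ℕ} (l : ℕ) : Measurable (bb (n := n) l) := by
  unfold bb
  fun_prop

lemma measurable_ker {n : ℕ} (A : ℝ) (l : ℕ) : Measurable (ker (n := n) A l) :=
  ((measurable_bb l).pow_const _).const_mul _

lemma measurable_ker_sub {n : ℕ} (A : ℝ) (l : ℕ) : Measurable (fun q : Rn n × Rn n => ker A l (q.1 - q.2)) :=
  (measurable_ker A l).comp (measurable_fst.sub measurable_snd)

lemma measurable_ker_left {n : ℕ} (A : ℝ) (l : ℕ) (x : Rn n) : Measurable (fun z : Rn n => ker A l (x - z)) :=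
  (measurable_ker A l).comp (measurable_const.sub measurable_id)

lemma measurable_cv {n : ℕ} (A : ℝ) (l : ℕ) {h : Rn n → ℝ≥0∞} (hh : Measurable h) :
    Measurable (cv A l h) := by
  unfold cv
  refine Measurable.lintegral_prod_right' (f := fun q : Rn n × Rn n => ker A l (q.1 - q.2) * h q.2) ?_
  exact (measurable_ker_sub A l).mul (hh.comp measurable_snd)

lemma ker_shell {n : ℕ} (l : ℕ) (x z : Rn n) : ker (n + 1) l (x - z) ≤
    2 ^ (n + 1) * ∑' i : ℕ, (2:ℝ≥0∞) ^ (-((1:ℝ) * i)) * ((ENNReal.ofReal (((2:ℝ) ^ ((i:ℤ) - l)) ^ n))⁻¹ *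
      (closedBall x ((2:ℝ) ^ ((i:ℤ) - l))).indicator 1 z) := by
  have hex : ∃ i : ℕ, 2 ^ l * ‖x - z‖ ≤ (2:ℝ) ^ i := by
    obtain ⟨i, hi⟩ := pow_unbounded_of_one_lt (2 ^ l * ‖x - z‖) (one_lt_two (α := ℝ))
    exact ⟨i, hi.le⟩
  classical
  set i := Nat.find hex with hi
  have h1 : 2 ^ l * ‖x - z‖ ≤ (2:ℝ) ^ i := Nat.find_spec hex
  have h2 : (2:ℝ) ^ ((i:ℝ) - 1) ≤ 1 + 2 ^ l * ‖x - z‖ := by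
    rcases Nat.eq_zero_or_pos i with h0 | h0
    · rw [h0]
      have : (2:ℝ) ^ (((0:ℕ):ℝ) - 1) ≤ 1 := Real.rpow_le_one_of_one_le_of_nonpos (by norm_num) (by norm_num)
      have h4 : 0 ≤ 2 ^ l * ‖x - z‖ := by positivity
      linarith
    · have := Nat.find_min hex (m := i - 1) (by omega)
      rw [not_le] at this
      have h3 : (2:ℝ) ^ ((i:ℝ) - 1) = 2 ^ (i - 1) := by
        rw [← Real.rpow_natCast]
        congr 1
        push_cast [Nat.cast_sub (show 1 ≤ i from h0)]
        ring
      rw [h3]; linarith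
  have h3 : (2:ℝ≥0∞) ^ ((i:ℝ) - 1) ≤ bb l (x - z) := by
    rw [two_rpow]
    exact ENNReal.ofReal_le_ofReal h2
  have hmem : z ∈ closedBall x ((2:ℝ) ^ ((i:ℤ) - l)) := by
    rw [mem_closedBall, dist_comm, dist_eq_norm, zpow_sub₀ (by norm_num), le_div_iff₀ (by positivity)]
    simp only [zpow_natCast]
    linarith
  have h5 : ENNReal.ofReal (((2:ℝ) ^ ((i:ℤ) - l)) ^ n) = (2:ℝ≥0∞) ^ (((i:ℝ) - l) * n) := by
    rw [two_rpow, Real.rpow_mul (by norm_num), Real.rpow_natCast]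
    congr 2
    rw [← Real.rpow_intCast]
    push_cast
    rfl
  refine le_trans ?_ (mul_le_mul' le_rfl (ENNReal.le_tsum i))
  rw [Set.indicator_of_mem hmem, Pi.one_apply, mul_one, h5]
  unfold ker
  calc _ ≤ (2:ℝ≥0∞) ^ (l * n) * ((2:ℝ≥0∞) ^ ((i:ℝ) - 1)) ^ (-((n:ℝ) + 1)) := by
        refine mul_le_mul' le_rfl ?_
        rw [ENNReal.rpow_neg, ENNReal.rpow_neg]
        exact ENNReal.inv_le_inv.2 (ENNReal.rpow_le_rpow h3 (by positivity))
    _ = _ := by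
        rw [← ENNReal.rpow_neg, ← ENNReal.rpow_mul, ← ENNReal.rpow_natCast, ← ENNReal.rpow_natCast 2 (n+1)]
        rw [← ENNReal.rpow_add _ _ (by norm_num) (by norm_num), ← ENNReal.rpow_add _ _ (by norm_num) (by norm_num),
          ← ENNReal.rpow_add _ _ (by norm_num) (by norm_num)]
        congr 1
        push_cast
        ring

/-- constant -/
def Ck (n : ℕ) : ℝ≥0∞ := 2 ^ (n + 1) * geo 1

lemma Ck_ne_top (n : ℕ) : Ck n ≠ ∞ := ENNReal.mul_ne_top (by simp) (geo_ne_top one_pos)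

lemma cv_le_Mx {n : ℕ} (l : ℕ) {h : Rn n → ℝ≥0∞} (hh : Measurable h) (x : Rn n) :
    cv (n + 1) l h x ≤ Ck n * Mx h x := by
  unfold cv
  calc _ ≤ ∫⁻ z, 2 ^ (n + 1) * ∑' i : ℕ, (2:ℝ≥0∞) ^ (-((1:ℝ) * i)) * ((ENNReal.ofReal (((2:ℝ) ^ ((i:ℤ) - l)) ^ n))⁻¹ *
      (closedBall x ((2:ℝ) ^ ((i:ℤ) - l))).indicator h z) := by
        refine lintegral_mono fun z => ?_
        refine (mul_le_mul' (ker_shell l x z) le_rfl).trans_eq ?_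
        rw [mul_assoc, ← ENNReal.tsum_mul_right]
        congr 3
        funext i
        rw [mul_assoc, mul_assoc]
        congr 2
        by_cases hz : z ∈ closedBall x ((2:ℝ) ^ ((i:ℤ) - l))
        · rw [indicator_of_mem hz, indicator_of_mem hz]; simp
        · rw [indicator_of_notMem hz, indicator_of_notMem hz]; simp
    _ = 2 ^ (n + 1) * ∑' i : ℕ, (2:ℝ≥0∞) ^ (-((1:ℝ) * i)) * av ((i:ℤ) - l) h x := by
        have hm : ∀ i : ℕ, Measurable ((closedBall x ((2:ℝ) ^ ((i:ℤ) - l))).indicator h) := fun i =>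
          hh.indicator measurableSet_closedBall
        rw [lintegral_const_mul' _ _ (by simp), lintegral_tsum fun i =>
          (((hm i).const_mul _).const_mul _).aemeasurable]
        congr 2
        funext i
        rw [lintegral_const_mul _ ((hm i).const_mul _), lintegral_const_mul _ (hm i),
          lintegral_indicator measurableSet_closedBall]
        rfl
    _ ≤ 2 ^ (n + 1) * ∑' i : ℕ, (2:ℝ≥0∞) ^ (-((1:ℝ) * i)) * Mx h x := by
        refine mul_le_mul' le_rfl (ENNReal.tsum_le_tsum fun i => mul_le_mul' le_rfl ?_)
        exact le_iSup (fun k => av k h x) _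
    _ = _ := by
        rw [ENNReal.tsum_mul_right, tsum_geo, Ck]
        ring

lemma Mx_one {n : ℕ} (x : Rn n) : Mx (fun _ => 1) x ≤ om n := by
  have := Mx_const_add (fun _ : Rn n => 1) (fun _ => 0) 1 (by simp) measurable_const x
  simpa [Mx, av] using this

/-- constant -/
def Ci (n : ℕ) : ℝ≥0∞ := Ck n * om n
lemma Ci_ne_top (n : ℕ) : Ci n ≠ ∞ := ENNReal.mul_ne_top (Ck_ne_top n) (om_ne_top n)

lemma int_ker {n : ℕ} (l : ℕ) (x : Rn n) : ∫⁻ z, ker (n + 1) l (x - z) ≤ Ci n := by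
  have := (cv_le_Mx l measurable_const x).trans (mul_le_mul' le_rfl (Mx_one x))
  simpa [cv, Ci] using this

lemma cv_symm {n : ℕ} (A : ℝ) (l : ℕ) {g h : Rn n → ℝ≥0∞} (hg : Measurable g) (hh : Measurable h) :
    ∫⁻ x, cv A l g x * h x = ∫⁻ x, g x * cv A l h x := by
  unfold cv
  calc _ = ∫⁻ x, ∫⁻ z, ker A l (x - z) * g z * h x := by
        refine lintegral_congr fun x => ?_
        rw [lintegral_mul_const]
        exact (measurable_ker_left _ l x).mul hg
    _ = ∫⁻ z, ∫⁻ x, ker A l (x - z) * g z * h x := by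
        rw [lintegral_lintegral_swap]
        refine Measurable.aemeasurable ?_
        exact ((measurable_ker_sub A l).mul (hg.comp measurable_snd)).mul (hh.comp measurable_fst)
    _ = _ := by
        refine lintegral_congr fun x => ?_
        rw [← lintegral_const_mul]
        · refine lintegral_congr fun z => ?_
          rw [ker_comm]; ring
        · exact (measurable_ker_left _ l x).mul hh

lemma cv_holder {n : ℕ} (l : ℕ) {h : Rn n → ℝ≥0∞} (hh : Measurable h) {u : ℝ} (hu : 1 < u) (x : Rn n) :
    (cv (n + 1) l h x) ^ u ≤ (Ci n) ^ (u - 1) * cv (n + 1) l (fun z => h z ^ u) x := by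
  have hk : Measurable fun z => ker (n + 1) l (x - z) :=
    measurable_ker_left _ l x
  have hpq := Real.HolderConjugate.conjExponent hu
  have key := ENNReal.lintegral_mul_le_Lp_mul_Lq ((volume : Measure (Rn n)).withDensity (fun z => ker (n + 1) l (x - z)))
    hpq (f := h) (g := fun _ => 1) hh.aemeasurable aemeasurable_const
  simp only [Pi.mul_apply, mul_one, ENNReal.one_rpow] at key
  rw [lintegral_withDensity_eq_lintegral_mul _ hk hh, lintegral_withDensity_eq_lintegral_mul _ hk (hh.pow_const _),
    lintegral_withDensity_eq_lintegral_mul _ hk measurable_const] at key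
  simp only [Pi.mul_apply, mul_one] at key
  have h0 : 0 < u := by linarith
  calc _ ≤ _ := ENNReal.rpow_le_rpow key h0.le
    _ = cv (n + 1) l (fun z => h z ^ u) x * (∫⁻ z, ker (n + 1) l (x - z)) ^ (u - 1) := by
        rw [ENNReal.mul_rpow_of_nonneg _ _ h0.le, ← ENNReal.rpow_mul, ← ENNReal.rpow_mul]
        rw [one_div_mul_cancel h0.ne', ENNReal.rpow_one]
        congr 2
        rw [Real.conjExponent]
        field_simp
    _ ≤ _ := by
        rw [mul_comm]
        exact mul_le_mul' (ENNReal.rpow_le_rpow (int_ker l x) (by linarith)) le_rfl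

lemma absorb {X Y D : ℝ≥0∞} {v : ℝ} (hv : 1 < v) (hX : X ≠ ∞)
    (h : X ≤ D * Y ^ (1 / v) * X ^ (1 - 1 / v)) : X ≤ D ^ v * Y := by
  rcases eq_or_ne X 0 with rfl | hX0
  · exact zero_le
  have hv0 : 0 < v := by linarith
  have h1 : X ^ (1 / v) ≤ D * Y ^ (1 / v) := by
    have h2 := mul_le_mul' h (le_refl (X ^ (-(1 - 1 / v))))
    rw [mul_assoc, ← ENNReal.rpow_add _ _ hX0 hX, add_neg_cancel, ENNReal.rpow_zero, mul_one] at h2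
    refine le_trans (le_of_eq ?_) h2
    nth_rewrite 2 [← ENNReal.rpow_one X]
    rw [← ENNReal.rpow_add _ _ hX0 hX]
    congr 1; ring
  have h3 := ENNReal.rpow_le_rpow h1 hv0.le
  rw [ENNReal.mul_rpow_of_nonneg _ _ hv0.le, ← ENNReal.rpow_mul, ← ENNReal.rpow_mul,
    one_div_mul_cancel hv0.ne', ENNReal.rpow_one, ENNReal.rpow_one] at h3
  exact h3

/-- truncation -/
def tr {n : ℕ} (N : ℕ) (T : Rn n → ℝ≥0∞) (x : Rn n) : ℝ≥0∞ := if ‖x‖ ≤ N then min (T x) N else 0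

/-- truncation of a sequence -/
def TR {n : ℕ} (N : ℕ) (F : ℕ → Rn n → ℝ≥0∞) (j : ℕ) (x : Rn n) : ℝ≥0∞ :=
  if j < N then tr N (F j) x else 0

lemma tr_le {n : ℕ} (N : ℕ) (T : Rn n → ℝ≥0∞) (x : Rn n) : tr N T x ≤ T x := by
  unfold tr; split_ifs
  · exact min_le_left _ _
  · exact zero_le

lemma TR_le {n : ℕ} (N : ℕ) (F : ℕ → Rn n → ℝ≥0∞) (j : ℕ) (x : Rn n) : TR N F j x ≤ F j x := by
  unfold TR; split_ifs
  · exact tr_le _ _ _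
  · exact zero_le

lemma tr_mono {n : ℕ} {N M : ℕ} (h : N ≤ M) (T : Rn n → ℝ≥0∞) (x : Rn n) : tr N T x ≤ tr M T x := by
  have h' : (N:ℝ) ≤ M := by exact_mod_cast h
  unfold tr
  by_cases h1 : ‖x‖ ≤ N
  · rw [if_pos h1, if_pos (h1.trans h')]
    exact min_le_min le_rfl (by exact_mod_cast h)
  · rw [if_neg h1]; exact zero_le

lemma TR_mono {n : ℕ} {N M : ℕ} (h : N ≤ M) (F : ℕ → Rn n → ℝ≥0∞) (j : ℕ) (x : Rn n) :
    TR N F j x ≤ TR M F j x := by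
  unfold TR
  by_cases h1 : j < N
  · rw [if_pos h1, if_pos (h1.trans_le h)]
    exact tr_mono h _ _
  · rw [if_neg h1]; exact zero_le

lemma iSup_TR {n : ℕ} (F : ℕ → Rn n → ℝ≥0∞) (j : ℕ) (x : Rn n) : ⨆ N, TR N F j x = F j x := by
  refine le_antisymm (iSup_le fun N => TR_le N F j x) ?_
  refine le_of_forall_lt fun c hc => ?_
  obtain ⟨N1, hN1⟩ := exists_nat_ge ‖x‖
  obtain ⟨N2, hN2⟩ := ENNReal.exists_nat_gt (ne_top_of_lt hc)
  set N := max (j + 1) (max N1 N2)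
  refine lt_of_lt_of_le ?_ (le_iSup _ N)
  unfold TR tr
  rw [if_pos (by omega), if_pos (hN1.trans (by exact_mod_cast (by omega : N1 ≤ N)))]
  refine lt_min hc (hN2.trans_le (by exact_mod_cast (by omega : N2 ≤ N)))

lemma measurable_tr {n : ℕ} (N : ℕ) {T : Rn n → ℝ≥0∞} (hT : Measurable T) : Measurable (tr N T) :=
  Measurable.ite (measurableSet_le measurable_norm measurable_const) (hT.min measurable_const) measurable_const

lemma measurable_TR {n : ℕ} (N : ℕ) {F : ℕ → Rn n → ℝ≥0∞} (hT : ∀ j, Measurable (F j)) (j : ℕ) :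
    Measurable (TR N F j) := by
  unfold TR
  split_ifs
  · exact measurable_tr N (hT j)
  · exact measurable_const

lemma lim2 {n : ℕ} {F : ℕ → Rn n → ℝ≥0∞} (hF : ∀ j, Measurable (F j)) {u w : ℝ} (hu : 0 < u) (hw : 0 < w)
    {B : ℝ≥0∞} (h : ∀ N, ∫⁻ x, (∑' j, (TR N F j x) ^ u) ^ w ≤ B) :
    ∫⁻ x, (∑' j, (F j x) ^ u) ^ w ≤ B := by
  have hmono : ∀ x, Monotone fun N => ∑' j, (TR N F j x) ^ u := fun x N M hNM =>
    ENNReal.tsum_le_tsum fun j => ENNReal.rpow_le_rpow (TR_mono hNM F j x) hu.le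
  have h1 : ∀ x, ∑' j, (F j x) ^ u = ⨆ N, ∑' j, (TR N F j x) ^ u := by
    intro x
    refine le_antisymm ?_ (iSup_le fun N => ENNReal.tsum_le_tsum fun j =>
      ENNReal.rpow_le_rpow (TR_le N F j x) hu.le)
    rw [ENNReal.tsum_eq_iSup_nat]
    refine iSup_le fun J => ?_
    have h2 : ∀ j, (F j x) ^ u = ⨆ N, (TR N F j x) ^ u := by
      intro j
      rw [← iSup_TR F j x]
      exact (ENNReal.orderIsoRpow u hu).map_iSup _
    simp_rw [h2]
    rw [ENNReal.finsetSum_iSup_of_monotone (fun j N M hNM => ENNReal.rpow_le_rpow (TR_mono hNM F j x) hu.le)]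
    exact iSup_mono fun N => ENNReal.sum_le_tsum _
  have h3 : ∀ x, (∑' j, (F j x) ^ u) ^ w = ⨆ N, (∑' j, (TR N F j x) ^ u) ^ w := by
    intro x
    rw [h1]
    exact (ENNReal.orderIsoRpow w hw).map_iSup _
  simp_rw [h3]
  rw [lintegral_iSup]
  · exact iSup_le h
  · intro N
    exact (Measurable.tsum fun j => (measurable_TR N hF j).pow_const u).pow_const w
  · intro N M hNM x
    exact ENNReal.rpow_le_rpow (hmono x hNM) hw.le

lemma TR_fin {n : ℕ} (F : ℕ → Rn n → ℝ≥0∞) {u w : ℝ} (hu : 0 < u) (hw : 0 < w) (N : ℕ) :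
    ∫⁻ x, (∑' j, (TR N F j x) ^ u) ^ w ≠ ∞ := by
  have h1 : ∀ x, (∑' j, (TR N F j x) ^ u) ^ w ≤ (closedBall (0 : Rn n) N).indicator
      (fun _ => ((N:ℝ≥0∞) * (N:ℝ≥0∞) ^ u) ^ w) x := by
    intro x
    by_cases hx : x ∈ closedBall (0 : Rn n) N
    · rw [indicator_of_mem hx]
      refine ENNReal.rpow_le_rpow ?_ hw.le
      rw [tsum_eq_sum (s := Finset.range N)]
      · calc _ ≤ ∑ j ∈ Finset.range N, (N:ℝ≥0∞) ^ u := by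
              refine Finset.sum_le_sum fun j _ => ENNReal.rpow_le_rpow ?_ hu.le
              unfold TR tr
              split_ifs
              · exact min_le_right _ _
              · exact zero_le
              · exact zero_le
          _ = _ := by simp
      · intro j hj
        rw [TR, if_neg (by simpa using hj), ENNReal.zero_rpow_of_pos hu]
    · rw [indicator_of_notMem hx]
      have : ∀ j, TR N F j x = 0 := by
        intro j
        unfold TR tr
        rw [if_neg (c := ‖x‖ ≤ N) (by simpa using hx)]
        simp
      simp [this, hu, hw]
  refine ne_top_of_le_ne_top ?_ (lintegral_mono h1)
  rw [lintegral_indicator measurableSet_closedBall, lintegral_const, Measure.restrict_apply_univ]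
  refine ENNReal.mul_ne_top ?_ measure_closedBall_lt_top.ne
  exact ENNReal.rpow_ne_top_of_nonneg hw.le (ENNReal.mul_ne_top (by simp) (ENNReal.rpow_ne_top_of_nonneg hu.le (by simp)))

lemma lim1 {n : ℕ} {T : Rn n → ℝ≥0∞} (hT : Measurable T) {w : ℝ} (hw : 0 < w) {B : ℝ≥0∞}
    (h : ∀ T' : Rn n → ℝ≥0∞, Measurable T' → (∀ x, T' x ≤ T x) → ∫⁻ x, (T' x) ^ w ≠ ∞ → ∫⁻ x, (T' x) ^ w ≤ B) :
    ∫⁻ x, (T x) ^ w ≤ B := by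
  set F : ℕ → Rn n → ℝ≥0∞ := fun j => if j = 0 then T else fun _ => 0 with hFd
  have hF : ∀ j, Measurable (F j) := by
    intro j
    simp only [hFd]
    split_ifs
    · exact hT
    · exact measurable_const
  have h1 : ∀ x, ∑' j, (F j x) ^ (1:ℝ) = T x := by
    intro x
    rw [tsum_eq_single 0]
    · simp [hFd]
    · intro j hj; simp [hFd, hj]
  have h2 : ∀ N x, ∑' j, (TR N F j x) ^ (1:ℝ) = TR N F 0 x := by
    intro N x
    rw [tsum_eq_single 0]
    · simp
    · intro j hj
      have := TR_le N F j x
      simp only [hFd, hj, if_false] at this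
      simpa using this
  have := lim2 hF one_pos hw (B := B) (fun N => by
    have hfin := TR_fin F one_pos hw N
    simp_rw [h2] at hfin ⊢
    exact h _ (measurable_TR N hF 0) (fun x => (TR_le N F 0 x).trans_eq (by simp [hFd])) hfin)
  simpa only [h1] using this

lemma dual_Mx (n : ℕ) {m : ℝ} (hm : 1 < m) (D : ℝ≥0∞) (hD : D ≠ ∞) : ∃ C : ℝ≥0∞, C ≠ ∞ ∧
    ∀ T G : Rn n → ℝ≥0∞, Measurable T → Measurable G →
    (∀ h : Rn n → ℝ≥0∞, Measurable h → ∫⁻ x, T x * h x ≤ D * ∫⁻ x, G x * Mx h x) →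
    ∫⁻ x, (T x) ^ m ≤ C * ∫⁻ x, (G x) ^ m := by
  have hpq := Real.HolderConjugate.conjExponent hm
  have hm' := hpq.symm.lt
  set m' := m.conjExponent with hm'd
  obtain ⟨C, hC, hs⟩ := strong n hm'
  have hm0 : 0 < m := by linarith
  have hm0' : 0 < m' := by linarith
  refine ⟨(D * C ^ (1 / m')) ^ m, ?_, fun T G hT hG hTG => ?_⟩
  · exact ENNReal.rpow_ne_top_of_nonneg hm0.le (ENNReal.mul_ne_top hD
      (ENNReal.rpow_ne_top_of_nonneg (by positivity) hC))
  refine lim1 hT hm0 fun T' hT' hTT hfin => absorb hm hfin ?_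
  have hmm : (m - 1) * m' = m := by
    rw [hm'd, Real.conjExponent]
    have : m - 1 ≠ 0 := by linarith
    field_simp
  have hh : Measurable fun x => (T' x) ^ (m - 1) := hT'.pow_const _
  calc ∫⁻ x, (T' x) ^ m = ∫⁻ x, T' x * (T' x) ^ (m - 1) := by
        refine lintegral_congr fun x => ?_
        nth_rewrite 2 [← ENNReal.rpow_one (T' x)]
        rw [← ENNReal.rpow_add_of_nonneg _ _ (by norm_num) (by linarith)]
        congr 1; ring
    _ ≤ ∫⁻ x, T x * (T' x) ^ (m - 1) := lintegral_mono fun x => mul_le_mul' (hTT x) le_rfl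
    _ ≤ _ := hTG _ hh
    _ ≤ D * ((∫⁻ x, (G x) ^ m) ^ (1 / m) * (∫⁻ x, (Mx (fun x => (T' x) ^ (m - 1)) x) ^ m') ^ (1 / m')) :=
        mul_le_mul' le_rfl (ENNReal.lintegral_mul_le_Lp_mul_Lq volume hpq hG.aemeasurable (measurable_Mx hh).aemeasurable)
    _ ≤ D * ((∫⁻ x, (G x) ^ m) ^ (1 / m) * (C * ∫⁻ x, ((T' x) ^ (m - 1)) ^ m') ^ (1 / m')) :=
        mul_le_mul' le_rfl (mul_le_mul' le_rfl (ENNReal.rpow_le_rpow (hs _ hh) (by positivity)))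
    _ = _ := by
        simp_rw [← ENNReal.rpow_mul, hmm]
        rw [ENNReal.mul_rpow_of_nonneg _ _ (by positivity)]
        rw [show 1 / m' = 1 - 1 / m from ?_]
        · ring
        · rw [one_div, one_div, ← hpq.one_sub_inv]

lemma VV_le (n : ℕ) {u v : ℝ} (hu : 1 < u) (huv : u ≤ v) : ∃ C : ℝ≥0∞, C ≠ ∞ ∧
    ∀ g : ℕ → Rn n → ℝ≥0∞, (∀ j, Measurable (g j)) →
    ∫⁻ x, (∑' j, (cv (n + 1) j (g j) x) ^ u) ^ (v / u) ≤ C * ∫⁻ x, (∑' j, (g j x) ^ u) ^ (v / u) := by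
  have hu0 : 0 < u := by linarith
  have hm : 1 ≤ v / u := (one_le_div hu0).2 huv
  have hCi : (Ci n) ^ (u - 1) ≠ ∞ := ENNReal.rpow_ne_top_of_nonneg (by linarith) (Ci_ne_top n)
  have red : ∀ g : ℕ → Rn n → ℝ≥0∞, (∀ j, Measurable (g j)) →
      ∫⁻ x, (∑' j, (cv (n + 1) j (g j) x) ^ u) ^ (v / u) ≤ ((Ci n) ^ (u - 1)) ^ (v / u) *
        ∫⁻ x, (∑' j, (cv (n + 1) j (fun z => g j z ^ u) x)) ^ (v / u) := by
    intro g hg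
    rw [← lintegral_const_mul' _ _ (ENNReal.rpow_ne_top_of_nonneg (by linarith) hCi)]
    refine lintegral_mono fun x => ?_
    rw [← ENNReal.mul_rpow_of_nonneg _ _ (by linarith), ← ENNReal.tsum_mul_left]
    exact ENNReal.rpow_le_rpow (ENNReal.tsum_le_tsum fun j => cv_holder j (hg j) hu x) (by linarith)
  have dualid : ∀ (G : ℕ → Rn n → ℝ≥0∞), (∀ j, Measurable (G j)) → ∀ h : Rn n → ℝ≥0∞, Measurable h →
      ∫⁻ x, (∑' j, cv (n + 1) j (G j) x) * h x ≤ Ck n * ∫⁻ x, (∑' j, G j x) * Mx h x := by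
    intro G hG h hh
    rw [← lintegral_const_mul' _ _ (Ck_ne_top n)]
    simp_rw [← ENNReal.tsum_mul_right, ← ENNReal.tsum_mul_left]
    rw [lintegral_tsum (f := fun j x => cv (n + 1) j (G j) x * h x)
        fun j => ((measurable_cv _ j (hG j)).mul hh).aemeasurable,
      lintegral_tsum (f := fun j x => Ck n * (G j x * Mx h x))
        fun j => (((hG j).mul (measurable_Mx hh)).const_mul _).aemeasurable]
    refine ENNReal.tsum_le_tsum fun j => ?_
    rw [cv_symm _ _ (hG j) hh]
    refine lintegral_mono fun x => ?_
    calc _ ≤ G j x * (Ck n * Mx h x) := mul_le_mul' le_rfl (cv_le_Mx j hh x)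
      _ = _ := by ring
  rcases hm.eq_or_lt with h1 | h1
  · refine ⟨(Ci n) ^ (u - 1) * (Ck n * om n), ENNReal.mul_ne_top hCi (Ci_ne_top n), fun g hg => ?_⟩
    have h2 := red g hg
    have h3 := dualid (fun j z => g j z ^ u) (fun j => (hg j).pow_const _) (fun _ => 1) measurable_const
    simp only [← h1, ENNReal.rpow_one, mul_one] at h2 h3 ⊢
    refine h2.trans ?_
    rw [mul_assoc]
    refine mul_le_mul' le_rfl (h3.trans ?_)
    rw [mul_assoc]
    refine mul_le_mul' le_rfl ?_
    rw [mul_comm, ← lintegral_mul_const' _ _ (om_ne_top n)]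
    exact lintegral_mono fun x => mul_le_mul' le_rfl (Mx_one x)
  · obtain ⟨C, hC, hd⟩ := dual_Mx n h1 (Ck n) (Ck_ne_top n)
    refine ⟨((Ci n) ^ (u - 1)) ^ (v / u) * C, ENNReal.mul_ne_top
      (ENNReal.rpow_ne_top_of_nonneg (by linarith) hCi) hC, fun g hg => ?_⟩
    have hg' : ∀ j, Measurable fun z => g j z ^ u := fun j => (hg j).pow_const _
    rw [mul_assoc]
    refine (red g hg).trans (mul_le_mul' le_rfl ?_)
    exact hd _ _ (Measurable.tsum fun j => measurable_cv _ j (hg' j))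
      (Measurable.tsum hg') (dualid _ hg')

lemma tsum_holder {u u' : ℝ} (h : u.HolderConjugate u') (a b : ℕ → ℝ≥0∞) :
    ∑' j, a j * b j ≤ (∑' j, a j ^ u) ^ (1 / u) * (∑' j, b j ^ u') ^ (1 / u') := by
  have := ENNReal.lintegral_mul_le_Lp_mul_Lq Measure.count h (f := a) (g := b)
    (Measurable.of_discrete).aemeasurable (Measurable.of_discrete).aemeasurable
  simpa only [lintegral_count, Pi.mul_apply] using this

lemma VV_lt (n : ℕ) {u v : ℝ} (hv : 1 < v) (huv : v < u) : ∃ C : ℝ≥0∞, C ≠ ∞ ∧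
    ∀ g : ℕ → Rn n → ℝ≥0∞, (∀ j, Measurable (g j)) →
    ∫⁻ x, (∑' j, (cv (n + 1) j (g j) x) ^ u) ^ (v / u) ≤ C * ∫⁻ x, (∑' j, (g j x) ^ u) ^ (v / u) := by
  have hu : 1 < u := hv.trans huv
  have hpv := Real.HolderConjugate.conjExponent hv
  have hpu := Real.HolderConjugate.conjExponent hu
  have hv1 := hpv.symm.lt
  have hu1 := hpu.symm.lt
  have hv' : v.conjExponent = v / (v - 1) := rfl
  have hu' : u.conjExponent = u / (u - 1) := rfl
  set v' := v.conjExponent with hv'd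
  set u' := u.conjExponent with hu'd
  have hu10 : 0 < u - 1 := by linarith
  have hv10 : 0 < v - 1 := by linarith
  have hle : u' ≤ v' := by
    rw [hv', hu', div_le_div_iff₀ (by linarith) (by linarith)]
    nlinarith
  obtain ⟨C, hC, hV⟩ := VV_le n hu1 hle
  have hv0 : 0 < v := by linarith
  have hu0 : 0 < u := by linarith
  have hv0' : 0 < v' := by linarith
  have hu0' : 0 < u' := by linarith
  refine ⟨(C ^ (1 / v')) ^ v, ENNReal.rpow_ne_top_of_nonneg hv0.le
    (ENNReal.rpow_ne_top_of_nonneg (by positivity) hC), fun g hg => ?_⟩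
  have hcm : ∀ j, Measurable (cv (n + 1) j (g j)) := fun j => measurable_cv _ j (hg j)
  refine lim2 hcm hu0 (by positivity) fun N => absorb hv (TR_fin _ hu0 (by positivity) N) ?_
  set F := TR N (fun j => cv (n + 1) j (g j)) with hF
  have hFm : ∀ j, Measurable (F j) := measurable_TR N hcm
  set S : Rn n → ℝ≥0∞ := fun x => ∑' j, (F j x) ^ u with hS
  have hSm : Measurable S := Measurable.tsum fun j => (hFm j).pow_const u
  have hStop : ∀ x, S x ≠ ∞ := by
    intro x
    simp only [hS]
    rw [tsum_eq_sum (s := Finset.range N)]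
    · refine (ENNReal.sum_lt_top.2 fun j _ => ?_).ne
      refine ENNReal.rpow_lt_top_of_nonneg hu0.le ?_
      simp only [hF, TR, tr]
      split_ifs
      · exact ne_top_of_le_ne_top (by simp) (min_le_right _ _)
      · simp
      · simp
    · intro j hj
      rw [hF, TR, if_neg (by simpa using hj), ENNReal.zero_rpow_of_pos hu0]
  set h : ℕ → Rn n → ℝ≥0∞ := fun j x => (F j x) ^ (u - 1) * (S x) ^ ((v - u) / u) with hh
  have hhm : ∀ j, Measurable (h j) := fun j => ((hFm j).pow_const _).mul (hSm.pow_const _)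
  have e1 : ∀ x, (S x) ^ (v / u) = ∑' j, F j x * h j x := by
    intro x
    have : ∀ j, F j x * h j x = (F j x) ^ u * (S x) ^ ((v - u) / u) := by
      intro j
      simp only [hh]
      rw [← mul_assoc]
      congr 1
      nth_rewrite 1 [← ENNReal.rpow_one (F j x)]
      rw [← ENNReal.rpow_add_of_nonneg _ _ (by norm_num) hu10.le]
      congr 1; ring
    simp_rw [this]
    rw [ENNReal.tsum_mul_right]
    change _ = S x * _
    rcases eq_or_ne (S x) 0 with h0 | h0
    · rw [h0, zero_mul, ENNReal.zero_rpow_of_pos (by positivity)]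
    · nth_rewrite 2 [← ENNReal.rpow_one (S x)]
      rw [← ENNReal.rpow_add _ _ h0 (hStop x)]
      congr 1
      field_simp
      ring
  have e2 : ∀ x, (∑' j, (h j x) ^ u') ^ (v' / u') ≤ (S x) ^ (v / u) := by
    intro x
    have : ∀ j, (h j x) ^ u' = (F j x) ^ u * (S x) ^ ((v - u) / u * u') := by
      intro j
      simp only [hh]
      rw [ENNReal.mul_rpow_of_nonneg _ _ hu0'.le, ← ENNReal.rpow_mul, ← ENNReal.rpow_mul]
      congr 2
      rw [hu']; field_simp
    simp_rw [this]
    rw [ENNReal.tsum_mul_right]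
    change (S x * _) ^ _ ≤ _
    rcases eq_or_ne (S x) 0 with h0 | h0
    · rw [h0, zero_mul, ENNReal.zero_rpow_of_pos (by positivity)]
      exact zero_le
    · nth_rewrite 1 [← ENNReal.rpow_one (S x)]
      rw [← ENNReal.rpow_add _ _ h0 (hStop x), ← ENNReal.rpow_mul]
      refine le_of_eq ?_
      congr 1
      rw [hu', hv']
      field_simp
      ring
  calc ∫⁻ x, (S x) ^ (v / u) = ∫⁻ x, ∑' j, F j x * h j x := lintegral_congr e1
    _ ≤ ∫⁻ x, ∑' j, cv (n + 1) j (g j) x * h j x :=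
        lintegral_mono fun x => ENNReal.tsum_le_tsum fun j => mul_le_mul' (TR_le _ _ _ _) le_rfl
    _ = ∫⁻ x, ∑' j, g j x * cv (n + 1) j (h j) x := by
        rw [lintegral_tsum (f := fun j x => cv (n + 1) j (g j) x * h j x)
            fun j => ((hcm j).mul (hhm j)).aemeasurable,
          lintegral_tsum (f := fun j x => g j x * cv (n + 1) j (h j) x) fun j => ((hg j).mul (measurable_cv _ j (hhm j))).aemeasurable]
        exact tsum_congr fun j => cv_symm _ _ (hg j) (hhm j)
    _ ≤ ∫⁻ x, (∑' j, (g j x) ^ u) ^ (1 / u) * (∑' j, (cv (n + 1) j (h j) x) ^ u') ^ (1 / u') :=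
        lintegral_mono fun x => tsum_holder hpu _ _
    _ ≤ (∫⁻ x, ((∑' j, (g j x) ^ u) ^ (1 / u)) ^ v) ^ (1 / v) *
        (∫⁻ x, ((∑' j, (cv (n + 1) j (h j) x) ^ u') ^ (1 / u')) ^ v') ^ (1 / v') :=
        ENNReal.lintegral_mul_le_Lp_mul_Lq volume hpv
          ((Measurable.tsum fun j => (hg j).pow_const _).pow_const _).aemeasurable
          ((Measurable.tsum fun j => (measurable_cv _ j (hhm j)).pow_const _).pow_const _).aemeasurable
    _ ≤ (∫⁻ x, (∑' j, (g j x) ^ u) ^ (v / u)) ^ (1 / v) * (C * ∫⁻ x, (S x) ^ (v / u)) ^ (1 / v') := by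
        simp_rw [← ENNReal.rpow_mul, one_div_mul_eq_div]
        refine mul_le_mul' le_rfl (ENNReal.rpow_le_rpow ((hV h hhm).trans ?_) (by positivity))
        exact mul_le_mul' le_rfl (lintegral_mono e2)
    _ = _ := by
        rw [ENNReal.mul_rpow_of_nonneg _ _ (by positivity)]
        rw [show 1 / v' = 1 - 1 / v from ?_]
        · ring
        · rw [one_div, one_div, ← hpv.one_sub_inv]

/-- vector valued inequality -/
lemma VV (n : ℕ) {u v : ℝ} (hu : 1 < u) (hv : 1 < v) : ∃ C : ℝ≥0∞, C ≠ ∞ ∧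
    ∀ g : ℕ → Rn n → ℝ≥0∞, (∀ j, Measurable (g j)) →
    ∫⁻ x, (∑' j, (cv (n + 1) j (g j) x) ^ u) ^ (v / u) ≤ C * ∫⁻ x, (∑' j, (g j x) ^ u) ^ (v / u) := by
  rcases le_or_gt u v with h | h
  · exact VV_le n hu h
  · exact VV_lt n hv h

lemma VV_sup (n : ℕ) {v : ℝ} (hv : 1 < v) : ∃ C : ℝ≥0∞, C ≠ ∞ ∧
    ∀ g : ℕ → Rn n → ℝ≥0∞, (∀ j, Measurable (g j)) →
    ∫⁻ x, (⨆ j, cv (n + 1) j (g j) x) ^ v ≤ C * ∫⁻ x, (⨆ j, g j x) ^ v := by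
  obtain ⟨C, hC, hs⟩ := strong n hv
  have hv0 : 0 ≤ v := by linarith
  refine ⟨(Ck n) ^ v * C, ENNReal.mul_ne_top (ENNReal.rpow_ne_top_of_nonneg hv0 (Ck_ne_top n)) hC, fun g hg => ?_⟩
  have hm : Measurable fun x => ⨆ j, g j x := Measurable.iSup hg
  rw [mul_assoc]
  refine le_trans ?_ (mul_le_mul' le_rfl (hs _ hm))
  rw [← lintegral_const_mul' _ _ (ENNReal.rpow_ne_top_of_nonneg hv0 (Ck_ne_top n))]
  refine lintegral_mono fun x => ?_
  rw [← ENNReal.mul_rpow_of_nonneg _ _ hv0]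
  refine ENNReal.rpow_le_rpow (iSup_le fun j => ?_) hv0
  refine le_trans ?_ (cv_le_Mx j hm x)
  exact lintegral_mono fun z => mul_le_mul' le_rfl (le_iSup (fun j => g j z) j)

lemma rpow_tsum {r : ℝ} (hr : 0 < r) (hr1 : r ≤ 1) (a : ℕ → ℝ≥0∞) : (∑' k, a k) ^ r ≤ ∑' k, (a k) ^ r := by
  have hf : ∀ s : Finset ℕ, (∑ k ∈ s, a k) ^ r ≤ ∑ k ∈ s, (a k) ^ r := by
    intro s
    classical
    induction s using Finset.induction_on with
    | empty => simp [hr]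
    | insert i s hi ih =>
      rw [Finset.sum_insert hi, Finset.sum_insert hi]
      exact (ENNReal.rpow_add_le_add_rpow _ _ hr.le hr1).trans (add_le_add le_rfl ih)
  rw [ENNReal.tsum_eq_iSup_sum]
  have : (⨆ s : Finset ℕ, ∑ k ∈ s, a k) ^ r = ⨆ s : Finset ℕ, (∑ k ∈ s, a k) ^ r :=
    (ENNReal.orderIsoRpow r hr).map_iSup _
  rw [this]
  exact iSup_le fun s => (hf s).trans (ENNReal.sum_le_tsum s)

/-- Schur weight -/
def wt (e : ℝ) (j k : ℕ) : ℝ≥0∞ := (2:ℝ≥0∞) ^ (-(e * |(j:ℝ) - k|))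

lemma wt_comm (e : ℝ) (j k : ℕ) : wt e j k = wt e k j := by
  unfold wt; rw [abs_sub_comm]

lemma wt_row (e : ℝ) (j : ℕ) : ∑' k, wt e j k ≤ 2 * geo e := by
  have h1 : ∀ k, wt e j k ≤ (∑' i : ℕ, if k = j + i then (2:ℝ≥0∞) ^ (-(e * i)) else 0) +
      (∑' i : ℕ, if j = k + i then (2:ℝ≥0∞) ^ (-(e * i)) else 0) := by
    intro k
    rcases le_total j k with h | h
    · obtain ⟨i, rfl⟩ := Nat.exists_eq_add_of_le h
      refine le_trans ?_ le_self_add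
      refine le_trans ?_ (ENNReal.le_tsum i)
      rw [if_pos rfl, wt]
      refine le_of_eq ?_
      congr 3
      push_cast
      rw [sub_add_cancel_left, abs_neg, abs_of_nonneg (by positivity)]
    · obtain ⟨i, rfl⟩ := Nat.exists_eq_add_of_le h
      refine le_trans ?_ le_add_self
      refine le_trans ?_ (ENNReal.le_tsum i)
      rw [if_pos rfl, wt]
      refine le_of_eq ?_
      congr 3
      push_cast
      rw [add_sub_cancel_left, abs_of_nonneg (by positivity)]
  refine (ENNReal.tsum_le_tsum h1).trans ?_
  rw [ENNReal.tsum_add, two_mul, ← tsum_geo]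
  refine add_le_add ?_ ?_
  · rw [ENNReal.tsum_comm]
    refine ENNReal.tsum_le_tsum fun i => ?_
    rw [tsum_ite_eq]
  · rw [ENNReal.tsum_comm]
    refine ENNReal.tsum_le_tsum fun i => ?_
    by_cases h : i ≤ j
    · rw [tsum_eq_single (j - i)]
      · split_ifs <;> simp
      · intro k hk
        rw [if_neg (by omega)]
    · refine le_trans (le_of_eq ?_) zero_le
      rw [ENNReal.tsum_eq_zero]
      intro k
      rw [if_neg (by omega)]

lemma schur (e : ℝ) {u : ℝ} (hu : 1 < u) (a : ℕ → ℝ≥0∞) :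
    ∑' j, (∑' k, wt e j k * a k) ^ u ≤ (2 * geo e) ^ u * ∑' k, (a k) ^ u := by
  have hu0 : 0 < u := by linarith
  set W := 2 * geo e with hW
  have hpu := Real.HolderConjugate.conjExponent hu
  have h1 : ∀ j, (∑' k, wt e j k * a k) ^ u ≤ W ^ (u - 1) * ∑' k, wt e j k * (a k) ^ u := by
    intro j
    have := tsum_holder hpu (fun k => (wt e j k) ^ (1 / u) * a k) (fun k => (wt e j k) ^ (1 / u.conjExponent))
    have e1 : ∀ k, (wt e j k) ^ (1 / u) * a k * (wt e j k) ^ (1 / u.conjExponent) = wt e j k * a k := by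
      intro k
      calc _ = ((wt e j k) ^ (1 / u) * (wt e j k) ^ (1 / u.conjExponent)) * a k := by ring
        _ = _ := by
          rw [← ENNReal.rpow_add_of_nonneg _ _ (by positivity) (one_div_nonneg.2 hpu.symm.nonneg)]
          rw [one_div, one_div, hpu.inv_add_inv_eq_one, ENNReal.rpow_one]
    have hc0 : u.conjExponent ≠ 0 := hpu.symm.ne_zero
    simp_rw [e1, ENNReal.mul_rpow_of_nonneg _ _ hu0.le, ← ENNReal.rpow_mul, one_div_mul_cancel hu0.ne',
      one_div_mul_cancel hc0, ENNReal.rpow_one] at this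
    refine (ENNReal.rpow_le_rpow this hu0.le).trans ?_
    rw [ENNReal.mul_rpow_of_nonneg _ _ hu0.le, ← ENNReal.rpow_mul, ← ENNReal.rpow_mul,
      one_div_mul_cancel hu0.ne', ENNReal.rpow_one, mul_comm]
    refine mul_le_mul' ?_ le_rfl
    rw [show 1 / u.conjExponent * u = u - 1 by rw [Real.conjExponent]; field_simp]
    exact ENNReal.rpow_le_rpow (wt_row e j) (by linarith)
  calc _ ≤ ∑' j, W ^ (u - 1) * ∑' k, wt e j k * (a k) ^ u := ENNReal.tsum_le_tsum h1
    _ = W ^ (u - 1) * ∑' k, ∑' j, wt e j k * (a k) ^ u := by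
        rw [ENNReal.tsum_mul_left, ENNReal.tsum_comm]
    _ ≤ W ^ (u - 1) * ∑' k, W * (a k) ^ u := by
        refine mul_le_mul' le_rfl (ENNReal.tsum_le_tsum fun k => ?_)
        rw [ENNReal.tsum_mul_right]
        refine mul_le_mul' ?_ le_rfl
        simp_rw [wt_comm e _ k]
        exact wt_row e k
    _ = _ := by
        rw [ENNReal.tsum_mul_left, ← mul_assoc]
        congr 1
        nth_rewrite 2 [← ENNReal.rpow_one W]
        rw [← ENNReal.rpow_add_of_nonneg _ _ (by linarith) (by norm_num)]
        congr 1; ring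

lemma schur_sup (e : ℝ) (a : ℕ → ℝ≥0∞) :
    ⨆ j, (∑' k, wt e j k * a k) ≤ 2 * geo e * ⨆ k, a k := by
  refine iSup_le fun j => ?_
  calc _ ≤ ∑' k, wt e j k * ⨆ k, a k := ENNReal.tsum_le_tsum fun k => mul_le_mul' le_rfl (le_iSup a k)
    _ ≤ _ := by
      rw [ENNReal.tsum_mul_right]
      exact mul_le_mul' (wt_row e j) le_rfl

lemma bb_mono {n : ℕ} {k l : ℕ} (h : k ≤ l) (x : Rn n) : bb k x ≤ bb l x := by
  unfold bb
  apply ENNReal.ofReal_le_ofReal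
  have : (2:ℝ) ^ k ≤ 2 ^ l := pow_le_pow_right₀ (by norm_num) h
  have := mul_le_mul_of_nonneg_right this (norm_nonneg x)
  linarith

lemma bb_sub {n : ℕ} (l : ℕ) (x y z : Rn n) : bb l (x - z) ≤ bb l (x - y) * bb l (y - z) := by
  unfold bb
  rw [← ENNReal.ofReal_mul (by positivity)]
  apply ENNReal.ofReal_le_ofReal
  have h1 : ‖x - z‖ ≤ ‖x - y‖ + ‖y - z‖ := norm_sub_le_norm_sub_add_norm_sub x y z
  have h2 := mul_le_mul_of_nonneg_left h1 (show (0:ℝ) ≤ 2 ^ l by positivity)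
  have h3 : 0 ≤ (2 ^ l * ‖x - y‖) * (2 ^ l * ‖y - z‖) := by positivity
  nlinarith

lemma bb_shift {n : ℕ} (l i : ℕ) (x : Rn n) : bb (l + i) x ≤ 2 ^ (i:ℝ) * bb l x := by
  unfold bb
  rw [two_rpow, ← ENNReal.ofReal_mul (by positivity)]
  apply ENNReal.ofReal_le_ofReal
  have : (1:ℝ) ≤ 2 ^ i := one_le_pow₀ (by norm_num)
  rw [Real.rpow_natCast, pow_add]
  nlinarith

lemma bb_key {n : ℕ} {a : ℝ} (ha : 0 ≤ a) (l i : ℕ) (x y z : Rn n) :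
    (bb l (x - y)) ^ (-a) * (bb (l + i) (y - z)) ^ (-a) ≤ 2 ^ ((i:ℝ) * a) * (bb (l + i) (x - z)) ^ (-a) := by
  have h : bb (l + i) (x - z) ≤ 2 ^ (i:ℝ) * (bb l (x - y) * bb (l + i) (y - z)) := by
    rw [← mul_assoc]
    exact (bb_sub _ x y z).trans (mul_le_mul' (bb_shift l i _) le_rfl)
  have h2 := ENNReal.rpow_le_rpow h ha
  rw [ENNReal.mul_rpow_of_nonneg _ _ ha, ← ENNReal.rpow_mul, ENNReal.mul_rpow_of_nonneg _ _ ha] at h2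
  rw [ENNReal.rpow_neg, ENNReal.rpow_neg, ENNReal.rpow_neg]
  rw [← ENNReal.mul_inv (Or.inr (ENNReal.rpow_ne_top_of_nonneg ha (bb_ne_top _ _)))
    (Or.inl (ENNReal.rpow_ne_top_of_nonneg ha (bb_ne_top _ _)))]
  rw [← div_eq_mul_inv, ENNReal.le_div_iff_mul_le (Or.inl ?_) (Or.inl ?_), mul_comm, ← div_eq_mul_inv]
  · exact ENNReal.div_le_of_le_mul h2
  · exact (ENNReal.rpow_pos (pos_iff_ne_zero.2 (bb_ne_zero _ _)) (bb_ne_top _ _)).ne'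
  · exact ENNReal.rpow_ne_top_of_nonneg ha (bb_ne_top _ _)

lemma bb_rpow_ne_zero {n : ℕ} (l : ℕ) (x : Rn n) (a : ℝ) : (bb l x) ^ a ≠ 0 :=
  (ENNReal.rpow_pos (pos_iff_ne_zero.2 (bb_ne_zero _ _)) (bb_ne_top _ _)).ne'

lemma bb_rpow_ne_top {n : ℕ} (l : ℕ) (x : Rn n) (a : ℝ) : (bb l x) ^ a ≠ ∞ :=
  ENNReal.rpow_ne_top_of_ne_zero (bb_ne_zero _ _) (bb_ne_top _ _)

lemma bb_rpow_neg_mono {n : ℕ} (l : ℕ) (x : Rn n) {a b : ℝ} (h : a ≤ b) : (bb l x) ^ (-b) ≤ (bb l x) ^ (-a) :=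
  ENNReal.rpow_le_rpow_of_exponent_le (one_le_bb l x) (by linarith)

lemma const_mul_cv {n : ℕ} (c : ℝ≥0∞) (A : ℝ) (l : ℕ) {h : Rn n → ℝ≥0∞} (hh : Measurable h) (x : Rn n) :
    c * cv A l h x = ∫⁻ z, c * (ker A l (x - z) * h z) := by
  unfold cv
  rw [lintegral_const_mul]
  exact (measurable_ker_left A l x).mul hh

/-- Peetre type maximal function -/
def HH {n : ℕ} (F : ℕ → Rn n → ℝ≥0∞) (a M : ℝ) (k : ℕ) (x : Rn n) : ℝ≥0∞ :=
  ⨆ (i : ℕ) (y : Rn n), (2:ℝ≥0∞) ^ (-(M * i)) * F (k + i) y * (bb (k + i) (x - y)) ^ (-a)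

/-- the right-hand side -/
def RR {n : ℕ} (F : ℕ → Rn n → ℝ≥0∞) (r a M : ℝ) (k : ℕ) (x : Rn n) : ℝ≥0∞ :=
  ∑' i : ℕ, (2:ℝ≥0∞) ^ (-(M * r * i)) * cv (a * r) (k + i) (fun z => F (k + i) z ^ r) x

lemma le_HH {n : ℕ} (F : ℕ → Rn n → ℝ≥0∞) (a M : ℝ) (k i : ℕ) (x y : Rn n) :
    (2:ℝ≥0∞) ^ (-(M * i)) * F (k + i) y * (bb (k + i) (x - y)) ^ (-a) ≤ HH F a M k x :=
  le_iSup_of_le i (le_iSup_of_le y le_rfl)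

lemma F_le_HH {n : ℕ} (F : ℕ → Rn n → ℝ≥0∞) (a M : ℝ) (k i : ℕ) (x y : Rn n) :
    F (k + i) y ≤ (2:ℝ≥0∞) ^ (M * i) * (bb (k + i) (x - y)) ^ a * HH F a M k x := by
  refine le_trans (le_of_eq ?_) (mul_le_mul' le_rfl (le_HH F a M k i x y))
  calc F (k + i) y = ((2:ℝ≥0∞) ^ (M * i) * (2:ℝ≥0∞) ^ (-(M * i))) * ((bb (k + i) (x - y)) ^ a * (bb (k + i) (x - y)) ^ (-a)) * F (k + i) y := by
        rw [← ENNReal.rpow_add _ _ (by norm_num) (by norm_num), ← ENNReal.rpow_add _ _ (bb_ne_zero _ _) (bb_ne_top _ _)]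
        simp
    _ = _ := by ring

/-- hypothesis (h1) -/
def Hyp1 {n : ℕ} (F : ℕ → Rn n → ℝ≥0∞) (A M : ℝ) (C : ℝ≥0∞) : Prop :=
  ∀ l y, F l y ≤ C * ∑' i : ℕ, (2:ℝ≥0∞) ^ (-(M * i)) * cv A (l + i) (F (l + i)) y

lemma RR_sub {n : ℕ} (F : ℕ → Rn n → ℝ≥0∞) (r a M : ℝ) (k i : ℕ) (x : Rn n) :
    ∑' i' : ℕ, (2:ℝ≥0∞) ^ (-(M * r * (i + i' : ℕ))) * cv (a * r) (k + i + i') (fun z => F (k + i + i') z ^ r) x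
      ≤ RR F r a M k x := by
  unfold RR
  refine le_trans (le_of_eq ?_) (ENNReal.tsum_comp_le_tsum_of_injective (add_right_injective i) _)
  refine tsum_congr fun i' => ?_
  simp only [add_assoc]

lemma S1 {n : ℕ} {F : ℕ → Rn n → ℝ≥0∞} {r a M : ℝ} {C : ℝ≥0∞} (hr : 0 < r) (hr1 : r ≤ 1)
    (ha : 0 ≤ a) (hF : Hyp1 F a (M + a) C) (hm : ∀ j, Measurable (F j)) (k : ℕ) (x : Rn n) :
    HH F a M k x ≤ C * (HH F a M k x) ^ (1 - r) * RR F r a M k x := by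
  refine iSup_le fun i => iSup_le fun y => ?_
  refine le_trans ?_ (mul_le_mul' le_rfl (RR_sub F r a M k i x))
  calc _ ≤ (2:ℝ≥0∞) ^ (-(M * i)) * (C * ∑' i' : ℕ, (2:ℝ≥0∞) ^ (-((M + a) * i')) * cv a (k + i + i') (F (k + i + i')) y) *
        (bb (k + i) (x - y)) ^ (-a) := mul_le_mul' (mul_le_mul' le_rfl (hF _ _)) le_rfl
    _ = C * ∑' i' : ℕ, (2:ℝ≥0∞) ^ (-(M * i)) * (2:ℝ≥0∞) ^ (-((M + a) * i')) * (bb (k + i) (x - y)) ^ (-a) *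
          cv a (k + i + i') (F (k + i + i')) y := by
        calc _ = C * ((2:ℝ≥0∞) ^ (-(M * i)) * (bb (k + i) (x - y)) ^ (-a) * (∑' i' : ℕ, (2:ℝ≥0∞) ^ (-((M + a) * i')) * cv a (k + i + i') (F (k + i + i')) y)) := by ring
          _ = _ := by
            rw [← ENNReal.tsum_mul_left]
            congr 2
            funext i'
            ring
    _ ≤ C * ∑' i' : ℕ, (HH F a M k x) ^ (1 - r) * ((2:ℝ≥0∞) ^ (-(M * r * (i + i' : ℕ))) *
          cv (a * r) (k + i + i') (fun z => F (k + i + i') z ^ r) x) := by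
        refine mul_le_mul' le_rfl (ENNReal.tsum_le_tsum fun i' => ?_)
        rw [const_mul_cv _ _ _ (hm _), ← mul_assoc, const_mul_cv _ _ _ ((hm _).pow_const _)]
        refine lintegral_mono fun z => ?_
        set l := k + i + i' with hl
        have f1 : F l z = F l z ^ r * F l z ^ (1 - r) := by
          rw [← ENNReal.rpow_add_of_nonneg _ _ hr.le (by linarith), add_sub_cancel, ENNReal.rpow_one]
        have f2 : F l z ^ (1 - r) ≤ ((2:ℝ≥0∞) ^ (M * (i + i' : ℕ)) * (bb l (x - z)) ^ a * HH F a M k x) ^ (1 - r) := by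
          refine ENNReal.rpow_le_rpow ?_ (by linarith)
          have := F_le_HH F a M k (i + i') x z
          rwa [← add_assoc] at this
        rw [ENNReal.mul_rpow_of_nonneg _ _ (by linarith), ENNReal.mul_rpow_of_nonneg _ _ (by linarith),
          ← ENNReal.rpow_mul, ← ENNReal.rpow_mul] at f2
        have f3 := bb_key ha (k + i) i' x y z
        rw [← hl] at f3
        unfold ker
        conv_lhs => rw [f1]
        calc _ ≤ 2 ^ (-(M * i)) * 2 ^ (-((M + a) * i')) * bb (k + i) (x - y) ^ (-a) *
              (2 ^ (l * n) * bb l (y - z) ^ (-a) * (F l z ^ r *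
                ((2:ℝ≥0∞) ^ (M * (i + i' : ℕ) * (1 - r)) * bb l (x - z) ^ (a * (1 - r)) * HH F a M k x ^ (1 - r)))) :=
              mul_le_mul' le_rfl (mul_le_mul' le_rfl (mul_le_mul' le_rfl f2))
          _ = 2 ^ (-(M * i)) * 2 ^ (-((M + a) * i')) * (bb (k + i) (x - y) ^ (-a) * bb l (y - z) ^ (-a)) *
              (2 ^ (l * n) * (F l z ^ r *
                ((2:ℝ≥0∞) ^ (M * (i + i' : ℕ) * (1 - r)) * bb l (x - z) ^ (a * (1 - r)) * HH F a M k x ^ (1 - r)))) := by ring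
          _ ≤ 2 ^ (-(M * i)) * 2 ^ (-((M + a) * i')) * (2 ^ ((i':ℝ) * a) * (bb l (x - z)) ^ (-a)) *
              (2 ^ (l * n) * (F l z ^ r *
                ((2:ℝ≥0∞) ^ (M * (i + i' : ℕ) * (1 - r)) * bb l (x - z) ^ (a * (1 - r)) * HH F a M k x ^ (1 - r)))) :=
              mul_le_mul' (mul_le_mul' le_rfl f3) le_rfl
          _ = (((2 ^ (-(M * i)) * 2 ^ (-((M + a) * i'))) * 2 ^ ((i':ℝ) * a)) * (2:ℝ≥0∞) ^ (M * (i + i' : ℕ) * (1 - r))) *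
               ((bb l (x - z)) ^ (-a) * bb l (x - z) ^ (a * (1 - r))) *
              (2 ^ (l * n) * (F l z ^ r * HH F a M k x ^ (1 - r))) := by ring
          _ = _ := by
            rw [← ENNReal.rpow_add _ _ (by norm_num) (by norm_num), ← ENNReal.rpow_add _ _ (by norm_num) (by norm_num),
              ← ENNReal.rpow_add _ _ (by norm_num) (by norm_num), ← ENNReal.rpow_add _ _ (bb_ne_zero _ _) (bb_ne_top _ _)]
            rw [show -(M * i) + -((M + a) * i') + (i':ℝ) * a + M * (i + i' : ℕ) * (1 - r) = -(M * r * (i + i' : ℕ)) by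
              push_cast; ring, show -a + a * (1 - r) = -(a * r) by ring]
            ring
    _ = _ := by
        rw [ENNReal.tsum_mul_left]
        ring

/-- hypothesis (h2) -/
def Hyp2 {n : ℕ} (F : ℕ → Rn n → ℝ≥0∞) (L : ℝ) (c : ℝ≥0∞) : Prop :=
  ∀ l y, F l y ≤ c * 2 ^ ((l:ℝ) * L) * (bb 0 y) ^ L

lemma S2 {n : ℕ} {F : ℕ → Rn n → ℝ≥0∞} {a M L : ℝ} {c : ℝ≥0∞} (hc : c ≠ ∞) (hL : 0 ≤ L) (ha : L ≤ a) (hM : L ≤ M)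
    (hF : Hyp2 F L c) (k : ℕ) (x : Rn n) : HH F a M k x ≠ ∞ := by
  have hfin : c * 2 ^ ((k:ℝ) * L) * (bb 0 x) ^ L ≠ ∞ :=
    ENNReal.mul_ne_top (ENNReal.mul_ne_top hc (ENNReal.rpow_ne_top_of_nonneg (by positivity) (by norm_num)))
      (bb_rpow_ne_top _ _ _)
  refine ne_top_of_le_ne_top hfin (iSup_le fun i => iSup_le fun y => ?_)
  have h1 : (bb (k + i) (x - y)) ^ (-a) ≤ (bb 0 (x - y)) ^ (-L) := by
    refine (bb_rpow_neg_mono _ _ ha).trans ?_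
    rw [ENNReal.rpow_neg, ENNReal.rpow_neg]
    exact ENNReal.inv_le_inv.2 (ENNReal.rpow_le_rpow (bb_mono (by omega) _) hL)
  have h2 : (bb 0 y) ^ L ≤ (bb 0 x) ^ L * (bb 0 (x - y)) ^ L := by
    rw [← ENNReal.mul_rpow_of_nonneg _ _ hL]
    refine ENNReal.rpow_le_rpow ?_ hL
    have := bb_sub 0 y x 0
    rw [sub_zero, sub_zero, bb_comm 0 y x, mul_comm] at this
    exact this
  have h3 : (2:ℝ≥0∞) ^ (-(M * i)) ≤ 2 ^ (-(L * i)) :=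
    ENNReal.rpow_le_rpow_of_exponent_le (by norm_num) (by
      have := mul_le_mul_of_nonneg_right hM (Nat.cast_nonneg (α := ℝ) i)
      linarith)
  calc _ ≤ 2 ^ (-(L * i)) * (c * 2 ^ (((k + i : ℕ):ℝ) * L) * ((bb 0 x) ^ L * (bb 0 (x - y)) ^ L)) * (bb 0 (x - y)) ^ (-L) :=
        mul_le_mul' (mul_le_mul' h3 ((hF _ _).trans (mul_le_mul' le_rfl h2))) h1
    _ = c * (2 ^ (-(L * i)) * 2 ^ (((k + i : ℕ):ℝ) * L)) * (bb 0 x) ^ L * ((bb 0 (x - y)) ^ L * (bb 0 (x - y)) ^ (-L)) := by ring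
    _ = _ := by
        rw [← ENNReal.rpow_add _ _ (by norm_num) (by norm_num), ← ENNReal.rpow_add _ _ (bb_ne_zero _ _) (bb_ne_top _ _),
          add_neg_cancel, ENNReal.rpow_zero, mul_one]
        congr 3
        push_cast; ring

lemma S1' {n : ℕ} {F : ℕ → Rn n → ℝ≥0∞} {r a M : ℝ} {C : ℝ≥0∞} (hr : 0 < r) (hr1 : r ≤ 1)
    (ha : 0 ≤ a) (hF : Hyp1 F a (M + a) C) (hm : ∀ j, Measurable (F j)) (k : ℕ) (x : Rn n)
    (hfin : HH F a M k x ≠ ∞) : (HH F a M k x) ^ r ≤ C * RR F r a M k x := by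
  have h1 := S1 hr hr1 ha hF hm k x
  set H := HH F a M k x with hH
  rcases eq_or_ne H 0 with h0 | h0
  · rw [h0, ENNReal.zero_rpow_of_pos hr]; exact zero_le
  · have h2 := mul_le_mul' h1 (le_refl (H ^ (-(1 - r))))
    calc H ^ r = H * H ^ (-(1 - r)) := by
          nth_rewrite 2 [← ENNReal.rpow_one H]
          rw [← ENNReal.rpow_add _ _ h0 hfin]
          congr 1; ring
      _ ≤ _ := h2
      _ = C * RR F r a M k x * (H ^ (1 - r) * H ^ (-(1 - r))) := by ring
      _ = _ := by
          rw [← ENNReal.rpow_add _ _ h0 hfin, add_neg_cancel, ENNReal.rpow_zero, mul_one]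

lemma RR_mono {n : ℕ} (F : ℕ → Rn n → ℝ≥0∞) {r a M a' M' : ℝ} (hr : 0 < r) (ha : a ≤ a') (hM : M ≤ M') (k : ℕ) (x : Rn n) :
    RR F r a' M' k x ≤ RR F r a M k x := by
  unfold RR
  refine ENNReal.tsum_le_tsum fun i => mul_le_mul' ?_ ?_
  · refine ENNReal.rpow_le_rpow_of_exponent_le (by norm_num) ?_
    have := mul_le_mul_of_nonneg_right (mul_le_mul_of_nonneg_right hM hr.le) (Nat.cast_nonneg (α := ℝ) i)
    linarith
  · unfold cv ker
    refine lintegral_mono fun z => mul_le_mul' (mul_le_mul' le_rfl (bb_rpow_neg_mono _ _ ?_)) le_rfl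
    exact mul_le_mul_of_nonneg_right ha hr.le

lemma S3 {n : ℕ} {F : ℕ → Rn n → ℝ≥0∞} {r a M : ℝ} {C : ℝ≥0∞} (hr : 0 < r)
    (ha : 0 ≤ a) (hm : ∀ j, Measurable (F j)) (h : ∀ l y, (F l y) ^ r ≤ C * RR F r a (M + a) l y) (k : ℕ) (x : Rn n) :
    (HH F a M k x) ^ r ≤ C * RR F r a M k x := by
  have hiso : (HH F a M k x) ^ r = ⨆ (i : ℕ) (y : Rn n), ((2:ℝ≥0∞) ^ (-(M * i)) * F (k + i) y * (bb (k + i) (x - y)) ^ (-a)) ^ r := by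
    unfold HH
    have := (ENNReal.orderIsoRpow r hr).map_iSup (fun i : ℕ => ⨆ y : Rn n, (2:ℝ≥0∞) ^ (-(M * i)) * F (k + i) y * (bb (k + i) (x - y)) ^ (-a))
    simp only [ENNReal.orderIsoRpow_apply] at this
    rw [this]
    refine iSup_congr fun i => ?_
    exact (ENNReal.orderIsoRpow r hr).map_iSup _
  rw [hiso]
  refine iSup_le fun i => iSup_le fun y => ?_
  refine le_trans ?_ (mul_le_mul' le_rfl (RR_sub F r a M k i x))
  rw [ENNReal.mul_rpow_of_nonneg _ _ hr.le, ENNReal.mul_rpow_of_nonneg _ _ hr.le, ← ENNReal.rpow_mul, ← ENNReal.rpow_mul]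
  calc _ ≤ (2:ℝ≥0∞) ^ (-(M * i) * r) * (C * RR F r a (M + a) (k + i) y) * (bb (k + i) (x - y)) ^ (-a * r) :=
        mul_le_mul' (mul_le_mul' le_rfl (h _ _)) le_rfl
    _ = C * ((2:ℝ≥0∞) ^ (-(M * i) * r) * (bb (k + i) (x - y)) ^ (-a * r) * RR F r a (M + a) (k + i) y) := by ring
    _ ≤ _ := by
        refine mul_le_mul' le_rfl ?_
        unfold RR
        rw [← ENNReal.tsum_mul_left]
        refine ENNReal.tsum_le_tsum fun i' => ?_
        rw [← mul_assoc, const_mul_cv _ _ _ ((hm _).pow_const _), const_mul_cv _ _ _ ((hm _).pow_const _)]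
        refine lintegral_mono fun z => ?_
        set l := k + i + i' with hl
        have f3 := bb_key (mul_nonneg ha hr.le) (k + i) i' x y z
        rw [← hl] at f3
        unfold ker
        calc _ = 2 ^ (-(M * i) * r) * 2 ^ (-((M + a) * r * i')) * (bb (k + i) (x - y) ^ (-(a * r)) * bb l (y - z) ^ (-(a * r))) *
              (2 ^ (l * n) * F l z ^ r) := by rw [neg_mul a r]; ring
          _ ≤ 2 ^ (-(M * i) * r) * 2 ^ (-((M + a) * r * i')) * (2 ^ ((i':ℝ) * (a * r)) * (bb l (x - z)) ^ (-(a * r))) *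
              (2 ^ (l * n) * F l z ^ r) := mul_le_mul' (mul_le_mul' le_rfl f3) le_rfl
          _ = (2 ^ (-(M * i) * r) * 2 ^ (-((M + a) * r * i')) * 2 ^ ((i':ℝ) * (a * r))) * ((bb l (x - z)) ^ (-(a * r)) *
              (2 ^ (l * n) * F l z ^ r)) := by ring
          _ = _ := by
            rw [← ENNReal.rpow_add _ _ (by norm_num) (by norm_num), ← ENNReal.rpow_add _ _ (by norm_num) (by norm_num)]
            rw [show -(M * i) * r + -((M + a) * r * i') + (i':ℝ) * (a * r) = -(M * r * (i + i' : ℕ)) by push_cast; ring]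
            ring

/-- Rychkov's lemma -/
lemma rychkov {n : ℕ} {F : ℕ → Rn n → ℝ≥0∞} {r a M : ℝ} {C : ℝ≥0∞} (hr : 0 < r) (hr1 : r ≤ 1)
    (ha : 0 ≤ a) (hm : ∀ j, Measurable (F j)) (hC : 1 ≤ C)
    (h1 : Hyp1 F a (M + a) C) (h1' : ∀ A M : ℝ, 0 ≤ A → ∃ C : ℝ≥0∞, C ≠ ∞ ∧ Hyp1 F A M C)
    (h2 : ∃ (L : ℝ) (c : ℝ≥0∞), 0 ≤ L ∧ c ≠ ∞ ∧ Hyp2 F L c) (k : ℕ) (x : Rn n) :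
    (HH F a M k x) ^ r ≤ C * RR F r a M k x := by
  obtain ⟨L, c, hL, hc, h2⟩ := h2
  rcases eq_or_ne (RR F r a M k x) ∞ with hR | hR
  · rw [hR, ENNReal.mul_top (lt_of_lt_of_le one_pos hC).ne']
    exact le_top
  refine S1' hr hr1 ha h1 hm k x ?_
  set a1 := max a L with ha1
  set M1 := max (M + a) L with hM1
  have ha1' : 0 ≤ a1 := ha.trans (le_max_left _ _)
  obtain ⟨C1, hC1, h3⟩ := h1' a1 (M1 + a1) ha1'
  have h4 : ∀ l y, (F l y) ^ r ≤ C1 * RR F r a (M + a) l y := by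
    intro l y
    have h5 := S1' hr hr1 ha1' h3 hm l y (S2 hc hL (le_max_right _ _) (le_max_right _ _) h2 l y)
    refine le_trans ?_ (h5.trans (mul_le_mul' le_rfl (RR_mono F hr (le_max_left _ _) (le_max_left _ _) l y)))
    refine ENNReal.rpow_le_rpow ?_ hr.le
    have := le_HH F a1 M1 l 0 y y
    simpa [bb] using this
  have h6 := S3 hr ha hm h4 k x
  intro htop
  rw [htop, ENNReal.top_rpow_of_pos hr] at h6
  exact ENNReal.mul_ne_top hC1 hR (top_le_iff.1 h6)

/-- two-sided weights -/
def bt (σ M : ℝ) (j k : ℕ) : ℝ≥0∞ :=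
  if k ≤ j then (2:ℝ≥0∞) ^ (-(σ * ((j:ℝ) - k))) else (2:ℝ≥0∞) ^ (-(M * ((k:ℝ) - j)))

/-- hypothesis (h3) -/
def Hyp3 {n : ℕ} (F V : ℕ → Rn n → ℝ≥0∞) (σ A M : ℝ) (C : ℝ≥0∞) : Prop :=
  ∀ j x, V j x ≤ C * ∑' k : ℕ, bt σ M j k * cv A k (F k) x

lemma bt_wt {σ s δ M : ℝ} (hδ : δ = σ - s) (hM : M = δ - s) (j k : ℕ) :
    (2:ℝ≥0∞) ^ ((j:ℝ) * s) * bt σ M j k = wt δ j k * 2 ^ ((k:ℝ) * s) := by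
  unfold bt wt
  split_ifs with h
  · rw [← ENNReal.rpow_add _ _ (by norm_num) (by norm_num), ← ENNReal.rpow_add _ _ (by norm_num) (by norm_num)]
    have : (k:ℝ) ≤ j := by exact_mod_cast h
    rw [abs_of_nonneg (by linarith)]
    congr 1; rw [hδ]; ring
  · rw [← ENNReal.rpow_add _ _ (by norm_num) (by norm_num), ← ENNReal.rpow_add _ _ (by norm_num) (by norm_num)]
    have : (j:ℝ) ≤ k := by exact_mod_cast (not_le.1 h).le
    rw [abs_of_nonpos (by linarith)]
    congr 1; rw [hM]; ring

lemma cv_le_HH {n : ℕ} (F : ℕ → Rn n → ℝ≥0∞) {a M : ℝ} (k : ℕ) (x : Rn n) :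
    cv (a + (n + 1)) k (F k) x ≤ Ci n * HH F a M k x := by
  unfold cv
  calc _ ≤ ∫⁻ z, ker (n + 1) k (x - z) * HH F a M k x := by
        refine lintegral_mono fun z => ?_
        have h := F_le_HH F a M k 0 x z
        simp only [Nat.cast_zero, mul_zero, ENNReal.rpow_zero, one_mul, add_zero] at h
        refine (mul_le_mul' le_rfl h).trans (le_of_eq ?_)
        unfold ker
        calc _ = 2 ^ (k * n) * (bb k (x - z) ^ (-(a + (n + 1))) * bb k (x - z) ^ a) * HH F a M k x := by ring
          _ = _ := by
            rw [← ENNReal.rpow_add _ _ (bb_ne_zero _ _) (bb_ne_top _ _)]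
            rw [show -(a + ((n:ℝ) + 1)) + a = -((n:ℝ) + 1) by ring]
    _ ≤ _ := by
        rw [lintegral_mul_const]
        · exact mul_le_mul' (int_ker k x) le_rfl
        · exact measurable_ker_left _ k x

lemma wt_rpow (δ r : ℝ) (j k : ℕ) : (wt δ j k) ^ r = wt (δ * r) j k := by
  unfold wt
  rw [← ENNReal.rpow_mul]; congr 1; ring

lemma P1 {n : ℕ} {F V : ℕ → Rn n → ℝ≥0∞} {σ s δ M a r : ℝ} {C : ℝ≥0∞} (hδ : δ = σ - s) (hM : M = δ - s)
    (hr : 0 < r) (hr1 : r ≤ 1) (h3 : Hyp3 F V σ (a + (n + 1)) M C) (j : ℕ) (x : Rn n) :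
    (2 ^ ((j:ℝ) * s) * V j x) ^ r ≤ (C * Ci n) ^ r * ∑' k, wt (δ * r) j k * (2 ^ ((k:ℝ) * s) * HH F a M k x) ^ r := by
  have h1 : 2 ^ ((j:ℝ) * s) * V j x ≤ (C * Ci n) * ∑' k, wt δ j k * (2 ^ ((k:ℝ) * s) * HH F a M k x) := by
    calc _ ≤ 2 ^ ((j:ℝ) * s) * (C * ∑' k : ℕ, bt σ M j k * cv (a + (n + 1)) k (F k) x) := mul_le_mul' le_rfl (h3 j x)
      _ ≤ 2 ^ ((j:ℝ) * s) * (C * ∑' k : ℕ, bt σ M j k * (Ci n * HH F a M k x)) :=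
        mul_le_mul' le_rfl (mul_le_mul' le_rfl (ENNReal.tsum_le_tsum fun k => mul_le_mul' le_rfl (cv_le_HH F k x)))
      _ = (C * Ci n) * ∑' k, (2 ^ ((j:ℝ) * s) * bt σ M j k) * HH F a M k x := by
        rw [← ENNReal.tsum_mul_left, ← ENNReal.tsum_mul_left, ← ENNReal.tsum_mul_left]
        exact tsum_congr fun k => by ring
      _ = _ := by
        congr 1
        refine tsum_congr fun k => ?_
        rw [bt_wt hδ hM]; ring
  refine (ENNReal.rpow_le_rpow h1 hr.le).trans ?_
  rw [ENNReal.mul_rpow_of_nonneg _ _ hr.le]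
  refine mul_le_mul' le_rfl ((rpow_tsum hr hr1 _).trans (le_of_eq (tsum_congr fun k => ?_)))
  rw [ENNReal.mul_rpow_of_nonneg _ _ hr.le, wt_rpow]

lemma P2 {n : ℕ} {F : ℕ → Rn n → ℝ≥0∞} {s δ M a r : ℝ} {C : ℝ≥0∞} (hM : M = δ - s)
    (hr : 0 < r) (har : a * r = n + 1) (hm : ∀ j, Measurable (F j)) (h : ∀ k x, (HH F a M k x) ^ r ≤ C * RR F r a M k x) (k : ℕ) (x : Rn n) :
    (2 ^ ((k:ℝ) * s) * HH F a M k x) ^ r ≤ C * ∑' l, wt (δ * r) k l * cv (n + 1) l (fun z => (2 ^ ((l:ℝ) * s) * F l z) ^ r) x := by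
  rw [ENNReal.mul_rpow_of_nonneg _ _ hr.le]
  refine (mul_le_mul' le_rfl (h k x)).trans ?_
  rw [mul_left_comm]
  refine mul_le_mul' le_rfl ?_
  refine le_trans (le_of_eq ?_) (ENNReal.tsum_comp_le_tsum_of_injective (add_right_injective k) _)
  unfold RR
  rw [← ENNReal.tsum_mul_left]
  refine tsum_congr fun i => ?_
  have e1 : cv (n + 1) (k + i) (fun z => (2 ^ (((k + i : ℕ):ℝ) * s) * F (k + i) z) ^ r) x
      = (2 ^ (((k + i : ℕ):ℝ) * s)) ^ r * cv (n + 1) (k + i) (fun z => F (k + i) z ^ r) x := by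
    rw [const_mul_cv _ _ _ ((hm _).pow_const _)]
    unfold cv
    refine lintegral_congr fun z => ?_
    simp only
    rw [ENNReal.mul_rpow_of_nonneg _ _ hr.le]; ring
  rw [e1, har, ← mul_assoc, ← mul_assoc]
  congr 1
  unfold wt
  rw [← ENNReal.rpow_mul, ← ENNReal.rpow_mul, ← ENNReal.rpow_add _ _ (by norm_num) (by norm_num),
    ← ENNReal.rpow_add _ _ (by norm_num) (by norm_num)]
  congr 1
  rw [abs_sub_comm, abs_of_nonneg (by push_cast; linarith [Nat.cast_nonneg (α := ℝ) i]), hM]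
  push_cast; ring

theorem main4 (n : ℕ) {s σ : ℝ} (hσ : s < σ) {p q : ℝ≥0∞} (hp : 0 < p) (hp' : p ≠ ∞) (hq : 0 < q)
    (C1 C3 : ℝ → ℝ → ℝ≥0∞) (hC1 : ∀ A M, 0 ≤ A → C1 A M ≠ ∞) (hC3 : ∀ A M, 0 ≤ A → C3 A M ≠ ∞) :
    ∃ C : ℝ≥0∞, C ≠ ∞ ∧ ∀ F V : ℕ → Rn n → ℝ≥0∞, (∀ j, Measurable (F j)) →
      (∀ A M, 0 ≤ A → Hyp1 F A M (C1 A M)) → (∃ (L : ℝ) (c : ℝ≥0∞), 0 ≤ L ∧ c ≠ ∞ ∧ Hyp2 F L c) →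
      (∀ A M, 0 ≤ A → Hyp3 F V σ A M (C3 A M)) →
      lpNormENN p (fun x => lqSum q fun j => (2:ℝ≥0∞) ^ ((j:ℝ) * s) * V j x) ≤
        C * lpNormENN p (fun x => lqSum q fun j => (2:ℝ≥0∞) ^ ((j:ℝ) * s) * F j x) := by
  have hpr : 0 < p.toReal := ENNReal.toReal_pos hp.ne' hp'
  obtain ⟨r, hr, hr1, hrp, hrq⟩ : ∃ r : ℝ, 0 < r ∧ r ≤ 1 ∧ r < p.toReal ∧ (q ≠ ∞ → r < q.toReal) := by
    rcases eq_or_ne q ∞ with h | h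
    · refine ⟨min 1 (p.toReal / 2), by positivity, min_le_left _ _, ?_, fun h' => absurd h h'⟩
      exact (min_le_right _ _).trans_lt (by linarith)
    · have := ENNReal.toReal_pos hq.ne' h
      refine ⟨min 1 (min (p.toReal / 2) (q.toReal / 2)), by positivity, min_le_left _ _, ?_, fun _ => ?_⟩
      · exact ((min_le_right _ _).trans (min_le_left _ _)).trans_lt (by linarith)
      · exact ((min_le_right _ _).trans (min_le_right _ _)).trans_lt (by linarith)
  set a : ℝ := (n + 1) / r with ha
  have har : a * r = n + 1 := by rw [ha]; field_simp
  have ha0 : 0 ≤ a := by positivity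
  set δ := σ - s with hδ
  have hδr : 0 < δ * r := mul_pos (by linarith) hr
  set M := δ - s with hM
  set c1 := max 1 (C1 a (M + a)) with hc1
  have hc1t : c1 ≠ ∞ := by
    rw [hc1]; exact (max_lt (by norm_num) (hC1 _ _ ha0).lt_top).ne
  set K := (C3 (a + (n + 1)) M * Ci n) ^ r with hK
  have hKt : K ≠ ∞ := ENNReal.rpow_ne_top_of_nonneg hr.le (ENNReal.mul_ne_top (hC3 _ _ (by positivity)) (Ci_ne_top n))
  have hg := geo_ne_top hδr
  set G := 2 * geo (δ * r) with hG
  have hGt : G ≠ ∞ := ENNReal.mul_ne_top (by norm_num) hg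
  set v := p.toReal / r with hv
  have hv1 : 1 < v := by rw [hv, lt_div_iff₀ hr]; linarith
  have key : ∀ F V : ℕ → Rn n → ℝ≥0∞, (∀ j, Measurable (F j)) →
      (∀ A M, 0 ≤ A → Hyp1 F A M (C1 A M)) → (∃ (L : ℝ) (c : ℝ≥0∞), 0 ≤ L ∧ c ≠ ∞ ∧ Hyp2 F L c) →
      (∀ A M, 0 ≤ A → Hyp3 F V σ A M (C3 A M)) → 
      (∀ (j : ℕ) x, (2 ^ ((j:ℝ) * s) * V j x) ^ r ≤ K * ∑' k, wt (δ * r) j k * (2 ^ ((k:ℝ) * s) * HH F a M k x) ^ r) ∧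
      (∀ (k : ℕ) x, (2 ^ ((k:ℝ) * s) * HH F a M k x) ^ r ≤ c1 * ∑' l, wt (δ * r) k l * cv (n + 1) l (fun z => (2 ^ ((l:ℝ) * s) * F l z) ^ r) x) := by
    intro F V hm h1 h2 h3
    refine ⟨P1 rfl rfl hr hr1 (h3 _ _ (by positivity)), P2 rfl hr har hm fun k x => ?_⟩
    refine rychkov hr hr1 ha0 hm (le_max_left _ _) ?_ (fun A M hA => ⟨_, hC1 A M hA, h1 A M hA⟩) h2 k x
    intro l y
    exact (h1 a (M + a) ha0 l y).trans (mul_le_mul' (le_max_right _ _) le_rfl)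
  have hinv : 0 ≤ 1 / p.toReal := by positivity
  rcases eq_or_ne q ∞ with hqt | hqt
  · obtain ⟨C, hC, hV⟩ := VV_sup n hv1
    refine ⟨((K * G * (c1 * G)) ^ v * C) ^ (1 / p.toReal), ?_, fun F V hm h1 h2 h3 => ?_⟩
    · refine ENNReal.rpow_ne_top_of_nonneg hinv (ENNReal.mul_ne_top (ENNReal.rpow_ne_top_of_nonneg (by positivity) ?_) hC)
      exact ENNReal.mul_ne_top (ENNReal.mul_ne_top hKt hGt) (ENNReal.mul_ne_top hc1t hGt)
    obtain ⟨k1, k2⟩ := key F V hm h1 h2 h3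
    unfold lpNormENN lqSum
    simp only [hqt, hp', if_true, if_false]
    rw [← ENNReal.mul_rpow_of_nonneg _ _ hinv]
    refine ENNReal.rpow_le_rpow ?_ hinv
    have e0 : ∀ b : ℕ → ℝ≥0∞, (⨆ j, b j) ^ p.toReal = (⨆ j, b j ^ r) ^ v := by
      intro b
      have := (ENNReal.orderIsoRpow r hr).map_iSup b
      simp only [ENNReal.orderIsoRpow_apply] at this
      rw [← this, ← ENNReal.rpow_mul]
      congr 1; rw [hv]; field_simp
    simp only [e0]
    have hVV := hV (fun l z => (2 ^ ((l:ℝ) * s) * F l z) ^ r) (fun l => ((hm l).const_mul _).pow_const _)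
    rw [mul_assoc]
    refine le_trans ?_ (mul_le_mul' le_rfl hVV)
    rw [← lintegral_const_mul' _ _ (ENNReal.rpow_ne_top_of_nonneg (by positivity)
      (ENNReal.mul_ne_top (ENNReal.mul_ne_top hKt hGt) (ENNReal.mul_ne_top hc1t hGt)))]
    refine lintegral_mono fun x => ?_
    simp only
    rw [← ENNReal.mul_rpow_of_nonneg _ _ (by positivity : 0 ≤ v)]
    refine ENNReal.rpow_le_rpow ?_ (by positivity)
    calc _ ≤ ⨆ j, K * ∑' k, wt (δ * r) j k * (2 ^ ((k:ℝ) * s) * HH F a M k x) ^ r := iSup_mono fun j => k1 j x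
      _ = K * ⨆ j, ∑' k, wt (δ * r) j k * (2 ^ ((k:ℝ) * s) * HH F a M k x) ^ r := by rw [ENNReal.mul_iSup]
      _ ≤ K * (G * ⨆ k : ℕ, (2 ^ ((k:ℝ) * s) * HH F a M k x) ^ r) := mul_le_mul' le_rfl (schur_sup _ _)
      _ ≤ K * (G * ⨆ k, c1 * ∑' l, wt (δ * r) k l * cv (n + 1) l (fun z => (2 ^ ((l:ℝ) * s) * F l z) ^ r) x) :=
        mul_le_mul' le_rfl (mul_le_mul' le_rfl (iSup_mono fun k => k2 k x))
      _ = K * (G * (c1 * ⨆ k, ∑' l, wt (δ * r) k l * cv (n + 1) l (fun z => (2 ^ ((l:ℝ) * s) * F l z) ^ r) x)) := by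
        rw [← ENNReal.mul_iSup]
      _ ≤ K * (G * (c1 * (G * ⨆ l, cv (n + 1) l (fun z => (2 ^ ((l:ℝ) * s) * F l z) ^ r) x))) :=
        mul_le_mul' le_rfl (mul_le_mul' le_rfl (mul_le_mul' le_rfl (schur_sup _ _)))
      _ = _ := by ring
  · have hqr := hrq hqt
    have hq0 : 0 < q.toReal := hr.trans hqr
    set u := q.toReal / r with hu
    have hu1 : 1 < u := by rw [hu, lt_div_iff₀ hr]; linarith
    have hu0 : 0 ≤ u := by linarith
    obtain ⟨C, hC, hV⟩ := VV n hu1 hv1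
    have hQ : (K * G * (c1 * G)) ^ u ≠ ∞ := ENNReal.rpow_ne_top_of_nonneg hu0
      (ENNReal.mul_ne_top (ENNReal.mul_ne_top hKt hGt) (ENNReal.mul_ne_top hc1t hGt))
    have hvu : 0 ≤ v / u := by positivity
    refine ⟨(((K * G * (c1 * G)) ^ u) ^ (v / u) * C) ^ (1 / p.toReal), ?_, fun F V hm h1 h2 h3 => ?_⟩
    · exact ENNReal.rpow_ne_top_of_nonneg hinv (ENNReal.mul_ne_top (ENNReal.rpow_ne_top_of_nonneg hvu hQ) hC)
    obtain ⟨k1, k2⟩ := key F V hm h1 h2 h3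
    unfold lpNormENN lqSum
    simp only [hqt, hp', if_false]
    rw [← ENNReal.mul_rpow_of_nonneg _ _ hinv]
    refine ENNReal.rpow_le_rpow ?_ hinv
    have e0 : ∀ b : ℕ → ℝ≥0∞, ((∑' j, (b j) ^ q.toReal) ^ (1 / q.toReal)) ^ p.toReal = (∑' j, (b j ^ r) ^ u) ^ (v / u) := by
      intro b
      rw [← ENNReal.rpow_mul]
      have : ∀ j, (b j ^ r) ^ u = b j ^ q.toReal := fun j => by
        rw [← ENNReal.rpow_mul]; congr 1; rw [hu]; field_simp
      simp only [this]
      congr 1; rw [hv, hu]; field_simp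
    simp only [e0]
    have hVV := hV (fun l z => (2 ^ ((l:ℝ) * s) * F l z) ^ r) (fun l => ((hm l).const_mul _).pow_const _)
    rw [mul_assoc]
    refine le_trans ?_ (mul_le_mul' le_rfl hVV)
    rw [← lintegral_const_mul' _ _ (ENNReal.rpow_ne_top_of_nonneg hvu hQ)]
    refine lintegral_mono fun x => ?_
    simp only
    rw [← ENNReal.mul_rpow_of_nonneg _ _ hvu]
    refine ENNReal.rpow_le_rpow ?_ hvu
    have pull : ∀ (c : ℝ≥0∞) (b : ℕ → ℝ≥0∞), ∑' j, (c * b j) ^ u = c ^ u * ∑' j, (b j) ^ u := fun c b => by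
      rw [← ENNReal.tsum_mul_left]
      exact tsum_congr fun j => ENNReal.mul_rpow_of_nonneg _ _ hu0
    calc _ ≤ ∑' j, (K * ∑' k, wt (δ * r) j k * (2 ^ ((k:ℝ) * s) * HH F a M k x) ^ r) ^ u :=
          ENNReal.tsum_le_tsum fun j => ENNReal.rpow_le_rpow (k1 j x) hu0
      _ = K ^ u * ∑' j, (∑' k, wt (δ * r) j k * (2 ^ ((k:ℝ) * s) * HH F a M k x) ^ r) ^ u := pull _ _
      _ ≤ K ^ u * (G ^ u * ∑' k : ℕ, ((2 ^ ((k:ℝ) * s) * HH F a M k x) ^ r) ^ u) := mul_le_mul' le_rfl (schur _ hu1 _)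
      _ ≤ K ^ u * (G ^ u * ∑' k, (c1 * ∑' l, wt (δ * r) k l * cv (n + 1) l (fun z => (2 ^ ((l:ℝ) * s) * F l z) ^ r) x) ^ u) :=
        mul_le_mul' le_rfl (mul_le_mul' le_rfl (ENNReal.tsum_le_tsum fun k => ENNReal.rpow_le_rpow (k2 k x) hu0))
      _ = K ^ u * (G ^ u * (c1 ^ u * ∑' k, (∑' l, wt (δ * r) k l * cv (n + 1) l (fun z => (2 ^ ((l:ℝ) * s) * F l z) ^ r) x) ^ u)) := by
        rw [pull]
      _ ≤ K ^ u * (G ^ u * (c1 ^ u * (G ^ u * ∑' l, (cv (n + 1) l (fun z => (2 ^ ((l:ℝ) * s) * F l z) ^ r) x) ^ u))) :=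
        mul_le_mul' le_rfl (mul_le_mul' le_rfl (mul_le_mul' le_rfl (schur _ hu1 _)))
      _ = _ := by
        simp only [ENNReal.mul_rpow_of_nonneg _ _ hu0]
        ring


/-- product of Schwartz functions -/
def mulS {n : ℕ} (a b : Sch n) : Sch n := SchwartzMap.pairing (ContinuousLinearMap.mul ℂ ℂ) a b

@[simp] lemma mulS_apply {n : ℕ} (a b : Sch n) (x : Rn n) : mulS a b x = a x * b x := rfl

@[simp] lemma dilate_apply {n : ℕ} (a : Sch n) {t : ℝ} (ht : t ≠ 0) (x : Rn n) : dilate a t x = a (t • x) := by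
  unfold dilate
  rw [dif_neg ht]; rfl

@[simp] lemma shiftReflect_apply {n : ℕ} (a : Sch n) (x y : Rn n) : shiftReflect a x y = a (x - y) := rfl

/-- basis vectors -/
def ev {n : ℕ} (i : Fin n) : Rn n := EuclideanSpace.single i (1:ℝ)

lemma norm_ev {n : ℕ} (i : Fin n) : ‖ev i‖ = 1 := by simp [ev]

/-- iterated derivatives along a list -/
def dl {n : ℕ} : List (Fin n) → Sch n →L[ℂ] Sch n
  | [] => ContinuousLinearMap.id ℂ _
  | i :: L => (LineDeriv.lineDerivOpCLM ℂ (Sch n) (ev i)).comp (dl L)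

lemma dl_cons {n : ℕ} (i : Fin n) (L : List (Fin n)) (φ : Sch n) :
    dl (i :: L) φ = LineDeriv.lineDerivOp (ev i) (dl L φ) := rfl

lemma dl_append {n : ℕ} (L L' : List (Fin n)) (φ : Sch n) : dl (L ++ L') φ = dl L (dl L' φ) := by
  induction L with
  | nil => rfl
  | cons i L ih => rw [List.cons_append, dl_cons, dl_cons, ih]

lemma dl_ofFn {n l : ℕ} (r : Fin l → Fin n) (φ : Sch n) :
    dl (List.ofFn r) φ = LineDeriv.iteratedLineDerivOp (fun i => ev (r i)) φ := by
  induction l with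
  | zero => simp; rfl
  | succ l ih =>
    rw [List.ofFn_succ, dl_cons, ih, LineDeriv.iteratedLineDerivOp_succ_left]
    rfl

lemma dl_ofFn_apply {n l : ℕ} (r : Fin l → Fin n) (φ : Sch n) (x : Rn n) :
    dl (List.ofFn r) φ x = iteratedFDeriv ℝ l φ x (fun i => ev (r i)) := by
  rw [dl_ofFn, SchwartzMap.iteratedLineDerivOp_eq_iteratedFDeriv]

lemma norm_dl_le {n : ℕ} (L : List (Fin n)) (φ : Sch n) (x : Rn n) :
    ‖dl L φ x‖ ≤ ‖iteratedFDeriv ℝ L.length φ x‖ := by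
  have := dl_ofFn_apply L.get φ x
  rw [List.ofFn_get] at this
  rw [this]
  refine (ContinuousMultilinearMap.le_opNorm _ _).trans ?_
  simp [norm_ev]

/-- list of a multi-index -/
def lst {n : ℕ} (α : Fin n → ℕ) : List (Fin n) := (List.finRange n).flatMap fun i => List.replicate (α i) i

lemma pd_iter {n : ℕ} (i : Fin n) (k : ℕ) (φ : Sch n) :
    (pd i)^[k] (fun y => φ y) = fun y => dl (List.replicate k i) φ y := by
  induction k with
  | zero => rfl
  | succ k ih =>
    rw [Function.iterate_succ_apply', ih, List.replicate_succ]
    funext x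
    rw [dl_cons, SchwartzMap.lineDerivOp_apply]
    rfl

lemma mderiv_eq {n : ℕ} (α : Fin n → ℕ) (φ : Sch n) : mderiv α (fun y => φ y) = fun y => dl (lst α) φ y := by
  unfold mderiv lst
  generalize List.finRange n = L
  induction L with
  | nil => rfl
  | cons i L ih =>
    rw [List.foldr_cons, ih, List.flatMap_cons, pd_iter]
    funext y
    rw [dl_append]

lemma lst_length {n : ℕ} (α : Fin n → ℕ) : (lst α).length = mdeg α := by
  unfold lst mdeg
  simp [List.length_flatMap, Fin.sum_univ_def]

lemma lst_count {n : ℕ} (α : Fin n → ℕ) (i : Fin n) : (lst α).count i = α i := by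
  unfold lst
  rw [List.count_flatMap]
  have : (List.count i ∘ fun j => List.replicate (α j) j) = fun j => if j = i then α j else 0 := by
    funext j
    simp [List.count_replicate]
  rw [this, ← Fin.sum_univ_def]
  simp

lemma lineDeriv_comm {n : ℕ} (u v : Rn n) (φ : Sch n) :
    LineDeriv.lineDerivOp u (LineDeriv.lineDerivOp v φ) = LineDeriv.lineDerivOp v (LineDeriv.lineDerivOp u φ) := by
  apply (FourierTransform.fourierCLE ℂ (Sch n)).injective
  simp only [FourierTransform.fourierCLE_apply]
  simp only [SchwartzMap.fourier_lineDerivOp_eq]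
  ext x
  have h1 : ∀ m : Rn n, (inner ℝ · m).HasTemperateGrowth := fun m => ((innerSL ℝ).flip m).hasTemperateGrowth
  simp [SchwartzMap.smulLeftCLM_apply_apply (h1 _)]
  ring

lemma dl_perm {n : ℕ} {L L' : List (Fin n)} (h : L.Perm L') (φ : Sch n) : dl L φ = dl L' φ := by
  induction h with
  | nil => rfl
  | cons i _ ih => rw [dl_cons, dl_cons, ih]
  | swap i j L => simp only [dl_cons]; exact lineDeriv_comm _ _ _
  | trans _ _ h1 h2 => exact h1.trans h2

lemma dl_eq_mderiv {n : ℕ} (L : List (Fin n)) (φ : Sch n) (x : Rn n) :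
    dl L φ x = mderiv (fun i => L.count i) (fun y => φ y) x := by
  rw [mderiv_eq]
  rw [dl_perm (L := L) (L' := lst (fun i => L.count i))]
  rw [List.perm_iff_count]
  intro i
  rw [lst_count]

lemma iter_le {n l : ℕ} (φ : Sch n) (x : Rn n) {c : ℝ} (hc : 0 ≤ c)
    (h : ∀ α : Fin n → ℕ, mdeg α = l → ‖mderiv α (fun y => φ y) x‖ ≤ c) :
    ‖iteratedFDeriv ℝ l φ x‖ ≤ n ^ l * c := by
  refine ContinuousMultilinearMap.opNorm_le_bound (by positivity) fun m => ?_
  have hm : m = fun i => ∑ j : Fin n, m i j • ev j := by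
    funext i
    have := (EuclideanSpace.basisFun (Fin n) ℝ).sum_repr (m i)
    simpa [ev] using this.symm
  have hb : ∀ r : Fin l → Fin n, ‖iteratedFDeriv ℝ l φ x (fun i => m i (r i) • ev (r i))‖ ≤ (∏ i, ‖m i‖) * c := by
    intro r
    rw [ContinuousMultilinearMap.map_smul_univ, norm_smul, norm_prod]
    refine mul_le_mul (Finset.prod_le_prod (fun _ _ => norm_nonneg _) fun i _ => ?_) ?_ (norm_nonneg _) (Finset.prod_nonneg fun _ _ => norm_nonneg _)
    · exact PiLp.norm_apply_le (m i) (r i)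
    · rw [← dl_ofFn_apply, dl_eq_mderiv]
      apply h
      have := lst_length (fun i => (List.ofFn r).count i)
      rw [← this]
      have hp : (lst fun i => (List.ofFn r).count i).Perm (List.ofFn r) := by
        rw [List.perm_iff_count]; intro i; rw [lst_count]
      rw [hp.length_eq]; simp
  calc ‖iteratedFDeriv ℝ l φ x m‖ = ‖∑ r : Fin l → Fin n, iteratedFDeriv ℝ l φ x (fun i => m i (r i) • ev (r i))‖ := by
        conv_lhs => rw [hm]
        rw [ContinuousMultilinearMap.map_sum]
    _ ≤ ∑ r : Fin l → Fin n, (∏ i, ‖m i‖) * c := norm_sum_le_of_le _ fun r _ => hb r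
    _ = _ := by
        simp; ring


/-- bounded families of Schwartz functions -/
def SB {ι : Type} {n : ℕ} (G : ι → Sch n) (w : ι → ℝ) : Prop :=
  ∀ m l : ℕ, ∃ C : ℝ, 0 ≤ C ∧ ∀ i x, ‖x‖ ^ m * ‖iteratedFDeriv ℝ l (G i) x‖ ≤ C * w i

lemma SB.semi {ι : Type} {n : ℕ} {G : ι → Sch n} {w : ι → ℝ} (h : SB G w) (hw : ∀ i, 0 ≤ w i) (m l : ℕ) :
    ∃ C : ℝ, 0 ≤ C ∧ ∀ i, SchwartzMap.seminorm ℂ m l (G i) ≤ C * w i := by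
  obtain ⟨C, hC, h⟩ := h m l
  exact ⟨C, hC, fun i => SchwartzMap.seminorm_le_bound ℂ m l _ (mul_nonneg hC (hw i)) (h i)⟩

lemma SB.sup {ι : Type} {n : ℕ} {G : ι → Sch n} {w : ι → ℝ} (h : SB G w) (hw : ∀ i, 0 ≤ w i) (s : Finset (ℕ × ℕ)) :
    ∃ C : ℝ, 0 ≤ C ∧ ∀ i, (s.sup (schwartzSeminormFamily ℂ (Rn n) ℂ)) (G i) ≤ C * w i := by
  choose C hC hb using fun p : ℕ × ℕ => h.semi hw p.1 p.2
  refine ⟨∑ p ∈ s, C p, Finset.sum_nonneg fun p _ => hC p, fun i => ?_⟩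
  refine Seminorm.finset_sup_apply_le (mul_nonneg (Finset.sum_nonneg fun p _ => hC p) (hw i)) fun p hp => ?_
  refine (hb p i).trans (mul_le_mul_of_nonneg_right ?_ (hw i))
  exact Finset.single_le_sum (fun p _ => hC p) hp

lemma SB_of_const {ι : Type} {n : ℕ} (g : Sch n) : SB (fun _ : ι => g) (fun _ => 1) := by
  intro m l
  refine ⟨SchwartzMap.seminorm ℂ m l g, apply_nonneg _ _, fun i x => ?_⟩
  rw [mul_one]
  exact SchwartzMap.le_seminorm ℂ m l g x

lemma SB.comp {ι κ : Type} {n : ℕ} {G : ι → Sch n} {w : ι → ℝ} (h : SB G w) (e : κ → ι) :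
    SB (fun k => G (e k)) (fun k => w (e k)) := fun m l => by
  obtain ⟨C, hC, h⟩ := h m l
  exact ⟨C, hC, fun i => h _⟩

lemma SB.mono {ι : Type} {n : ℕ} {G : ι → Sch n} {w v : ι → ℝ} (h : SB G w) {c : ℝ} (hc : 0 ≤ c)
    (hw : ∀ i, w i ≤ c * v i) : SB G v := fun m l => by
  obtain ⟨C, hC, h⟩ := h m l
  refine ⟨C * c, by positivity, fun i x => (h i x).trans ?_⟩
  rw [mul_assoc]
  exact mul_le_mul_of_nonneg_left (hw i) hC

lemma SB.inv {ι : Type} {n : ℕ} {G : ι → Sch n} {w : ι → ℝ} (h : SB G w) (hw : ∀ i, 0 ≤ w i) :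
    SB (fun i => invFourierS (G i)) w := by
  intro m l
  have hcont : Continuous ((SchwartzMap.seminorm ℂ m l).comp
      ((FourierTransform.fourierCLE ℂ (Sch n)).symm.toContinuousLinearMap.toLinearMap) : Seminorm ℂ (Sch n)) :=
    ((schwartz_withSeminorms ℂ (Rn n) ℂ).continuous_seminorm (m, l)).comp (FourierTransform.fourierCLE ℂ (Sch n)).symm.continuous
  obtain ⟨s, C, -, hb⟩ := Seminorm.bound_of_continuous (schwartz_withSeminorms ℂ (Rn n) ℂ) _ hcont
  obtain ⟨C', hC', hs⟩ := h.sup hw s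
  refine ⟨C * C', by positivity, fun i x => (SchwartzMap.le_seminorm ℂ m l _ x).trans ((hb (G i)).trans ?_)⟩
  rw [mul_assoc]
  exact mul_le_mul_of_nonneg_left (hs i) C.2

lemma SB.decay {ι : Type} {n : ℕ} {G : ι → Sch n} {w : ι → ℝ} (h : SB G w) (hw : ∀ i, 0 ≤ w i) (A : ℝ) :
    ∃ C : ℝ, 0 ≤ C ∧ ∀ i x, ‖G i x‖ ≤ C * w i * (1 + ‖x‖) ^ (-A) := by
  obtain ⟨k, hk⟩ := exists_nat_ge A
  obtain ⟨C, hC, hs⟩ := h.sup hw (Finset.Iic (k, 0))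
  refine ⟨2 ^ k * C, by positivity, fun i x => ?_⟩
  have h1 := SchwartzMap.one_add_le_sup_seminorm_apply (𝕜 := ℂ) (m := (k, 0)) (k := k) (n := 0) le_rfl le_rfl (G i) x
  simp only [norm_iteratedFDeriv_zero] at h1
  have h2 := h1.trans (mul_le_mul_of_nonneg_left (hs i) (by positivity))
  have hx : 1 ≤ 1 + ‖x‖ := by linarith [norm_nonneg x]
  have hA : (1 + ‖x‖) ^ A ≤ (1 + ‖x‖) ^ k := by
    rw [← Real.rpow_natCast]; exact Real.rpow_le_rpow_of_exponent_le hx hk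
  rw [Real.rpow_neg (by linarith), ← div_eq_mul_inv, le_div_iff₀ (by positivity)]
  calc _ = (1 + ‖x‖) ^ A * ‖G i x‖ := mul_comm _ _
    _ ≤ (1 + ‖x‖) ^ k * ‖G i x‖ := mul_le_mul_of_nonneg_right hA (norm_nonneg _)
    _ ≤ _ := by rw [mul_assoc]; exact h2

lemma SB.mul_on {ι : Type} {n : ℕ} {G H : ι → Sch n} {w v : ι → ℝ} (h : SB G w) (hw : ∀ i, 0 ≤ w i) (hv : ∀ i, 0 ≤ v i)
    (S : Set (Rn n)) (hS : ∀ i, ∀ x ∉ S, (G i : Rn n → ℂ) =ᶠ[𝓝 x] 0)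
    (hH : ∀ l : ℕ, ∃ C : ℝ, 0 ≤ C ∧ ∀ i, ∀ x ∈ S, ‖iteratedFDeriv ℝ l (H i) x‖ ≤ C * v i) :
    SB (fun i => mulS (H i) (G i)) (fun i => w i * v i) := by
  intro m l
  choose C hC hb using fun l => h m l
  choose D hD hd using hH
  refine ⟨∑ i ∈ Finset.range (l + 1), (l.choose i : ℝ) * D i * C (l - i), Finset.sum_nonneg fun i _ => ?_, fun i x => ?_⟩
  · have := hC (l - i); have := hD i; positivity
  by_cases hx : x ∈ S
  · have h1 := norm_iteratedFDeriv_mul_le (N := l) ((H i).smooth l) ((G i).smooth l) x (n := l) le_rfl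
    have e : ((mulS (H i) (G i) : Sch n) : Rn n → ℂ) = fun y => H i y * G i y := rfl
    rw [e]
    refine (mul_le_mul_of_nonneg_left h1 (by positivity)).trans ?_
    rw [Finset.mul_sum, Finset.sum_mul]
    refine Finset.sum_le_sum fun a _ => ?_
    calc _ = (l.choose a : ℝ) * ‖iteratedFDeriv ℝ a (H i) x‖ * (‖x‖ ^ m * ‖iteratedFDeriv ℝ (l - a) (G i) x‖) := by ring
      _ ≤ (l.choose a : ℝ) * (D a * v i) * (C (l - a) * w i) := by
        refine mul_le_mul (mul_le_mul_of_nonneg_left (hd a i x hx) (by positivity)) (hb _ i x) (by positivity) ?_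
        have := hD a; have := hv i; positivity
      _ = _ := by ring
  · have e : ((mulS (H i) (G i) : Sch n) : Rn n → ℂ) =ᶠ[𝓝 x] 0 := by
      filter_upwards [hS i x hx] with y hy
      simp [hy]
    have e2 : iteratedFDeriv ℝ l (mulS (H i) (G i)) x = 0 := by
      rw [(e.iteratedFDeriv ℝ l).eq_of_nhds]
      simp
    rw [e2, norm_zero, mul_zero]
    refine mul_nonneg (Finset.sum_nonneg fun i _ => ?_) (mul_nonneg (hw i) (hv i))
    have := hC (l - i); have := hD i; positivity

lemma SB.mul {ι : Type} {n : ℕ} {G H : ι → Sch n} {w v : ι → ℝ} (h : SB G w) (hw : ∀ i, 0 ≤ w i) (hv : ∀ i, 0 ≤ v i)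
    (hH : SB H v) : SB (fun i => mulS (H i) (G i)) (fun i => w i * v i) := by
  refine h.mul_on hw hv Set.univ (fun i x hx => absurd (Set.mem_univ x) hx) fun l => ?_
  obtain ⟨C, hC, hb⟩ := hH 0 l
  exact ⟨C, hC, fun i x _ => by simpa using hb i x⟩

lemma iter_dilate {n : ℕ} (a : Sch n) {t : ℝ} (ht : t ≠ 0) (l : ℕ) (x : Rn n) :
    iteratedFDeriv ℝ l (dilate a t) x = t ^ l • iteratedFDeriv ℝ l a (t • x) := by
  have e : ((dilate a t : Sch n) : Rn n → ℂ) = fun y => a (t • y) := funext fun y => dilate_apply a ht y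
  rw [e, iteratedFDeriv_comp_const_smul (i := l) t (a.smooth l)]

/-- low frequency -/
lemma DB_dilate {ι : Type} {n : ℕ} {G : ι → Sch n} (h : SB G (fun _ => 1)) {t : ι → ℝ} (ht : ∀ i, 0 < t i) (ht1 : ∀ i, t i ≤ 1) (l : ℕ) :
    ∃ C : ℝ, 0 ≤ C ∧ ∀ i, ∀ x, ‖iteratedFDeriv ℝ l (dilate (G i) (t i)) x‖ ≤ C * 1 := by
  obtain ⟨C, hC, hb⟩ := h 0 l
  refine ⟨C, hC, fun i x => ?_⟩
  rw [iter_dilate _ (ht i).ne', norm_smul, norm_pow, Real.norm_of_nonneg (ht i).le]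
  have := hb i (t i • x)
  rw [pow_zero, one_mul] at this
  calc _ ≤ 1 * ‖iteratedFDeriv ℝ l (G i) (t i • x)‖ :=
        mul_le_mul_of_nonneg_right (pow_le_one₀ (ht i).le (ht1 i)) (norm_nonneg _)
    _ ≤ _ := by rw [one_mul]; exact this

/-- high frequency -/
lemma DB_dilate_high {ι : Type} {n : ℕ} {G : ι → Sch n} (h : SB G (fun _ => 1)) {t : ι → ℝ} (ht1 : ∀ i, 1 ≤ t i)
    {ρ : ℝ} (hρ : 0 < ρ) (M l : ℕ) :
    ∃ C : ℝ, 0 ≤ C ∧ ∀ i, ∀ x ∈ {x : Rn n | ρ ≤ ‖x‖}, ‖iteratedFDeriv ℝ l (dilate (G i) (t i)) x‖ ≤ C * ((t i) ^ M)⁻¹ := by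
  obtain ⟨C, hC, hb⟩ := h (M + l) l
  refine ⟨C * (ρ ^ (M + l))⁻¹, by positivity, fun i x hx => ?_⟩
  have ht : 0 < t i := by linarith [ht1 i]
  rw [iter_dilate _ ht.ne', norm_smul, norm_pow, Real.norm_of_nonneg ht.le]
  have h1 := hb i (t i • x)
  rw [norm_smul, Real.norm_of_nonneg ht.le, mul_one] at h1
  have h2 : (t i * ρ) ^ (M + l) * ‖iteratedFDeriv ℝ l (G i) (t i • x)‖ ≤ C := by
    refine le_trans (mul_le_mul_of_nonneg_right ?_ (norm_nonneg _)) h1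
    exact pow_le_pow_left₀ (by positivity) (mul_le_mul_of_nonneg_left hx ht.le) _
  rw [← div_eq_mul_inv, ← div_eq_mul_inv, div_div, le_div_iff₀ (by positivity)]
  refine le_trans (le_of_eq ?_) h2
  rw [mul_pow, pow_add (t i)]; ring

/-- growth under dilations -/
lemma SB_dilate_pow {n : ℕ} {G : ℕ → Sch n} {w : ℕ → ℝ} (hw : ∀ i, 0 ≤ w i) (h : SB G w) (m l : ℕ) : ∃ C : ℝ, 0 ≤ C ∧ ∀ k x,
    ‖x‖ ^ m * ‖iteratedFDeriv ℝ l (dilate (G k) (((2:ℝ) ^ k)⁻¹)) x‖ ≤ C * (w k * (2 ^ k) ^ m) := by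
  obtain ⟨C, hC, hb⟩ := h m l
  refine ⟨C, hC, fun k x => ?_⟩
  have h2 : (0:ℝ) < 2 ^ k := by positivity
  rw [iter_dilate _ (by positivity), norm_smul, norm_pow, Real.norm_of_nonneg (by positivity)]
  have h1 := hb k (((2:ℝ) ^ k)⁻¹ • x)
  rw [norm_smul, Real.norm_of_nonneg (by positivity)] at h1
  have h3 : (((2:ℝ) ^ k)⁻¹) ^ l ≤ 1 := pow_le_one₀ (by positivity) (inv_le_one_of_one_le₀ (one_le_pow₀ (by norm_num)))
  calc _ = (((2:ℝ) ^ k)⁻¹) ^ l * (2 ^ k) ^ m * ((((2:ℝ) ^ k)⁻¹ * ‖x‖) ^ m * ‖iteratedFDeriv ℝ l (G k) (((2:ℝ) ^ k)⁻¹ • x)‖) := by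
        rw [mul_pow, inv_pow _ m]; field_simp
    _ ≤ 1 * (2 ^ k) ^ m * (C * w k) := by
        refine mul_le_mul (mul_le_mul_of_nonneg_right h3 (by positivity)) h1 (by positivity) (by positivity)
    _ = _ := by ring


/-- weight -/
def wtK {n : ℕ} (K : ℕ) : Rn n → ℂ := fun x => (((1 + ‖x‖ ^ 2) ^ K : ℝ) : ℂ)

lemma wtK_growth {n : ℕ} (K : ℕ) : (wtK (n := n) K).HasTemperateGrowth := by
  have h1 : (fun x : Rn n => (1 + ‖x‖ ^ 2 : ℝ)).HasTemperateGrowth := by fun_prop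
  have h2 : (fun x : Rn n => ((1 + ‖x‖ ^ 2) ^ K : ℝ)).HasTemperateGrowth := by
    induction K with
    | zero => simpa using Function.HasTemperateGrowth.const (1:ℝ)
    | succ K ih => simp only [pow_succ]; exact ih.mul h1
  exact Complex.ofRealCLM.hasTemperateGrowth.comp h2

/-- embedding into bounded functions -/
def JJ {n : ℕ} (K L : ℕ) : Sch n →L[ℂ] ((Fin n → Fin (L + 1)) → BoundedContinuousFunction (Rn n) ℂ) :=
  ContinuousLinearMap.pi fun α => (toBoundedContinuousFunctionCLM ℂ (Rn n) ℂ).comp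
    ((smulLeftCLM ℂ (wtK K)).comp (dl (lst fun i => (α i : ℕ))))

lemma JJ_apply {n : ℕ} (K L : ℕ) (φ : Sch n) (α : Fin n → Fin (L + 1)) (x : Rn n) :
    JJ K L φ α x = wtK K x * dl (lst fun i => (α i : ℕ)) φ x := by
  change smulLeftCLM ℂ (wtK K) (dl (lst fun i => (α i : ℕ)) φ) x = _
  rw [smulLeftCLM_apply_apply (wtK_growth K)]; rfl

lemma semi_le_JJ {n : ℕ} (K L : ℕ) (φ : Sch n) :
    schSemi K L φ ≤ (Fintype.card (Fin n → Fin (L + 1))) * ‖JJ K L φ‖ := by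
  unfold schSemi
  refine Real.iSup_le (fun x => ?_) (by positivity)
  rw [Finset.mul_sum, ← nsmul_eq_mul, ← Finset.card_univ]
  refine Finset.sum_le_card_nsmul _ _ _ fun α _ => ?_
  split_ifs with h
  · rw [mderiv_eq]
    have h1 : ‖JJ K L φ α x‖ ≤ ‖JJ K L φ‖ :=
      (BoundedContinuousFunction.norm_coe_le_norm _ x).trans (norm_le_pi_norm (JJ K L φ) α)
    refine le_trans ?_ h1
    rw [JJ_apply, norm_mul]
    refine mul_le_mul_of_nonneg_right ?_ (norm_nonneg _)
    unfold wtK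
    rw [Complex.norm_real, Real.norm_of_nonneg (by positivity)]
    have hk : (0:ℝ) ≤ K := by positivity
    have := Real.rpow_le_rpow_of_exponent_le (by linarith [sq_nonneg ‖x‖] : (1:ℝ) ≤ 1 + ‖x‖ ^ 2) (by linarith : (K:ℝ) / 2 ≤ K)
    rwa [Real.rpow_natCast] at this
  · simp

lemma td_bound {n : ℕ} {E : Type*} [NormedAddCommGroup E] [NormedSpace ℂ E] (f : TDist n E) :
    ∃ (C : ℝ) (K L : ℕ), 0 ≤ C ∧ ∀ φ, ‖f.toFun φ‖ ≤ C * ‖JJ K L φ‖ := by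
  obtain ⟨c, K, L, h⟩ := f.bound
  refine ⟨|c| * (Fintype.card (Fin n → Fin (L + 1))), K, L, by positivity, fun φ => (h φ).trans ?_⟩
  have h0 : 0 ≤ schSemi K L φ := by
    unfold schSemi
    refine Real.iSup_nonneg fun x => ?_
    refine mul_nonneg (by positivity) (Finset.sum_nonneg fun α _ => ?_)
    split_ifs <;> positivity
  rw [mul_assoc]
  exact mul_le_mul (le_abs_self c) (semi_le_JJ K L φ) h0 (abs_nonneg c)

lemma td_cont {n : ℕ} {E : Type*} [NormedAddCommGroup E] [NormedSpace ℂ E] (f : TDist n E) :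
    Continuous f.toFun := by
  obtain ⟨C, K, L, hC, h⟩ := td_bound f
  refine continuous_of_continuousAt_zero f.toFun ?_
  unfold ContinuousAt
  rw [map_zero]
  refine squeeze_zero_norm h ?_
  have : Continuous fun φ : Sch n => C * ‖JJ K L φ‖ := by fun_prop
  have h2 := this.tendsto 0
  simpa using h2

lemma sr_eq {n : ℕ} (a : Sch n) (w : Rn n) :
    ((shiftReflect a w : Sch n) : Rn n → ℂ) = fun y => dilate a (-1) (y - w) := by
  funext y
  rw [dilate_apply _ (by norm_num), shiftReflect_apply]
  simp

lemma sr_iter {n : ℕ} (a : Sch n) (w x : Rn n) (l : ℕ) :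
    iteratedFDeriv ℝ l (shiftReflect a w) x = iteratedFDeriv ℝ l (dilate a (-1)) (x - w) := by
  rw [sr_eq, iteratedFDeriv_comp_sub]

lemma dil_neg_iter {n : ℕ} (a : Sch n) (x : Rn n) (l : ℕ) :
    ‖iteratedFDeriv ℝ l (dilate a (-1)) x‖ = ‖iteratedFDeriv ℝ l a (-x)‖ := by
  rw [iter_dilate _ (by norm_num), norm_smul]; simp

lemma pow_shift {n : ℕ} (x w : Rn n) (m : ℕ) : ‖x‖ ^ m ≤ (1 + ‖w‖) ^ m * (1 + ‖x - w‖) ^ m := by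
  rw [← mul_pow]
  refine pow_le_pow_left₀ (norm_nonneg x) ?_ m
  have : ‖x‖ ≤ ‖x - w‖ + ‖w‖ := by simpa using norm_add_le (x - w) w
  nlinarith [norm_nonneg w, norm_nonneg (x - w), mul_nonneg (norm_nonneg w) (norm_nonneg (x - w))]

lemma sr_semi {n : ℕ} (a : Sch n) (w : Rn n) (m l : ℕ) :
    SchwartzMap.seminorm ℂ m l (shiftReflect a w) ≤
      (1 + ‖w‖) ^ m * (2 ^ m * ((Finset.Iic (m, l)).sup fun p => SchwartzMap.seminorm ℂ p.1 p.2) a) := by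
  refine SchwartzMap.seminorm_le_bound ℂ m l _ (by positivity) fun x => ?_
  rw [sr_iter, dil_neg_iter]
  have h1 := SchwartzMap.one_add_le_sup_seminorm_apply (𝕜 := ℂ) (m := (m, l)) (k := m) (n := l) le_rfl le_rfl a (-(x - w))
  rw [norm_neg] at h1
  refine (mul_le_mul_of_nonneg_right (pow_shift x w m) (norm_nonneg _)).trans ?_
  rw [mul_assoc]
  exact mul_le_mul_of_nonneg_left h1 (by positivity)

lemma sr_cont {n : ℕ} (a : Sch n) : Continuous (shiftReflect a) := by
  rw [continuous_iff_continuousAt]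
  intro w
  rw [ContinuousAt, (schwartz_withSeminorms ℂ (Rn n) ℂ).tendsto_nhds]
  rintro ⟨m, l⟩ ε hε
  set D := 2 ^ m * ((Finset.Iic (m, l + 1)).sup fun p => SchwartzMap.seminorm ℂ p.1 p.2) a with hD
  have hD0 : 0 ≤ D := by positivity
  have key : ∀ v ∈ ball w 1, SchwartzMap.seminorm ℂ m l (shiftReflect a v - shiftReflect a w) ≤
      (2 + ‖w‖) ^ m * D * ‖v - w‖ := by
    intro v hv
    refine SchwartzMap.seminorm_le_bound ℂ m l _ (by positivity) fun x => ?_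
    have e : iteratedFDeriv ℝ l (shiftReflect a v - shiftReflect a w : Sch n) x =
        iteratedFDeriv ℝ l (dilate a (-1)) (x - v) - iteratedFDeriv ℝ l (dilate a (-1)) (x - w) := by
      rw [← sr_iter, ← sr_iter]
      exact congrFun (iteratedFDeriv_sub ((shiftReflect a v).smooth l) ((shiftReflect a w).smooth l)) x
    rw [e]
    have hd : ∀ u ∈ ball (x - w) 1, DifferentiableAt ℝ (iteratedFDeriv ℝ l (dilate a (-1))) u := by
      intro u _
      exact (((dilate a (-1)).smooth ⊤).differentiable_iteratedFDeriv (m := l) (by exact_mod_cast ENat.natCast_lt_top l)).differentiableAt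
    have hb : ∀ u ∈ ball (x - w) 1, ‖fderiv ℝ (iteratedFDeriv ℝ l (dilate a (-1))) u‖ ≤
        (2 + ‖w‖) ^ m * D / (1 + ‖x‖) ^ m := by
      intro u hu
      rw [norm_fderiv_iteratedFDeriv, dil_neg_iter, le_div_iff₀ (by positivity)]
      have h1 := SchwartzMap.one_add_le_sup_seminorm_apply (𝕜 := ℂ) (m := (m, l + 1)) (k := m) (n := l + 1) le_rfl le_rfl a (-u)
      rw [norm_neg] at h1
      have h3 : ‖u - (x - w)‖ < 1 := by simpa [dist_eq_norm] using hu
      have h4 : ‖x‖ ≤ ‖u‖ + ‖u - (x - w)‖ + ‖w‖ := by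
        have : x = u - (u - (x - w)) + w := by abel
        calc ‖x‖ = ‖u - (u - (x - w)) + w‖ := by rw [← this]
          _ ≤ ‖u - (u - (x - w))‖ + ‖w‖ := norm_add_le _ _
          _ ≤ _ := by gcongr; exact norm_sub_le _ _
      have h5 : (1 + ‖x‖) ^ m ≤ (2 + ‖w‖) ^ m * (1 + ‖u‖) ^ m := by
        rw [← mul_pow]
        refine pow_le_pow_left₀ (by positivity) ?_ m
        nlinarith [norm_nonneg w, norm_nonneg u, mul_nonneg (norm_nonneg w) (norm_nonneg u)]
      rw [mul_comm]
      refine (mul_le_mul_of_nonneg_right h5 (norm_nonneg _)).trans ?_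
      rw [mul_assoc]
      exact mul_le_mul_of_nonneg_left h1 (by positivity)
    have hv2 : x - v ∈ ball (x - w) 1 := by simpa [dist_eq_norm, norm_sub_rev] using hv
    have := (convex_ball (x - w) 1).norm_image_sub_le_of_norm_fderiv_le (𝕜 := ℝ) hd hb
      (mem_ball_self one_pos) hv2
    rw [sub_sub_sub_cancel_left, norm_sub_rev w v] at this
    have h6 : ‖x‖ ^ m ≤ (1 + ‖x‖) ^ m := pow_le_pow_left₀ (norm_nonneg x) (by linarith) m
    refine (mul_le_mul h6 this (norm_nonneg _) (by positivity)).trans (le_of_eq ?_)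
    have : (1 + ‖x‖) ^ m ≠ 0 := by positivity
    field_simp
  have h2 : Tendsto (fun v => (2 + ‖w‖) ^ m * D * ‖v - w‖) (𝓝 w) (𝓝 0) := by
    have : Continuous fun v => (2 + ‖w‖) ^ m * D * ‖v - w‖ := by fun_prop
    simpa using this.tendsto w
  filter_upwards [h2.eventually (gt_mem_nhds hε), ball_mem_nhds w one_pos] with v hv hv'
  exact (key v hv').trans_lt hv

lemma tdConv_cont {n : ℕ} {E : Type*} [NormedAddCommGroup E] [NormedSpace ℂ E] (ψ : Sch n) (f : TDist n E) :
    Continuous (tdConv ψ f) := by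
  unfold tdConv
  exact ((td_cont f).comp (sr_cont ψ)).const_smul _

/-- bound of a continuous linear map -/
lemma clm_sr_bound {n : ℕ} {Y : Type*} [NormedAddCommGroup Y] [NormedSpace ℂ Y] (T : Sch n →L[ℂ] Y) :
    ∃ (s : Finset (ℕ × ℕ)) (C : ℝ) (K : ℕ), 0 ≤ C ∧ ∀ a w,
      ‖T (shiftReflect a w)‖ ≤ C * (1 + ‖w‖) ^ K * (s.sup (schwartzSeminormFamily ℂ (Rn n) ℂ)) a := by
  obtain ⟨s, C, -, hb⟩ := Seminorm.bound_of_continuous (schwartz_withSeminorms ℂ (Rn n) ℂ)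
    ((normSeminorm ℂ Y).comp T.toLinearMap) (continuous_norm.comp T.continuous)
  let s' : Finset (ℕ × ℕ) := s.biUnion fun p => Finset.Iic p
  let K := s.sup Prod.fst
  refine ⟨s', C * 2 ^ K, K, by positivity, fun a w => (hb _).trans ?_⟩
  change (C : ℝ) * (s.sup (schwartzSeminormFamily ℂ (Rn n) ℂ)) (shiftReflect a w) ≤ _
  rw [mul_assoc, mul_assoc]
  refine mul_le_mul_of_nonneg_left ?_ C.2
  refine Seminorm.finset_sup_apply_le (by positivity) fun p hp => ?_
  refine (sr_semi a w p.1 p.2).trans ?_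
  have hK : p.1 ≤ K := Finset.le_sup (f := Prod.fst) hp
  have h1 : (1 + ‖w‖) ^ p.1 ≤ (1 + ‖w‖) ^ K := pow_le_pow_right₀ (by linarith [norm_nonneg w]) hK
  have h2 : (2:ℝ) ^ p.1 ≤ 2 ^ K := pow_le_pow_right₀ (by norm_num) hK
  have h3 : ((Finset.Iic (p.1, p.2)).sup fun p => SchwartzMap.seminorm ℂ p.1 p.2) a ≤
      (s'.sup (schwartzSeminormFamily ℂ (Rn n) ℂ)) a := by
    have : (Finset.Iic (p.1, p.2)) ⊆ s' := fun r hr => Finset.mem_biUnion.mpr ⟨p, hp, hr⟩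
    exact (Finset.sup_mono (f := schwartzSeminormFamily ℂ (Rn n) ℂ) this) a
  calc (1 + ‖w‖) ^ p.1 * (2 ^ p.1 * ((Finset.Iic (p.1, p.2)).sup fun p => SchwartzMap.seminorm ℂ p.1 p.2) a)
      ≤ (1 + ‖w‖) ^ K * (2 ^ K * (s'.sup (schwartzSeminormFamily ℂ (Rn n) ℂ)) a) := by gcongr
    _ = _ := by ring

lemma sup_cont {n : ℕ} (s : Finset (ℕ × ℕ)) : Continuous fun a : Sch n => (s.sup (schwartzSeminormFamily ℂ (Rn n) ℂ)) a := by
  refine Finset.sup_induction (p := fun q : Seminorm ℂ (Sch n) => Continuous q) ?_ (fun a ha b hb => ?_)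
    fun i _ => (schwartz_withSeminorms ℂ (Rn n) ℂ).continuous_seminorm i
  · exact continuous_const (y := (0:ℝ))
  · exact Continuous.sup ha hb

lemma MB {n : ℕ} {E : Type*} [NormedAddCommGroup E] [NormedSpace ℂ E] (f : TDist n E) :
    ∃ (s : Finset (ℕ × ℕ)) (C : ℝ) (K : ℕ), 0 ≤ C ∧ ∀ b x,
      ‖mOp b f x‖ ≤ C * (1 + ‖x‖) ^ K * (s.sup (schwartzSeminormFamily ℂ (Rn n) ℂ)) b := by
  obtain ⟨s, C, K, hC, h⟩ := clm_sr_bound (⟨f.toFun, td_cont f⟩ : Sch n →L[ℂ] E)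
  obtain ⟨s', C', -, hb⟩ := Seminorm.bound_of_continuous (schwartz_withSeminorms ℂ (Rn n) ℂ)
    ((s.sup (schwartzSeminormFamily ℂ (Rn n) ℂ)).comp
      ((FourierTransform.fourierCLE ℂ (Sch n)).symm.toContinuousLinearMap.toLinearMap))
    ((sup_cont s).comp
      (FourierTransform.fourierCLE ℂ (Sch n)).symm.continuous)
  refine ⟨s', |((2 * π) ^ (-(n : ℝ) / 2) : ℝ)| * C * C', K, by positivity, fun b x => ?_⟩
  unfold mOp tdConv
  rw [norm_smul, Real.norm_eq_abs]
  have h1 := h (invFourierS b) x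
  have h2 : (s.sup (schwartzSeminormFamily ℂ (Rn n) ℂ)) (invFourierS b) ≤
      C' * (s'.sup (schwartzSeminormFamily ℂ (Rn n) ℂ)) b := hb b
  calc _ ≤ |((2 * π) ^ (-(n : ℝ) / 2) : ℝ)| * (C * (1 + ‖x‖) ^ K * (C' * (s'.sup (schwartzSeminormFamily ℂ (Rn n) ℂ)) b)) := by
        refine mul_le_mul_of_nonneg_left (h1.trans ?_) (abs_nonneg _)
        exact mul_le_mul_of_nonneg_left h2 (by positivity)
    _ = _ := by ring

/-- integral and linear maps controlled by an embedding -/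
lemma int_graph {S Y E Z : Type*} [AddCommGroup S] [Module ℝ S] [NormedAddCommGroup Y] [NormedSpace ℝ Y] [CompleteSpace Y]
    [NormedAddCommGroup E] [NormedSpace ℝ E] [CompleteSpace E] [MeasurableSpace Z] {μ : Measure Z}
    (T : S →ₗ[ℝ] E) (J : S →ₗ[ℝ] Y) (C : ℝ) (h : ∀ φ, ‖T φ‖ ≤ C * ‖J φ‖) (g : Z → S) (Φ : S)
    (h1 : Integrable (fun z => J (g z)) μ) (h2 : Integrable (fun z => T (g z)) μ)
    (h3 : J Φ = ∫ z, J (g z) ∂μ) : T Φ = ∫ z, T (g z) ∂μ := by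
  let R : S →ₗ[ℝ] Y × E := J.prod T
  let P : Submodule ℝ (Y × E) := R.range.topologicalClosure
  have hP : ∀ v ∈ P, ‖v.2‖ ≤ C * ‖v.1‖ := by
    intro v hv
    have hcl : IsClosed {v : Y × E | ‖v.2‖ ≤ C * ‖v.1‖} := isClosed_le (by fun_prop) (by fun_prop)
    have : (R.range : Set (Y × E)) ⊆ {v : Y × E | ‖v.2‖ ≤ C * ‖v.1‖} := by
      rintro _ ⟨φ, rfl⟩
      exact h φ
    exact closure_minimal this hcl hv
  have hint : Integrable (fun z => R (g z)) μ := h1.prodMk h2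
  have hmem : ∫ z, R (g z) ∂μ ∈ P := by
    by_contra hcon
    obtain ⟨F, u, hF1, hF2⟩ := geometric_hahn_banach_closed_point (s := (P : Set (Y × E))) P.convex R.range.isClosed_topologicalClosure hcon
    have hz : ∀ v ∈ P, F v = 0 := by
      intro v hv
      by_contra hne
      have := hF1 ((u / F v) • v) (P.smul_mem _ hv)
      rw [map_smul, smul_eq_mul, div_mul_cancel₀ _ hne] at this
      exact lt_irrefl _ this
    have h0 : 0 < u := by simpa using hF1 0 P.zero_mem
    rw [← F.integral_comp_comm hint] at hF2
    have : ∫ z, F (R (g z)) ∂μ = 0 := by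
      rw [integral_eq_zero_of_ae]
      exact Filter.Eventually.of_forall fun z => hz _ (Submodule.le_topologicalClosure _ ⟨g z, rfl⟩)
    linarith
  have hd : R Φ - ∫ z, R (g z) ∂μ ∈ P := P.sub_mem (Submodule.le_topologicalClosure _ ⟨Φ, rfl⟩) hmem
  have := hP _ hd
  have e : ∫ z, R (g z) ∂μ = (∫ z, J (g z) ∂μ, ∫ z, T (g z) ∂μ) := integral_pair h1 h2
  rw [e] at this
  have e2 : R Φ = (J Φ, T Φ) := rfl
  rw [e2, ← h3] at this
  simpa [sub_eq_zero] using this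

/-- symbols of derivatives -/
def pp {n : ℕ} : List (Fin n) → Sch n → Sch n
  | [], b => b
  | i :: L, b => (2 * π * Complex.I) • smulLeftCLM ℂ (inner ℝ · (ev i)) (pp L b)

lemma pp_cons {n : ℕ} (i : Fin n) (L : List (Fin n)) (b : Sch n) (x : Rn n) :
    pp (i :: L) b x = (2 * π * Complex.I) * ((inner ℝ x (ev i) : ℝ) * pp L b x) := by
  have hg : (inner ℝ · (ev i) : Rn n → ℝ).HasTemperateGrowth := ((innerSL ℝ).flip (ev i)).hasTemperateGrowth
  change (2 * π * Complex.I) • (smulLeftCLM ℂ (inner ℝ · (ev i)) (pp L b) x) = _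
  rw [smulLeftCLM_apply_apply hg, smul_eq_mul, Complex.real_smul]

lemma pp_mul {n : ℕ} (L : List (Fin n)) (a b : Sch n) : pp L (mulS a b) = mulS a (pp L b) := by
  induction L with
  | nil => rfl
  | cons i L ih =>
    ext x
    rw [pp_cons, ih, mulS_apply, mulS_apply, pp_cons]
    ring

lemma invF_eq {n : ℕ} (a : Sch n) : invFourierS a = 𝓕⁻ a := rfl

lemma fF_eq {n : ℕ} (a : Sch n) : fourierS a = 𝓕 a := rfl

lemma dl_invF {n : ℕ} (L : List (Fin n)) (b : Sch n) : dl L (invFourierS b) = invFourierS (pp L b) := by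
  induction L with
  | nil => rfl
  | cons i L ih =>
    rw [dl_cons, ih, invF_eq, invF_eq, SchwartzMap.lineDerivOp_fourierInv_eq]
    rfl

lemma invF_mul {n : ℕ} (a b : Sch n) (y : Rn n) :
    invFourierS (mulS a b) y = ∫ z, invFourierS a z * invFourierS b (y - z) := by
  have h := SchwartzMap.convolution_apply (ContinuousLinearMap.mul ℂ ℂ) (invFourierS a) (invFourierS b) y
  have e : SchwartzMap.convolution (ContinuousLinearMap.mul ℂ ℂ) (invFourierS a) (invFourierS b) = invFourierS (mulS a b) := by
    have h1 : 𝓕 (SchwartzMap.convolution (ContinuousLinearMap.mul ℂ ℂ) (invFourierS a) (invFourierS b)) = mulS a b := by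
      rw [SchwartzMap.fourier_convolution, invF_eq, invF_eq]
      simp [mulS]
    rw [← h1]
    exact ((FourierTransform.fourierCLE ℂ (Sch n)).symm_apply_apply _).symm
  rw [e] at h
  rw [h]
  rfl

lemma dl_sr {n : ℕ} (L : List (Fin n)) (a : Sch n) (w x : Rn n) :
    dl L (shiftReflect a w) x = (-1) ^ L.length * dl L a (w - x) := by
  have h1 := dl_ofFn_apply L.get (shiftReflect a w) x
  have h2 := dl_ofFn_apply L.get a (w - x)
  rw [List.ofFn_get] at h1 h2
  rw [h1, h2, sr_iter, iter_dilate _ (by norm_num)]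
  simp

lemma JJ_conv {n : ℕ} (K L : ℕ) (a b : Sch n) (w : Rn n) (α : Fin n → Fin (L + 1)) (x : Rn n) :
    JJ K L (shiftReflect (invFourierS (mulS a b)) w) α x =
      ∫ z, JJ K L (invFourierS a z • shiftReflect (invFourierS b) (w - z)) α x := by
  simp only [map_smul, Pi.smul_apply, BoundedContinuousFunction.coe_smul, JJ_apply, dl_sr, dl_invF, pp_mul, invF_mul]
  rw [← integral_const_mul, ← integral_const_mul]
  refine integral_congr_ae (Filter.Eventually.of_forall fun z => ?_)
  simp only [smul_eq_mul]
  rw [show w - x - z = w - z - x by abel]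
  ring

lemma conv_integrable {n : ℕ} {Y : Type*} [NormedAddCommGroup Y] [NormedSpace ℂ Y] (T : Sch n →L[ℂ] Y) (a b : Sch n) (w : Rn n) :
    Integrable fun z => T (a z • shiftReflect b (w - z)) := by
  obtain ⟨s, C, K, hC, h⟩ := clm_sr_bound T
  have hc : Continuous fun z => T (a z • shiftReflect b (w - z)) :=
    T.continuous.comp (a.continuous.smul ((sr_cont b).comp (by fun_prop)))
  set D := (s.sup (schwartzSeminormFamily ℂ (Rn n) ℂ)) b
  have hD : 0 ≤ D := apply_nonneg _ _
  have hi : Integrable fun z => C * (1 + ‖w‖) ^ K * D * 2 ^ K * (‖a z‖ + ‖z‖ ^ K * ‖a z‖) := by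
    refine Integrable.const_mul ?_ _
    refine Integrable.add a.integrable.norm ?_
    exact a.integrable_pow_mul volume K
  refine hi.mono' hc.aestronglyMeasurable (Filter.Eventually.of_forall fun z => ?_)
  rw [map_smul, norm_smul]
  refine (mul_le_mul_of_nonneg_left (h b (w - z)) (norm_nonneg _)).trans ?_
  have h1 : (1 + ‖w - z‖) ^ K ≤ (1 + ‖w‖) ^ K * (2 ^ K * (1 + ‖z‖ ^ K)) := by
    have e1 : (1 + ‖w - z‖) ^ K ≤ ((1 + ‖w‖) * (1 + ‖z‖)) ^ K := by
      refine pow_le_pow_left₀ (by positivity) ?_ K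
      nlinarith [norm_sub_le w z, mul_nonneg (norm_nonneg w) (norm_nonneg z)]
    rw [mul_pow] at e1
    refine e1.trans (mul_le_mul_of_nonneg_left ?_ (by positivity))
    have e2 : (1 + ‖z‖) ^ K ≤ (2 * max 1 ‖z‖) ^ K := by
      refine pow_le_pow_left₀ (by positivity) ?_ K
      linarith [le_max_left 1 ‖z‖, le_max_right 1 ‖z‖]
    rw [mul_pow] at e2
    refine e2.trans (mul_le_mul_of_nonneg_left ?_ (by positivity))
    rcases max_cases 1 ‖z‖ with h | h <;> rw [h.1]
    · simp
    · simp
  calc ‖a z‖ * (C * (1 + ‖w - z‖) ^ K * D) ≤ ‖a z‖ * (C * ((1 + ‖w‖) ^ K * (2 ^ K * (1 + ‖z‖ ^ K))) * D) := by gcongr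
    _ = _ := by ring

lemma mOp_conv {n : ℕ} {E : Type*} [NormedAddCommGroup E] [NormedSpace ℂ E] [CompleteSpace E] (f : TDist n E) (a b : Sch n) (x : Rn n) :
    mOp (mulS a b) f x = ∫ z, invFourierS a z • mOp b f (x - z) := by
  obtain ⟨C, K, L, hC, h⟩ := td_bound f
  let T : Sch n →L[ℂ] E := ⟨f.toFun, td_cont f⟩
  have h1 := conv_integrable (JJ K L) (invFourierS a) (invFourierS b) x
  have h2 := conv_integrable T (invFourierS a) (invFourierS b) x
  have key : T (shiftReflect (invFourierS (mulS a b)) x) = ∫ z, T (invFourierS a z • shiftReflect (invFourierS b) (x - z)) := by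
    refine int_graph (T.toLinearMap.restrictScalars ℝ) ((JJ K L).toLinearMap.restrictScalars ℝ) C h _ _ h1 h2 ?_
    change JJ K L _ = ∫ z, JJ K L _
    funext α
    ext y
    rw [JJ_conv]
    let ev : (((Fin n → Fin (L + 1)) → BoundedContinuousFunction (Rn n) ℂ)) →L[ℂ] ℂ :=
      (BoundedContinuousFunction.evalCLM ℂ y).comp (ContinuousLinearMap.proj α)
    exact ev.integral_comp_comm h1
  change ((2 * π) ^ (-(n : ℝ) / 2) : ℝ) • T (shiftReflect (invFourierS (mulS a b)) x) = ∫ z, invFourierS a z •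
    (((2 * π) ^ (-(n : ℝ) / 2) : ℝ) • T (shiftReflect (invFourierS b) (x - z)))
  rw [key, ← integral_smul]
  refine integral_congr_ae (Filter.Eventually.of_forall fun z => ?_)
  simp only [map_smul]
  rw [smul_comm]

lemma invF_dilate {n : ℕ} (g : Sch n) {t : ℝ} (ht : 0 < t) (z : Rn n) :
    invFourierS (dilate g t⁻¹) z = (t ^ n : ℝ) • invFourierS g (t • z) := by
  have e : ∀ (a : Sch n) (z : Rn n), invFourierS a z = ∫ v, Real.fourierChar (inner ℝ v z) • a v := by
    intro a z
    rw [invF_eq, SchwartzMap.fourierInv_coe, Real.fourierInv_eq]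
  rw [e, e]
  have h := MeasureTheory.Measure.integral_comp_inv_smul (volume : Measure (Rn n))
    (fun v : Rn n => Real.fourierChar (inner ℝ v (t • z)) • g v) t
  rw [finrank_euclideanSpace_fin, abs_of_pos (by positivity)] at h
  rw [← h]
  refine integral_congr_ae (Filter.Eventually.of_forall fun v => ?_)
  simp only
  rw [dilate_apply _ (by positivity), inner_smul_left, inner_smul_right]
  congr 3
  simp only [conj_trivial]
  field_simp

lemma dilate_mulS {n : ℕ} (a b : Sch n) {t : ℝ} (ht : t ≠ 0) : dilate (mulS a b) t = mulS (dilate a t) (dilate b t) := by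
  ext x
  simp [ht]

/-- `mOp` as linear map -/
def mOpL {n : ℕ} {E : Type*} [NormedAddCommGroup E] [NormedSpace ℂ E] (f : TDist n E) (x : Rn n) : Sch n →L[ℝ] E :=
  ((2 * π) ^ (-(n : ℝ) / 2) : ℝ) • ((⟨f.toFun, td_cont f⟩ : Sch n →L[ℂ] E).restrictScalars ℝ).comp
    ((SchwartzMap.compCLMOfAntilipschitz (𝕜 := ℝ) (Aux.hasTemperateGrowth_sub_left x) (Aux.antilipschitz_sub_left x)).comp
      ((FourierTransform.fourierCLE ℂ (Sch n)).symm.toContinuousLinearMap.restrictScalars ℝ))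

lemma mOpL_apply {n : ℕ} {E : Type*} [NormedAddCommGroup E] [NormedSpace ℂ E] (f : TDist n E) (x : Rn n) (b : Sch n) :
    mOpL f x b = mOp b f x := rfl

lemma iter_sum {n : ℕ} {ι : Type*} (s : Finset ι) (g : ι → Sch n) (l : ℕ) (x : Rn n) :
    iteratedFDeriv ℝ l (∑ i ∈ s, g i : Sch n) x = ∑ i ∈ s, iteratedFDeriv ℝ l (g i) x := by
  have e : ((∑ i ∈ s, g i : Sch n) : Rn n → ℂ) = fun y => ∑ i ∈ s, g i y := by
    funext y; simp
  rw [e, iteratedFDeriv_sum fun i _ => (g i).smooth l]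
  simp

/-- convergence of locally finite sums -/
lemma sum_tendsto {n : ℕ} (g : ℕ → Sch n) (m : Sch n)
    (hb : ∀ a l : ℕ, ∃ C : ℝ, 0 ≤ C ∧ ∀ k x, ‖x‖ ^ a * ‖iteratedFDeriv ℝ l (g k) x‖ ≤ C * (1 / 2) ^ k)
    (hs : ∀ ξ, ∃ K0, ∀ᶠ ξ' in 𝓝 ξ, ∀ K ≥ K0, ∑ k ∈ Finset.range K, g k ξ' = m ξ') :
    Tendsto (fun K => ∑ k ∈ Finset.range K, g k) atTop (𝓝 m) := by
  rw [(schwartz_withSeminorms ℂ (Rn n) ℂ).tendsto_nhds]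
  rintro ⟨a, l⟩ ε hε
  obtain ⟨C, hC, hb⟩ := hb a l
  have key : ∀ K, SchwartzMap.seminorm ℂ a l (∑ k ∈ Finset.range K, g k - m) ≤ 2 * C * (1 / 2) ^ K := by
    intro K
    refine SchwartzMap.seminorm_le_bound ℂ a l _ (by positivity) fun x => ?_
    obtain ⟨K0, hK0⟩ := hs x
    set K' := max K0 K
    have e1 : ((∑ k ∈ Finset.range K, g k - m : Sch n) : Rn n → ℂ) =ᶠ[𝓝 x]
        ((-∑ k ∈ Finset.Ico K K', g k : Sch n) : Rn n → ℂ) := by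
      filter_upwards [hK0] with y hy
      have h1 := hy K' (le_max_left _ _)
      rw [← Finset.sum_range_add_sum_Ico _ (le_max_right K0 K)] at h1
      have e2 : (∑ k ∈ Finset.range K, g k - m : Sch n) y = ∑ k ∈ Finset.range K, g k y - m y := by simp
      have e3 : (-∑ k ∈ Finset.Ico K K', g k : Sch n) y = - ∑ k ∈ Finset.Ico K K', g k y := by simp
      rw [e2, e3, ← h1]; ring
    rw [(Filter.EventuallyEq.iteratedFDeriv ℝ e1 l).eq_of_nhds]
    have e4 : ((-∑ k ∈ Finset.Ico K K', g k : Sch n) : Rn n → ℂ) = -((∑ k ∈ Finset.Ico K K', g k : Sch n) : Rn n → ℂ) := rfl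
    rw [e4, iteratedFDeriv_neg_apply, norm_neg, iter_sum]
    refine (mul_le_mul_of_nonneg_left (norm_sum_le _ _) (by positivity)).trans ?_
    rw [Finset.mul_sum]
    refine (Finset.sum_le_sum fun k _ => hb k x).trans ?_
    rw [← Finset.mul_sum, mul_comm 2 C, mul_assoc]
    refine mul_le_mul_of_nonneg_left ?_ hC
    rw [geom_sum_Ico' (by norm_num) (le_max_right K0 K)]
    have : (0:ℝ) ≤ (1 / 2) ^ K' := by positivity
    rw [div_le_iff₀ (by norm_num)]
    linarith
  have h2 : Tendsto (fun K : ℕ => 2 * C * (1 / 2 : ℝ) ^ K) atTop (𝓝 0) := by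
    simpa using (tendsto_pow_atTop_nhds_zero_of_lt_one (by norm_num : (0:ℝ) ≤ 1 / 2) (by norm_num)).const_mul (2 * C)
  filter_upwards [h2.eventually (gt_mem_nhds hε)] with K hK
  exact (key K).trans_lt hK

lemma ker_eq {n : ℕ} (A : ℝ) (k : ℕ) (z : Rn n) :
    ker A k z = ENNReal.ofReal ((2 ^ k) ^ n * (1 + ‖((2:ℝ) ^ k) • z‖) ^ (-A)) := by
  unfold ker bb
  rw [norm_smul, Real.norm_of_nonneg (by positivity), ENNReal.ofReal_mul (by positivity),
    ← ENNReal.ofReal_rpow_of_pos (by positivity), ← pow_mul, ENNReal.ofReal_pow (by norm_num)]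
  norm_num

lemma lemD {n : ℕ} {E : Type*} [NormedAddCommGroup E] [NormedSpace ℂ E] [CompleteSpace E]
    (P : ℕ → Sch n) (hP : SB P fun _ => 1) (G : ℕ → ℕ → Sch n) (m : ℕ → Sch n) (w : ℕ → ℕ → ℕ → ℝ)
    (hw : ∀ M j k, 0 ≤ w M j k) (hG : ∀ M, SB (fun p : ℕ × ℕ => G p.1 p.2) fun p => w M p.1 p.2)
    (hwd : ∀ j M, ∃ C : ℝ, 0 ≤ C ∧ ∀ k, w M j k ≤ C * (((2:ℝ) ^ k) ^ M)⁻¹)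
    (hs : ∀ j ξ, ∃ K0, ∀ᶠ ξ' in 𝓝 ξ, ∀ K ≥ K0, ∑ k ∈ Finset.range K,
      G j k (((2:ℝ) ^ k)⁻¹ • ξ') * P k (((2:ℝ) ^ k)⁻¹ • ξ') = m j ξ') (A : ℝ) (M : ℕ) :
    ∃ C : ℝ≥0∞, C ≠ ∞ ∧ ∀ (f : TDist n E) j x, ‖mOp (m j) f x‖ₑ ≤
      C * ∑' k, ENNReal.ofReal (w M j k) * cv A k (fun z => ‖mOp (dilate (P k) (((2:ℝ) ^ k)⁻¹)) f z‖ₑ) x := by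
  obtain ⟨C, hC, hdec⟩ := ((hG M).inv (fun p => hw _ _ _)).decay (fun p => hw _ _ _) A
  refine ⟨ENNReal.ofReal C, ENNReal.ofReal_ne_top, fun f j x => ?_⟩
  set g : ℕ → Sch n := fun k => dilate (mulS (G j k) (P k)) (((2:ℝ) ^ k)⁻¹) with hg
  have h2k : ∀ k : ℕ, ((2:ℝ) ^ k)⁻¹ ≠ 0 := fun k => by positivity
  have hT : Tendsto (fun K => ∑ k ∈ Finset.range K, g k) atTop (𝓝 (m j)) := by
    refine sum_tendsto g (m j) (fun a l => ?_) fun ξ => ?_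
    · have h1 : SB (fun k => mulS (G j k) (P k)) fun k => w (a + 1) j k := by
        have := hP.mul (fun _ => zero_le_one) (fun k => hw (a + 1) j k) ((hG (a + 1)).comp fun k => (j, k))
        simpa using this
      obtain ⟨D, hD, hb⟩ := SB_dilate_pow (fun k => hw (a + 1) j k) h1 a l
      obtain ⟨D', hD', hb'⟩ := hwd j (a + 1)
      refine ⟨D * D', by positivity, fun k x => (hb k x).trans ?_⟩
      rw [mul_assoc]
      refine mul_le_mul_of_nonneg_left ?_ hD
      refine (mul_le_mul_of_nonneg_right (hb' k) (by positivity)).trans (le_of_eq ?_)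
      rw [pow_succ, one_div, inv_pow]
      field_simp
    · obtain ⟨K0, h⟩ := hs j ξ
      refine ⟨K0, ?_⟩
      filter_upwards [h] with y hy K hK
      rw [← hy K hK]
      refine Finset.sum_congr rfl fun k _ => ?_
      simp only [hg]
      rw [dilate_apply _ (h2k k), mulS_apply]
  have hb : ∀ k, ‖mOp (g k) f x‖ₑ ≤ ENNReal.ofReal C * (ENNReal.ofReal (w M j k) *
      cv A k (fun z => ‖mOp (dilate (P k) (((2:ℝ) ^ k)⁻¹)) f z‖ₑ) x) := by
    intro k
    simp only [hg]
    rw [dilate_mulS _ _ (h2k k), mOp_conv]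
    refine (enorm_integral_le_lintegral_enorm _).trans ?_
    unfold cv
    rw [← lintegral_const_mul' _ _ ENNReal.ofReal_ne_top, ← lintegral_const_mul' _ _ ENNReal.ofReal_ne_top,
      ← lintegral_sub_left_eq_self (fun z => ENNReal.ofReal C * (ENNReal.ofReal (w M j k) * (ker A k (x - z) * ‖mOp (dilate (P k) (((2:ℝ) ^ k)⁻¹)) f z‖ₑ))) x]
    refine lintegral_mono fun z => ?_
    simp only [enorm_smul, sub_sub_cancel]
    rw [← mul_assoc, ← mul_assoc]
    refine mul_le_mul' ?_ le_rfl
    rw [ker_eq, ← ENNReal.ofReal_mul hC, ← ENNReal.ofReal_mul (mul_nonneg hC (hw _ _ _)), ← ofReal_norm]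
    refine ENNReal.ofReal_le_ofReal ?_
    rw [invF_dilate _ (by positivity), norm_smul, Real.norm_of_nonneg (by positivity)]
    refine (mul_le_mul_of_nonneg_left (hdec (j, k) _) (by positivity)).trans (le_of_eq ?_)
    simp only
    ring
  have hlim : Tendsto (fun K => ‖∑ k ∈ Finset.range K, mOp (g k) f x‖ₑ) atTop (𝓝 ‖mOp (m j) f x‖ₑ) := by
    have := ((mOpL f x).continuous.tendsto (m j)).comp hT
    have h2 := (continuous_enorm.tendsto _).comp this
    refine h2.congr fun K => ?_
    simp only [Function.comp, map_sum, mOpL_apply]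
  refine le_of_tendsto hlim (Filter.Eventually.of_forall fun K => ?_)
  refine (enorm_sum_le _ _).trans ?_
  rw [← ENNReal.tsum_mul_left]
  exact (Finset.sum_le_sum fun k _ => hb k).trans (ENNReal.sum_le_tsum _)

lemma SB_cases {ι : Type} {n : ℕ} {G : ι → Sch n} {w : ι → ℝ} (hw : ∀ i, 0 ≤ w i) (S : ι → Prop)
    (h1 : SB (fun i : {i // S i} => G i) fun i => w i) (h2 : SB (fun i : {i // ¬ S i} => G i) fun i => w i) : SB G w := by
  intro m l
  obtain ⟨C, hC, hb⟩ := h1 m l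
  obtain ⟨D, hD, hd⟩ := h2 m l
  refine ⟨C + D, by positivity, fun i x => ?_⟩
  by_cases hi : S i
  · exact (hb ⟨i, hi⟩ x).trans (mul_le_mul_of_nonneg_right (by linarith) (hw i))
  · exact (hd ⟨i, hi⟩ x).trans (mul_le_mul_of_nonneg_right (by linarith) (hw i))

lemma SB.congr {ι : Type} {n : ℕ} {G H : ι → Sch n} {w v : ι → ℝ} (h : SB G w) (e : ∀ i x, H i x = G i x) (e' : ∀ i, w i = v i) : SB H v := by
  have h1 : H = G := funext fun i => SchwartzMap.ext (e i)
  have h2 : v = w := funext fun i => (e' i).symm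
  rw [h1, h2]; exact h

lemma SB.smul {ι : Type} {n : ℕ} {G : ι → Sch n} (h : SB G fun _ => 1) {c : ι → ℝ} (hc : ∀ i, 0 ≤ c i) :
    SB (fun i => c i • G i) c := by
  intro m l
  obtain ⟨C, hC, hb⟩ := h m l
  refine ⟨C, hC, fun i x => ?_⟩
  have e : iteratedFDeriv ℝ l (c i • G i : Sch n) x = c i • iteratedFDeriv ℝ l (G i) x :=
    iteratedFDeriv_const_smul_apply ((G i).smooth l).contDiffAt
  rw [e, norm_smul, Real.norm_of_nonneg (hc i)]
  have := mul_le_mul_of_nonneg_left (hb i x) (hc i)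
  linarith

/-- two values -/
def Lk {n : ℕ} (L0 L : Sch n) (k : ℕ) : Sch n := if k = 0 then L0 else L

lemma SB_Lk {n : ℕ} (L0 L : Sch n) : SB (Lk L0 L) fun _ => 1 := by
  refine SB_cases (fun _ => zero_le_one) (fun k => k = 0) ?_ ?_
  · exact (SB_of_const L0).congr (fun i x => by simp [Lk, i.2]) fun _ => rfl
  · exact (SB_of_const L).congr (fun i x => by simp [Lk, i.2]) fun _ => rfl

/-- weights -/
def w1 (M j k : ℕ) : ℝ := if j ≤ k then (((2:ℝ) ^ (k - j)) ^ M)⁻¹ else 0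

/-- weights -/
def w3 (N M j k : ℕ) : ℝ := if j ≤ k then (((2:ℝ) ^ (k - j)) ^ M)⁻¹ else (((2:ℝ) ^ (j - k)) ^ (2 * N))⁻¹

lemma w1_nonneg (M j k : ℕ) : 0 ≤ w1 M j k := by unfold w1; split_ifs <;> positivity

lemma w3_nonneg (N M j k : ℕ) : 0 ≤ w3 N M j k := by unfold w3; split_ifs <;> positivity

lemma wdec_aux {M j k : ℕ} (h : j ≤ k) : (((2:ℝ) ^ (k - j)) ^ M)⁻¹ = ((2:ℝ) ^ j) ^ M * (((2:ℝ) ^ k) ^ M)⁻¹ := by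
  have : (2:ℝ) ^ k = 2 ^ (k - j) * 2 ^ j := by rw [← pow_add, Nat.sub_add_cancel h]
  rw [this, mul_pow]
  field_simp

lemma w1_dec (M j : ℕ) : ∃ C : ℝ, 0 ≤ C ∧ ∀ k, w1 M j k ≤ C * (((2:ℝ) ^ k) ^ M)⁻¹ := by
  refine ⟨((2:ℝ) ^ j) ^ M, by positivity, fun k => ?_⟩
  unfold w1
  split_ifs with h
  · rw [wdec_aux h]
  · positivity

lemma w3_dec (N M j : ℕ) : ∃ C : ℝ, 0 ≤ C ∧ ∀ k, w3 N M j k ≤ C * (((2:ℝ) ^ k) ^ M)⁻¹ := by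
  refine ⟨((2:ℝ) ^ j) ^ M, by positivity, fun k => ?_⟩
  unfold w3
  split_ifs with h
  · rw [wdec_aux h]
  · have h1 : (((2:ℝ) ^ (j - k)) ^ (2 * N))⁻¹ ≤ 1 := inv_le_one_of_one_le₀ (one_le_pow₀ (one_le_pow₀ (by norm_num)))
    refine h1.trans ?_
    rw [← div_eq_mul_inv, one_le_div (by positivity)]
    gcongr
    · norm_num
    · omega

/-- admissible systems -/
structure Sys (n N : ℕ) (P : ℕ → Sch n) : Prop where
  hP : SB P fun _ => 1
  hW : ∃ W : ℕ → Sch n, (SB W fun _ => 1) ∧ ∀ j, j ≠ 0 → ∀ ξ, P j ξ = (((‖ξ‖ ^ 2) ^ N : ℝ) : ℂ) * W j ξ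
  hL : ∃ (L0 L : Sch n) (ρ : ℝ), 0 < ρ ∧ (∀ ξ, ‖ξ‖ < ρ → L ξ = 0) ∧ ∀ ξ : Rn n, ∃ K0 : ℕ, ∀ᶠ ξ' in 𝓝 ξ, ∀ K ≥ K0,
    ∑ k ∈ Finset.range K, Lk L0 L k (((2:ℝ) ^ k)⁻¹ • ξ') * P k (((2:ℝ) ^ k)⁻¹ • ξ') = 1
  hG : ∃ G : ℕ → ℕ → Sch n, (∀ M, SB (fun p : ℕ × ℕ => G p.1 p.2) fun p => w1 M p.1 p.2) ∧
    ∀ (j : ℕ) (ξ : Rn n), ∃ K0 : ℕ, ∀ᶠ ξ' in 𝓝 ξ, ∀ K ≥ K0, ∑ k ∈ Finset.range K,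
      G j k (((2:ℝ) ^ k)⁻¹ • ξ') * P k (((2:ℝ) ^ k)⁻¹ • ξ') = P j (((2:ℝ) ^ j)⁻¹ • ξ')

lemma SB_high {n : ℕ} {Q : ℕ → Sch n} (hQ : SB Q fun _ => 1) (L : Sch n) {ρ : ℝ} (hρ : 0 < ρ)
    (hL : ∀ ξ, ‖ξ‖ < ρ → L ξ = 0) (M : ℕ) :
    SB (fun p : {p : ℕ × ℕ // p.1 ≤ p.2} => mulS (dilate (Q p.1.1) (2 ^ (p.1.2 - p.1.1))) L)
      fun p => (((2:ℝ) ^ (p.1.2 - p.1.1)) ^ M)⁻¹ := by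
  have h := SB.mul_on (H := fun p : {p : ℕ × ℕ // p.1 ≤ p.2} => dilate (Q p.1.1) (2 ^ (p.1.2 - p.1.1)))
    (v := fun p => (((2:ℝ) ^ (p.1.2 - p.1.1)) ^ M)⁻¹) (SB_of_const L) (fun _ => zero_le_one) (fun p => by positivity)
    {x : Rn n | ρ ≤ ‖x‖} (fun i x hx => ?_)
    (fun l => DB_dilate_high (hQ.comp fun p : {p : ℕ × ℕ // p.1 ≤ p.2} => p.1.1) (t := fun p => 2 ^ (p.1.2 - p.1.1)) (fun p => one_le_pow₀ (by norm_num)) hρ M l)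
  · exact h.congr (fun _ _ => rfl) fun _ => one_mul _
  · have hx' : ‖x‖ < ρ := not_le.mp hx
    filter_upwards [(isOpen_lt continuous_norm continuous_const).mem_nhds hx'] with y hy
    exact hL y hy

/-- multiplication by `|x|^{2N}` -/
def XN {n : ℕ} (N : ℕ) : Sch n → Sch n := smulLeftCLM ℂ (fun x : Rn n => ((‖x‖ ^ 2) ^ N : ℝ))

lemma XN_apply {n : ℕ} (N : ℕ) (a : Sch n) (x : Rn n) : XN N a x = (((‖x‖ ^ 2) ^ N : ℝ) : ℂ) * a x := by
  have h1 : (fun x : Rn n => (‖x‖ ^ 2 : ℝ)).HasTemperateGrowth := by fun_prop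
  have h2 : (fun x : Rn n => ((‖x‖ ^ 2) ^ N : ℝ)).HasTemperateGrowth := by
    induction N with
    | zero => simpa using Function.HasTemperateGrowth.const (1:ℝ)
    | succ N ih => simp only [pow_succ]; exact ih.mul h1
  unfold XN
  rw [smulLeftCLM_apply_apply h2, Complex.real_smul]

lemma SB_low {n N : ℕ} {Q W : ℕ → Sch n} (hW : SB W fun _ => 1)
    (hQ : ∀ j, j ≠ 0 → ∀ ξ, Q j ξ = (((‖ξ‖ ^ 2) ^ N : ℝ) : ℂ) * W j ξ) (L0 L : Sch n) :
    SB (fun p : {p : ℕ × ℕ // ¬ p.1 ≤ p.2} => mulS (dilate (Q p.1.1) ((2 ^ (p.1.1 - p.1.2))⁻¹)) (Lk L0 L p.1.2))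
      fun p => (((2:ℝ) ^ (p.1.1 - p.1.2)) ^ (2 * N))⁻¹ := by
  let c : {p : ℕ × ℕ // ¬ p.1 ≤ p.2} → ℝ := fun p => (((2:ℝ) ^ (p.1.1 - p.1.2)) ^ (2 * N))⁻¹
  have hc : ∀ p, 0 ≤ c p := fun p => by positivity
  have h1 := ((SB_Lk (XN N L0) (XN N L)).comp fun p : {p : ℕ × ℕ // ¬ p.1 ≤ p.2} => p.1.2).smul hc
  have h := SB.mul_on (H := fun p : {p : ℕ × ℕ // ¬ p.1 ≤ p.2} => dilate (W p.1.1) ((2 ^ (p.1.1 - p.1.2))⁻¹))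
    (v := fun p => 1) h1 hc (fun p => zero_le_one) univ (fun i x hx => absurd (mem_univ x) hx)
    (fun l => by
      obtain ⟨C, hC, hb⟩ := DB_dilate (hW.comp fun p : {p : ℕ × ℕ // ¬ p.1 ≤ p.2} => p.1.1) (t := fun p => ((2 ^ (p.1.1 - p.1.2))⁻¹))
        (fun p => by positivity) (fun p => inv_le_one_of_one_le₀ (one_le_pow₀ (by norm_num))) l
      exact ⟨C, hC, fun i x _ => hb i x⟩)
  refine h.congr (fun p x => ?_) fun p => mul_one _
  have hj : p.1.1 ≠ 0 := by have := p.2; omega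
  have ht : ((2:ℝ) ^ (p.1.1 - p.1.2))⁻¹ ≠ 0 := by positivity
  have hx : Lk (XN N L0) (XN N L) p.1.2 x = (((‖x‖ ^ 2) ^ N : ℝ) : ℂ) * Lk L0 L p.1.2 x := by
    unfold Lk; split_ifs <;> exact XN_apply _ _ _
  rw [mulS_apply, mulS_apply, dilate_apply _ ht, dilate_apply _ ht, hQ _ hj]
  change _ = _ * (c p • Lk (XN N L0) (XN N L) p.1.2 x)
  rw [hx, Complex.real_smul, norm_smul, Real.norm_of_nonneg (by positivity)]
  simp only [c]
  push_cast
  rw [pow_mul, mul_pow, mul_pow, inv_pow, inv_pow]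
  ring

lemma SB_hyp3 {n N : ℕ} {Q : ℕ → Sch n} (hQ : SB Q fun _ => 1)
    (hQW : ∃ W : ℕ → Sch n, (SB W fun _ => 1) ∧ ∀ j, j ≠ 0 → ∀ ξ, Q j ξ = (((‖ξ‖ ^ 2) ^ N : ℝ) : ℂ) * W j ξ)
    (L0 L : Sch n) {ρ : ℝ} (hρ : 0 < ρ) (hL : ∀ ξ, ‖ξ‖ < ρ → L ξ = 0) (M : ℕ) :
    SB (fun p : ℕ × ℕ => mulS (dilate (Q p.1) (2 ^ p.2 / 2 ^ p.1)) (Lk L0 L p.2)) fun p => w3 N M p.1 p.2 := by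
  obtain ⟨W, hW, hQW⟩ := hQW
  refine SB_cases (fun p => w3_nonneg _ _ _ _) (fun p => p.1 ≤ p.2) ?_ ?_
  · refine SB_cases (fun p => w3_nonneg _ _ _ _) (fun p => p.1.2 = 0) ?_ ?_
    · refine (SB_of_const (mulS (dilate (Q 0) 1) L0)).congr (fun p x => ?_) fun p => ?_
      · have h1 := p.2; have h2 := p.1.2
        have h3 : p.1.1.1 = 0 := by omega
        rw [h1, h3]; simp [Lk]
      · have h1 := p.2; have h2 := p.1.2
        have h3 : p.1.1.1 = 0 := by omega
        rw [h1, h3]; simp [w3]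
    · refine ((SB_high hQ L hρ hL M).comp (fun p : {p : {p : ℕ × ℕ // p.1 ≤ p.2} // ¬ p.1.2 = 0} => p.1)).congr (fun p x => ?_) fun p => ?_
      · rw [pow_sub₀ _ (by norm_num) p.1.2, Lk, if_neg p.2, div_eq_mul_inv]
      · rw [w3, if_pos p.1.2]
  · refine (SB_low hW hQW L0 L).congr (fun p x => ?_) fun p => ?_
    · have h := p.2
      rw [pow_sub₀ _ (by norm_num) (by omega), mul_inv, inv_inv, div_eq_mul_inv, mul_comm]
    · rw [w3, if_neg p.2]

lemma pw_le (M : ℝ) (d : ℕ) : ENNReal.ofReal ((((2:ℝ) ^ d) ^ ⌈M⌉₊)⁻¹) ≤ (2:ℝ≥0∞) ^ (-(M * d)) := by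
  rw [two_rpow, Real.rpow_neg (by norm_num)]
  refine ENNReal.ofReal_le_ofReal (inv_anti₀ (by positivity) ?_)
  rw [← pow_mul, ← Real.rpow_natCast]
  refine Real.rpow_le_rpow_of_exponent_le (by norm_num) ?_
  push_cast
  rw [mul_comm]
  exact mul_le_mul_of_nonneg_left (Nat.le_ceil M) (by positivity)

/-- the family of means -/
def SF {n : ℕ} {E : Type*} [NormedAddCommGroup E] [NormedSpace ℂ E] (P : ℕ → Sch n) (f : TDist n E) (k : ℕ) (x : Rn n) : ℝ≥0∞ :=
  ‖mOp (dilate (P k) (((2:ℝ) ^ k)⁻¹)) f x‖ₑ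

lemma tsum_tail (j : ℕ) {g : ℕ → ℝ≥0∞} (hg : ∀ k, k < j → g k = 0) : ∑' k, g k = ∑' i, g (j + i) := by
  rw [← Summable.sum_add_tsum_nat_add' (f := g) (k := j) ENNReal.summable, Finset.sum_eq_zero, zero_add]
  · simp only [add_comm]
  · exact fun k hk => hg k (Finset.mem_range.mp hk)

lemma hyp1 {n N : ℕ} (E : Type*) [NormedAddCommGroup E] [NormedSpace ℂ E] [CompleteSpace E] {P : ℕ → Sch n} (h : Sys n N P) (A M : ℝ) :
    ∃ C : ℝ≥0∞, C ≠ ∞ ∧ ∀ f : TDist n E, Hyp1 (SF P f) A M C := by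
  obtain ⟨G, hG, hs⟩ := h.hG
  obtain ⟨C, hC, hb⟩ := lemD (E := E) P h.hP G (fun j => dilate (P j) (((2:ℝ) ^ j)⁻¹)) w1 w1_nonneg hG (fun j M => w1_dec M j)
    (fun j ξ => by
      obtain ⟨K0, hK⟩ := hs j ξ
      refine ⟨K0, hK.mono fun ξ' h' K hK' => (h' K hK').trans ?_⟩
      rw [dilate_apply _ (by positivity)]) A ⌈M⌉₊
  refine ⟨C, hC, fun f j x => (hb f j x).trans (mul_le_mul' le_rfl ?_)⟩
  rw [tsum_tail j]
  · refine ENNReal.tsum_le_tsum fun i => mul_le_mul' ?_ le_rfl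
    rw [w1, if_pos (by omega), Nat.add_sub_cancel_left]
    exact pw_le M i
  · intro k hk
    rw [w1, if_neg (by omega), ENNReal.ofReal_zero, zero_mul]

lemma hyp2 {n : ℕ} {E : Type*} [NormedAddCommGroup E] [NormedSpace ℂ E] {P : ℕ → Sch n} (h : SB P fun _ => 1) (f : TDist n E) :
    ∃ (L : ℝ) (c : ℝ≥0∞), 0 ≤ L ∧ c ≠ ∞ ∧ Hyp2 (SF P f) L c := by
  obtain ⟨s, C, K, hC, hb⟩ := MB f
  choose D hD hd using fun p : ℕ × ℕ => SB_dilate_pow (fun _ => zero_le_one) h p.1 p.2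
  let m := s.sup Prod.fst
  let D' := ∑ p ∈ s, D p
  have hD' : 0 ≤ D' := Finset.sum_nonneg fun p _ => hD p
  refine ⟨((m + K : ℕ) : ℝ), ENNReal.ofReal (C * D'), by positivity, ENNReal.ofReal_ne_top, fun k x => ?_⟩
  have h1 : (s.sup (schwartzSeminormFamily ℂ (Rn n) ℂ)) (dilate (P k) (((2:ℝ) ^ k)⁻¹)) ≤ D' * (2 ^ k) ^ (m + K) := by
    refine Seminorm.finset_sup_apply_le (by positivity) fun p hp => ?_
    refine SchwartzMap.seminorm_le_bound ℂ p.1 p.2 _ (by positivity) fun x => (hd p k x).trans ?_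
    rw [one_mul]
    refine mul_le_mul (Finset.single_le_sum (fun p _ => hD p) hp) ?_ (by positivity) hD'
    exact pow_le_pow_right₀ (one_le_pow₀ (by norm_num)) ((Finset.le_sup (f := Prod.fst) hp).trans (Nat.le_add_right _ _))
  have h2 : ‖mOp (dilate (P k) (((2:ℝ) ^ k)⁻¹)) f x‖ ≤ C * D' * (2 ^ k) ^ (m + K) * (1 + ‖x‖) ^ (m + K) := by
    refine (hb _ x).trans ?_
    have h3 : (1 + ‖x‖) ^ K ≤ (1 + ‖x‖) ^ (m + K) := pow_le_pow_right₀ (by linarith [norm_nonneg x]) (Nat.le_add_left _ _)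
    calc _ ≤ C * (1 + ‖x‖) ^ (m + K) * (D' * (2 ^ k) ^ (m + K)) := by gcongr
      _ = _ := by ring
  unfold SF
  rw [← ofReal_norm]
  refine (ENNReal.ofReal_le_ofReal h2).trans (le_of_eq ?_)
  rw [ENNReal.ofReal_mul (by positivity), ENNReal.ofReal_mul (by positivity), two_rpow, bb, ENNReal.rpow_natCast,
    ← ENNReal.ofReal_pow (by positivity), pow_zero, one_mul, Real.rpow_mul (by norm_num), Real.rpow_natCast, Real.rpow_natCast]

lemma hyp3 {n N : ℕ} (E : Type*) [NormedAddCommGroup E] [NormedSpace ℂ E] [CompleteSpace E] {P Q : ℕ → Sch n} (h : Sys n N P)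
    (h' : Sys n N Q) (A M : ℝ) :
    ∃ C : ℝ≥0∞, C ≠ ∞ ∧ ∀ f : TDist n E, Hyp3 (SF P f) (SF Q f) (2 * (N:ℝ)) A M C := by
  obtain ⟨L0, L, ρ, hρ, hL, hs⟩ := h.hL
  obtain ⟨C, hC, hb⟩ := lemD (E := E) P h.hP (fun j k => mulS (dilate (Q j) (2 ^ k / 2 ^ j)) (Lk L0 L k)) (fun j => dilate (Q j) (((2:ℝ) ^ j)⁻¹))
    (w3 N) (w3_nonneg N) (SB_hyp3 h'.hP h'.hW L0 L hρ hL) (fun j M => w3_dec N M j)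
    (fun j ξ => by
      obtain ⟨K0, hK⟩ := hs ξ
      refine ⟨K0, hK.mono fun ξ' h' K hK' => ?_⟩
      have h1 := h' K hK'
      rw [dilate_apply _ (by positivity), ← mul_one (Q j _), ← h1, Finset.mul_sum]
      refine Finset.sum_congr rfl fun k _ => ?_
      rw [mulS_apply, dilate_apply _ (by positivity), smul_smul, mul_assoc]
      congr 3
      field_simp) A ⌈M⌉₊
  refine ⟨C, hC, fun f j x => (hb f j x).trans (mul_le_mul' le_rfl ?_)⟩
  refine ENNReal.tsum_le_tsum fun k => mul_le_mul' ?_ le_rfl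
  have hlow : ∀ d : ℕ, ENNReal.ofReal ((((2:ℝ) ^ d) ^ (2 * N))⁻¹) = (2:ℝ≥0∞) ^ (-(2 * (N:ℝ) * d)) := fun d => by
    rw [two_rpow, Real.rpow_neg (by norm_num), ← pow_mul, ← Real.rpow_natCast]
    push_cast
    rw [mul_comm (d:ℝ)]
  unfold w3 bt
  split_ifs with h1 h2 h2
  · have : j = k := le_antisymm h1 h2
    subst this; simp
  · have e : (k:ℝ) - j = ((k - j : ℕ) : ℝ) := by push_cast [Nat.cast_sub h1]; ring
    rw [e]; exact pw_le M _
  · have e : (j:ℝ) - k = ((j - k : ℕ) : ℝ) := by push_cast [Nat.cast_sub h2]; ring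
    rw [e, hlow]
  · omega

theorem main5 {n N : ℕ} (E : Type*) [NormedAddCommGroup E] [NormedSpace ℂ E] [CompleteSpace E] {P Q : ℕ → Sch n} (h : Sys n N P)
    (h' : Sys n N Q) {s : ℝ} (hs : s < 2 * (N:ℝ)) {p q : ℝ≥0∞} (hp : 0 < p) (hp' : p ≠ ∞) (hq : 0 < q) :
    ∃ C : ℝ≥0∞, C ≠ ∞ ∧ ∀ f : TDist n E,
      lpNormENN p (fun x => lqSum q fun j => (2:ℝ≥0∞) ^ ((j:ℝ) * s) * SF Q f j x) ≤
        C * lpNormENN p (fun x => lqSum q fun j => (2:ℝ≥0∞) ^ ((j:ℝ) * s) * SF P f j x) := by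
  choose C1 hC1 h1 using fun A M => hyp1 E h A M
  choose C3 hC3 h3 using fun A M => hyp3 E h h' A M
  obtain ⟨C, hC, hb⟩ := main4 n hs hp hp' hq C1 C3 (fun A M _ => hC1 A M) (fun A M _ => hC3 A M)
  refine ⟨C, hC, fun f => hb (SF P f) (SF Q f) (fun j => ?_) (fun A M _ => h1 A M f) (hyp2 h.hP f) fun A M _ => h3 A M f⟩
  exact (tdConv_cont _ f).enorm.measurable

lemma exists_bump (n : ℕ) {r : ℝ} (hr : 0 < r) : ∃ b : Sch n, (∀ x, ‖x‖ ≤ r → b x = 1) ∧ ∀ x, 2 * r ≤ ‖x‖ → b x = 0 := by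
  let g : ContDiffBump (0 : Rn n) := ⟨r, 2 * r, hr, by linarith⟩
  have h1 : HasCompactSupport (fun x => ((g x : ℝ) : ℂ)) := g.hasCompactSupport.comp_left Complex.ofReal_zero
  have h2 : ContDiff ℝ ((⊤ : ℕ∞) : WithTop ℕ∞) (fun x => ((g x : ℝ) : ℂ)) := Complex.ofRealCLM.contDiff.comp g.contDiff
  refine ⟨h1.toSchwartzMap h2, fun x hx => ?_, fun x hx => ?_⟩
  · change ((g x : ℝ) : ℂ) = 1
    rw [g.one_of_mem_closedBall (by simpa [g] using hx)]; simp
  · change ((g x : ℝ) : ℂ) = 0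
    rw [g.zero_of_le_dist (by simpa [g] using hx)]; simp

lemma exists_div {n : ℕ} (χ : Sch n) {θ : Rn n → ℂ} (hθ : ContDiff ℝ ((⊤ : ℕ∞) : WithTop ℕ∞) θ) {S : Set (Rn n)} (hS : IsCompact S)
    (h0 : ∀ x ∉ S, χ x = 0) (h1 : ∀ x ∈ S, θ x ≠ 0) : ∃ L : Sch n, ∀ x, L x = χ x / θ x := by
  have e : ∀ x ∉ S, χ x / θ x = 0 := fun x hx => by rw [h0 x hx, zero_div]
  have hc : HasCompactSupport (fun x => χ x / θ x) := HasCompactSupport.intro hS e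
  have hd : ContDiff ℝ ((⊤ : ℕ∞) : WithTop ℕ∞) (fun x => χ x / θ x) := by
    rw [contDiff_iff_contDiffAt]
    intro x
    by_cases hx : x ∈ S
    · simp only [div_eq_mul_inv]
      exact ((χ.smooth _).contDiffAt).mul (hθ.contDiffAt.inv (h1 x hx))
    · refine (contDiffAt_const (c := (0:ℂ))).congr_of_eventuallyEq ?_
      filter_upwards [hS.isClosed.isOpen_compl.mem_nhds hx] with y hy using e y hy
  exact ⟨hc.toSchwartzMap hd, fun x => rfl⟩

lemma SB_zero {ι : Type} {n : ℕ} {w : ι → ℝ} {G : ι → Sch n} (hG : ∀ i, G i = 0) : SB G w := by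
  intro m l
  refine ⟨0, le_rfl, fun i x => ?_⟩
  rw [hG i]
  have : iteratedFDeriv ℝ l ((0 : Sch n) : Rn n → ℂ) x = 0 := by
    have : ((0 : Sch n) : Rn n → ℂ) = 0 := rfl
    rw [this]; simp
  rw [this]; simp

lemma phi_zero {n : ℕ} {φ : ℕ → Sch n} (h : SmoothResolution n φ) (k : ℕ) {η : Rn n} (hη : dilate (φ k) (2 ^ k) η ≠ 0) :
    ‖η‖ ≤ 2 ∧ (k ≠ 0 → 1 / 2 ≤ ‖η‖) := by
  rw [dilate_apply _ (by positivity)] at hη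
  rcases Nat.eq_zero_or_pos k with rfl | hk
  · refine ⟨by simpa using h.supp0 hη, fun h => absurd rfl h⟩
  · have h1 := h.suppj k hk hη
    simp only [mem_ofPred_eq] at h1
    rw [norm_smul, norm_pow, Real.norm_of_nonneg (by norm_num), Real.rpow_sub_one (by norm_num), Real.rpow_add_one (by norm_num),
      Real.rpow_natCast] at h1
    have h2 : (0:ℝ) < 2 ^ k := by positivity
    exact ⟨le_of_mul_le_mul_left h1.2 h2, fun _ => le_of_mul_le_mul_left (by linarith [h1.1]) h2⟩

lemma phi_SB {n : ℕ} {φ : ℕ → Sch n} (h : SmoothResolution n φ) : SB (fun k => dilate (φ k) (2 ^ k)) fun _ => 1 := by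
  intro m l
  choose c hc using h.deriv_bound
  let S : Finset (Fin n → ℕ) := Fintype.piFinset fun _ => Finset.range (l + 1)
  let C := ∑ α ∈ S, |c α|
  have hC : 0 ≤ C := Finset.sum_nonneg fun _ _ => abs_nonneg _
  refine ⟨2 ^ m * (n ^ l * C), by positivity, fun k x => ?_⟩
  have h2 : (0:ℝ) < 2 ^ k := by positivity
  by_cases hx : ‖x‖ ≤ 2
  · rw [iter_dilate _ h2.ne', norm_smul, norm_pow, Real.norm_of_nonneg h2.le, mul_one]
    have h1 := iter_le (l := l) (φ k) ((2:ℝ) ^ k • x) (c := C * ((2 ^ k) ^ l)⁻¹) (by positivity) (fun α hα => by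
      refine (hc α k _).trans ?_
      have e : (2:ℝ) ^ (-(k:ℝ) * (mdeg α : ℝ)) = ((2 ^ k) ^ l)⁻¹ := by
        rw [hα, neg_mul, Real.rpow_neg (by norm_num), Real.rpow_mul (by norm_num), Real.rpow_natCast, Real.rpow_natCast]
      rw [e]
      refine mul_le_mul_of_nonneg_right ((le_abs_self _).trans ?_) (by positivity)
      refine Finset.single_le_sum (f := fun α => |c α|) (fun _ _ => abs_nonneg _) ?_
      refine Fintype.mem_piFinset.mpr fun i => Finset.mem_range.mpr ?_
      have : α i ≤ mdeg α := Finset.single_le_sum (f := α) (fun _ _ => Nat.zero_le _) (Finset.mem_univ i)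
      omega)
    have h3 : ‖x‖ ^ m ≤ 2 ^ m := pow_le_pow_left₀ (norm_nonneg _) hx m
    refine mul_le_mul h3 ?_ (by positivity) (by positivity)
    calc _ ≤ (2 ^ k) ^ l * (n ^ l * (C * ((2 ^ k) ^ l)⁻¹)) := by gcongr
      _ = _ := by field_simp
  · have e : (dilate (φ k) (2 ^ k) : Rn n → ℂ) =ᶠ[𝓝 x] fun _ => 0 := by
      filter_upwards [(isOpen_lt continuous_const continuous_norm).mem_nhds (not_le.mp hx)] with y hy
      by_contra hne
      exact absurd (phi_zero h k hne).1 (not_le.mpr hy)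
    rw [(e.iteratedFDeriv ℝ l).eq_of_nhds]
    have : iteratedFDeriv ℝ l (fun _ : Rn n => (0:ℂ)) x = 0 := by
      have := iteratedFDeriv_fun_zero (𝕜 := ℝ) (E := Rn n) (F := ℂ) (n := l)
      exact congrFun this x
    rw [this, norm_zero, mul_zero]
    positivity

lemma phi_Sys {n : ℕ} (N : ℕ) {φ : ℕ → Sch n} (h : SmoothResolution n φ) : Sys n N fun k => dilate (φ k) (2 ^ k) := by
  obtain ⟨b, hb1, hb0⟩ := exists_bump n (r := 2) (by norm_num)
  obtain ⟨a, ha1, ha0⟩ := exists_bump n (r := 1 / 8) (by norm_num)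
  have hQ1 : ∀ x : Rn n, 1 / 2 ≤ ‖x‖ → ‖x‖ ≤ 2 → (b - a) x = 1 := fun x h1 h2 => by
    rw [sub_apply, hb1 x h2, ha0 x (by linarith), sub_zero]
  have hQ0 : ∀ x : Rn n, ‖x‖ ≤ 1 / 8 → (b - a) x = 0 := fun x h1 => by
    rw [sub_apply, hb1 x (by linarith), ha1 x h1, sub_self]
  have hφe : ∀ (k : ℕ) (ξ : Rn n), dilate (φ k) (2 ^ k) (((2:ℝ) ^ k)⁻¹ • ξ) = φ k ξ := fun k ξ => by
    rw [dilate_apply _ (by positivity), smul_smul, mul_inv_cancel₀ (by positivity), one_smul]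
  refine ⟨phi_SB h, ?_, ?_, ?_⟩
  · obtain ⟨Y, hY⟩ := exists_div (b - a) (θ := fun x => (((‖x‖ ^ 2) ^ N : ℝ) : ℂ))
      (Complex.ofRealCLM.contDiff.comp ((contDiff_norm_sq ℝ).pow N))
      (S := closedBall 0 4 ∩ {x | 1 / 8 ≤ ‖x‖}) ((isCompact_closedBall _ _).inter_right (isClosed_le continuous_const continuous_norm))
      (fun x hx => by
        rcases le_total (1 / 8) ‖x‖ with h1 | h1
        · have h2 : ¬ ‖x‖ ≤ 4 := fun h2 => hx ⟨by simpa using h2, h1⟩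
          rw [sub_apply, hb0 x (by linarith), ha0 x (by linarith), sub_self]
        · exact hQ0 x h1)
      (fun x hx => by
        have h1 : (1:ℝ) / 8 ≤ ‖x‖ := hx.2
        have : 0 < ‖x‖ := by linarith
        exact_mod_cast (by positivity : ((‖x‖ ^ 2) ^ N : ℝ) ≠ 0))
    refine ⟨fun j => mulS (dilate (φ j) (2 ^ j)) Y, ((SB_of_const Y).mul (fun _ => zero_le_one) (fun _ => zero_le_one) (phi_SB h)).congr
      (fun _ _ => rfl) (fun _ => mul_one _), fun j hj ξ => ?_⟩
    rw [mulS_apply, hY]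
    by_cases hz : dilate (φ j) (2 ^ j) ξ = 0
    · rw [hz]; simp
    · obtain ⟨h1, h2⟩ := phi_zero h j hz
      have h3 := h2 hj
      have : 0 < ‖ξ‖ := by linarith
      have h4 : (((‖ξ‖ ^ 2) ^ N : ℝ) : ℂ) ≠ 0 := by exact_mod_cast (by positivity : ((‖ξ‖ ^ 2) ^ N : ℝ) ≠ 0)
      rw [hQ1 ξ h3 h1]
      field_simp
  · refine ⟨b, b - a, 1 / 8, by norm_num, fun ξ hξ => hQ0 ξ hξ.le, fun ξ => ?_⟩
    obtain ⟨K0, hK0⟩ := pow_unbounded_of_one_lt (‖ξ‖ + 1) (one_lt_two (α := ℝ))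
    refine ⟨K0 + 1, ?_⟩
    filter_upwards [ball_mem_nhds ξ one_pos] with y hy K hK
    have hy' : ‖y‖ < 2 ^ K0 := by
      have : ‖y - ξ‖ < 1 := by rwa [← dist_eq_norm]
      have := norm_sub_norm_le y ξ
      linarith
    rw [← h.sum_eq y, tsum_eq_sum (s := Finset.range K)]
    · refine Finset.sum_congr rfl fun k _ => ?_
      rw [← hφe k y]
      by_cases hz : dilate (φ k) (2 ^ k) (((2:ℝ) ^ k)⁻¹ • y) = 0
      · rw [hz, mul_zero]
      · obtain ⟨h1, h2⟩ := phi_zero h k hz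
        unfold Lk
        split_ifs with hk
        · rw [hb1 _ h1, one_mul]
        · rw [hQ1 _ (h2 hk) h1, one_mul]
    · intro k hk
      have hk' : K ≤ k := by simpa using hk
      by_contra hz
      rw [← hφe k y] at hz
      have h1 := (phi_zero h k hz).2 (by omega)
      rw [norm_smul, norm_inv, norm_pow, Real.norm_of_nonneg (by norm_num)] at h1
      have h2 : (2:ℝ) ^ (K0 + 1) ≤ 2 ^ k := pow_le_pow_right₀ (by norm_num) (by omega)
      have h3 : (0:ℝ) < 2 ^ k := by positivity
      rw [inv_mul_eq_div, le_div_iff₀ h3] at h1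
      rw [pow_succ] at h2
      linarith
  · refine ⟨fun l k => if k = l then b else 0, fun M => ?_, fun l ξ => ⟨l + 1, Filter.Eventually.of_forall fun y K hK => ?_⟩⟩
    · refine SB_cases (fun p => w1_nonneg _ _ _) (fun p => p.2 = p.1) ?_ ?_
      · exact (SB_of_const b).congr (fun p x => by beta_reduce; rw [if_pos p.2]) fun p => by have := p.2; simp [w1, this]
      · exact SB_zero fun p => if_neg p.2
    · rw [Finset.sum_eq_single_of_mem l (Finset.mem_range.mpr (by omega))]
      · beta_reduce
        rw [if_pos rfl]
        by_cases hz : dilate (φ l) (2 ^ l) (((2:ℝ) ^ l)⁻¹ • y) = 0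
        · rw [hz, mul_zero]
        · rw [hb1 _ (phi_zero h l hz).1, one_mul]
      · intro k _ hk
        beta_reduce
        rw [if_neg hk]
        exact zero_mul _

lemma fD {n : ℕ} (a : Sch n) (i : Fin n) (ξ : Rn n) :
    fourierS (LineDeriv.lineDerivOpCLM ℝ (Sch n) (EuclideanSpace.single i (1 : ℝ)) a) ξ = (2 * π * Complex.I * (ξ i : ℂ)) * fourierS a ξ := by
  have h := SchwartzMap.fourier_lineDerivOp_eq a (EuclideanSpace.single i (1 : ℝ) : Rn n)
  have hg : (fun x : Rn n => inner ℝ x (EuclideanSpace.single i (1 : ℝ) : Rn n)).HasTemperateGrowth :=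
    ((innerSL ℝ).flip (EuclideanSpace.single i (1 : ℝ) : Rn n)).hasTemperateGrowth
  have h2 := congrArg (fun g : Sch n => g ξ) h
  change fourierS (LineDeriv.lineDerivOpCLM ℝ (Sch n) (EuclideanSpace.single i (1 : ℝ)) a) ξ = _ at h2
  rw [h2]
  change (2 * π * Complex.I : ℂ) • (smulLeftCLM ℂ (fun x : Rn n => inner ℝ x (EuclideanSpace.single i (1 : ℝ) : Rn n)) (𝓕 a)) ξ = _
  rw [smulLeftCLM_apply_apply hg, EuclideanSpace.inner_single_right, Complex.real_smul, fF_eq]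
  simp
  ring

lemma fLap {n : ℕ} (a : Sch n) (ξ : Rn n) : fourierS (schLap a) ξ = (-(4 * (π:ℂ) ^ 2)) * ((‖ξ‖ ^ 2 : ℝ) : ℂ) * fourierS a ξ := by
  have e : fourierS (schLap a) = ∑ i : Fin n, fourierS (LineDeriv.lineDerivOpCLM ℝ (Sch n) (EuclideanSpace.single i (1 : ℝ))
    (LineDeriv.lineDerivOpCLM ℝ (Sch n) (EuclideanSpace.single i (1 : ℝ)) a)) := by
    simp only [fF_eq]
    exact map_sum (FourierTransform.fourierCLE ℂ (Sch n)) _ _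
  rw [e, sum_apply]
  simp only [fD]
  rw [EuclideanSpace.norm_sq_eq, Complex.ofReal_sum, Finset.mul_sum, Finset.sum_mul]
  refine Finset.sum_congr rfl fun i _ => ?_
  rw [Real.norm_eq_abs, sq_abs]
  push_cast
  linear_combination (4 * (π:ℂ) ^ 2 * (ξ i:ℂ) ^ 2 * fourierS a ξ) * Complex.I_sq

lemma fLapN {n : ℕ} (N : ℕ) (a : Sch n) (ξ : Rn n) :
    fourierS (schLap^[N] a) ξ = (((‖ξ‖ ^ 2) ^ N : ℝ) : ℂ) * ((-(4 * (π:ℂ) ^ 2)) ^ N * fourierS a ξ) := by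
  induction N with
  | zero => simp
  | succ N ih =>
    rw [Function.iterate_succ_apply', fLap, ih]
    push_cast
    ring

lemma tele {n : ℕ} (χ : Sch n) (l : ℕ) (ξ : Rn n) (K : ℕ) (hK : l + 1 ≤ K) :
    ∑ k ∈ Finset.range K, (if k < l then 0 else if k = l then χ (((2:ℝ) ^ k)⁻¹ • ξ) else
      χ (((2:ℝ) ^ k)⁻¹ • ξ) - χ ((2:ℝ) • ((2:ℝ) ^ k)⁻¹ • ξ)) = χ (((2:ℝ) ^ (K - 1))⁻¹ • ξ) := by
  induction K, hK using Nat.le_induction with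
  | base =>
    rw [Finset.sum_range_succ, Finset.sum_eq_zero, if_neg (by omega), if_pos rfl, zero_add, Nat.add_sub_cancel]
    intro k hk
    rw [if_pos (Finset.mem_range.mp hk)]
  | succ K hK ih =>
    rw [Finset.sum_range_succ, ih, if_neg (by omega), if_neg (by omega), Nat.add_sub_cancel, smul_smul]
    have : (2:ℝ) * (2 ^ K)⁻¹ = (2 ^ (K - 1))⁻¹ := by
      obtain ⟨m, rfl⟩ : ∃ m, K = m + 1 := ⟨K - 1, by omega⟩
      rw [Nat.add_sub_cancel, pow_succ]; field_simp
    rw [this]; ring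

lemma tele_one {n : ℕ} {χ : Sch n} {r : ℝ} (hr : 0 < r) (hχ : ∀ x, ‖x‖ ≤ r → χ x = 1) (ξ : Rn n) :
    ∃ K0 : ℕ, ∀ᶠ y in 𝓝 ξ, ∀ K ≥ K0, χ (((2:ℝ) ^ (K - 1))⁻¹ • y) = 1 := by
  obtain ⟨K0, hK0⟩ := pow_unbounded_of_one_lt ((‖ξ‖ + 1) / r) (one_lt_two (α := ℝ))
  refine ⟨K0 + 1, ?_⟩
  filter_upwards [ball_mem_nhds ξ one_pos] with y hy K hK
  have hy' : ‖y‖ ≤ ‖ξ‖ + 1 := by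
    have : ‖y - ξ‖ < 1 := by rwa [← dist_eq_norm]
    have := norm_sub_norm_le y ξ
    linarith
  refine hχ _ ?_
  have h2 : (2:ℝ) ^ K0 ≤ 2 ^ (K - 1) := pow_le_pow_right₀ (by norm_num) (by omega)
  rw [norm_smul, norm_inv, norm_pow, Real.norm_of_nonneg (by norm_num), inv_mul_le_iff₀ (by positivity)]
  rw [div_lt_iff₀ hr] at hK0
  calc _ ≤ 2 ^ K0 * r := hy'.trans hK0.le
    _ ≤ _ := by gcongr

lemma loc_Sys {n : ℕ} (N : ℕ) (k0 k0' : Sch n) (hk0 : fourierS k0 0 ≠ 0) (hk0' : fourierS k0' 0 ≠ 0) :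
    Sys n N (Lk (fourierS k0) (fourierS (schLap^[N] k0'))) := by
  obtain ⟨r, hr, hr0⟩ : ∃ r : ℝ, 0 < r ∧ ∀ ξ : Rn n, ‖ξ‖ ≤ 2 * r → fourierS k0 ξ ≠ 0 ∧ fourierS k0' ξ ≠ 0 := by
    have h1 := ((fourierS k0).continuous.continuousAt.eventually_ne hk0).and ((fourierS k0').continuous.continuousAt.eventually_ne hk0')
    obtain ⟨ε, hε, h2⟩ := Metric.eventually_nhds_iff.mp h1
    refine ⟨ε / 4, by positivity, fun ξ hξ => h2 ?_⟩
    rw [dist_zero_right]; linarith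
  obtain ⟨χ, hχ1, hχ0⟩ := exists_bump n hr
  set θ := fourierS (schLap^[N] k0') with hθ
  have hθ0 : ∀ ξ : Rn n, 0 < ‖ξ‖ → ‖ξ‖ ≤ 2 * r → θ ξ ≠ 0 := fun ξ h1 h2 => by
    rw [hθ, fLapN]
    have h4 : (((‖ξ‖ ^ 2) ^ N : ℝ) : ℂ) ≠ 0 := by exact_mod_cast (by positivity : ((‖ξ‖ ^ 2) ^ N : ℝ) ≠ 0)
    have h5 : (-(4 * (π:ℂ) ^ 2)) ^ N ≠ 0 := pow_ne_zero _ (neg_ne_zero.mpr (by simp [Real.pi_ne_zero]))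
    exact mul_ne_zero h4 (mul_ne_zero h5 (hr0 ξ h2).2)
  obtain ⟨L0, hL0⟩ := exists_div χ ((fourierS k0).smooth _) (isCompact_closedBall (0 : Rn n) (2 * r))
    (fun x hx => hχ0 x (not_le.mp (by simpa using hx)).le) (fun x hx => (hr0 x (by simpa using hx)).1)
  have hd : ∀ x, (χ - dilate χ 2) x = χ x - χ ((2:ℝ) • x) := fun x => by
    rw [sub_apply, dilate_apply _ (by norm_num)]
  have n2 : ∀ x : Rn n, ‖(2:ℝ) • x‖ = 2 * ‖x‖ := fun x => by rw [norm_smul]; simp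
  have hlow : ∀ x : Rn n, ‖x‖ ≤ r / 2 → (χ - dilate χ 2) x = 0 := fun x hx => by
    rw [hd, hχ1 x (by linarith), hχ1 _ (by rw [n2]; linarith), sub_self]
  have hhi : ∀ x : Rn n, 2 * r ≤ ‖x‖ → (χ - dilate χ 2) x = 0 := fun x hx => by
    rw [hd, hχ0 x hx, hχ0 _ (by rw [n2]; linarith), sub_self]
  obtain ⟨L, hL⟩ := exists_div (χ - dilate χ 2) (θ.smooth _)
    (S := closedBall 0 (2 * r) ∩ {x | r / 2 ≤ ‖x‖}) ((isCompact_closedBall _ _).inter_right (isClosed_le continuous_const continuous_norm))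
    (fun x hx => by
      rcases le_total (r / 2) ‖x‖ with h1 | h1
      · refine hhi x (le_of_lt (not_le.mp fun h2 => hx ⟨by simpa using h2, h1⟩))
      · exact hlow x h1)
    (fun x hx => by
      have h1 : r / 2 ≤ ‖x‖ := hx.2
      exact hθ0 x (by linarith) (by simpa using hx.1))
  have hLθ : ∀ x, L x * θ x = χ x - χ ((2:ℝ) • x) := fun x => by
    rw [← hd, hL]
    by_cases hx : θ x = 0
    · rw [hx, mul_zero]
      rcases le_total (2 * r) ‖x‖ with h1 | h1
      · exact (hhi x h1).symm
      · refine (hlow x ?_).symm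
        by_contra h2
        exact hθ0 x (by linarith) h1 hx
    · rw [div_mul_cancel₀ _ hx]
  have hL00 : ∀ x, L0 x * fourierS k0 x = χ x := fun x => by
    rw [hL0]
    by_cases hx : fourierS k0 x = 0
    · rw [hx, mul_zero]
      refine (hχ0 x ?_).symm
      by_contra h2
      exact (hr0 x (by linarith)).1 hx
    · rw [div_mul_cancel₀ _ hx]
  have hLz : ∀ ξ : Rn n, ‖ξ‖ < r / 2 → L ξ = 0 := fun ξ hξ => by rw [hL, hlow ξ hξ.le, zero_div]
  refine ⟨SB_Lk _ _, ?_, ⟨L0, L, r / 2, by positivity, hLz, fun ξ => ?_⟩, ?_⟩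
  · refine ⟨fun _ => ((-(4 * (π:ℂ) ^ 2)) ^ N) • fourierS k0', SB_of_const _, fun j hj ξ => ?_⟩
    rw [Lk, if_neg hj, hθ, fLapN]
    rfl
  · obtain ⟨K0, hK0⟩ := tele_one hr hχ1 ξ
    refine ⟨K0 + 1, hK0.mono fun y hy K hK => ?_⟩
    rw [← hy K (by omega), ← tele χ 0 y K (by omega)]
    refine Finset.sum_congr rfl fun k _ => ?_
    rw [if_neg (by omega)]
    unfold Lk
    split_ifs with hk
    · exact hL00 _
    · exact hLθ _
  · refine ⟨fun l k => if k < l then 0 else if k = l then χ else mulS (dilate (Lk (fourierS k0) θ l) (2 ^ (k - l))) L, fun M => ?_, fun l ξ => ?_⟩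
    · refine SB_cases (fun p => w1_nonneg _ _ _) (fun p => p.1 ≤ p.2) ?_ ?_
      · refine SB_cases (fun p => w1_nonneg _ _ _) (fun p => p.1.2 = p.1.1) ?_ ?_
        · exact (SB_of_const χ).congr (fun p x => by beta_reduce; rw [if_neg (by have := p.2; omega), if_pos p.2])
            fun p => by have := p.2; simp [w1, this]
        · refine ((SB_high (SB_Lk (fourierS k0) θ) L (half_pos hr) hLz M).comp
            (fun p : {p : {p : ℕ × ℕ // p.1 ≤ p.2} // ¬ p.1.2 = p.1.1} => p.1)).congr (fun p x => ?_) fun p => ?_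
          · beta_reduce
            rw [if_neg (by have := p.1.2; omega), if_neg p.2]
          · rw [w1, if_pos p.1.2]
      · exact SB_zero fun p => if_pos (by have := p.2; omega)
    · obtain ⟨K0, hK0⟩ := tele_one hr hχ1 ξ
      refine ⟨K0 + l + 1, hK0.mono fun y hy K hK => ?_⟩
      rw [← mul_one (Lk (fourierS k0) θ l _), ← hy K (by omega), ← tele χ l y K (by omega), Finset.mul_sum]
      refine Finset.sum_congr rfl fun k _ => ?_
      beta_reduce
      split_ifs with h1 h2
      · change (0:ℂ) * _ = _
        rw [zero_mul, mul_zero]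
      · rw [h2, mul_comm]
      · have h3 : k ≠ 0 := by omega
        rw [← hLθ, mulS_apply, dilate_apply _ (by positivity), smul_smul, mul_assoc]
        congr 2
        · congr 2
          rw [pow_sub₀ _ (by norm_num) (by omega)]
          field_simp
        · rw [Lk, if_neg h3]

lemma two_mul_rpow_le {a b : ℝ≥0∞} {r : ℝ} (hr : 0 ≤ r) : (a + b) ^ r ≤ 2 ^ r * (a ^ r + b ^ r) := by
  have h : a + b ≤ 2 * max a b := by rw [two_mul]; exact add_le_add (le_max_left _ _) (le_max_right _ _)
  refine (ENNReal.rpow_le_rpow h hr).trans ?_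
  rw [ENNReal.mul_rpow_of_nonneg _ _ hr]
  refine mul_le_mul' le_rfl ?_
  rcases max_cases a b with ⟨h, -⟩ | ⟨h, -⟩ <;> rw [h]
  · exact le_self_add
  · exact le_add_self

lemma lp_mono {n : ℕ} {p : ℝ≥0∞} (hp' : p ≠ ∞) {g h : Rn n → ℝ≥0∞} (H : ∀ x, g x ≤ h x) : lpNormENN p g ≤ lpNormENN p h := by
  unfold lpNormENN
  rw [if_neg hp', if_neg hp']
  refine ENNReal.rpow_le_rpow (lintegral_mono fun x => ENNReal.rpow_le_rpow (H x) (by positivity)) (by positivity)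

lemma lp_smul {n : ℕ} {p : ℝ≥0∞} (hp : 0 < p) (hp' : p ≠ ∞) {c : ℝ≥0∞} (hc : c ≠ ∞) (g : Rn n → ℝ≥0∞) :
    lpNormENN p (fun x => c * g x) = c * lpNormENN p g := by
  have hr : 0 < p.toReal := ENNReal.toReal_pos hp.ne' hp'
  unfold lpNormENN
  rw [if_neg hp', if_neg hp']
  simp only [ENNReal.mul_rpow_of_nonneg _ _ hr.le]
  rw [lintegral_const_mul' _ _ (ENNReal.rpow_ne_top_of_nonneg hr.le hc), ENNReal.mul_rpow_of_nonneg _ _ (by positivity),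
    ← ENNReal.rpow_mul, mul_one_div_cancel hr.ne', ENNReal.rpow_one]

lemma lp_add {n : ℕ} {p : ℝ≥0∞} (hp' : p ≠ ∞) {u : Rn n → ℝ≥0∞} (hu : Measurable u) (v : Rn n → ℝ≥0∞) :
    lpNormENN p (fun x => u x + v x) ≤ (2 ^ p.toReal) ^ (1 / p.toReal) * (2 ^ (1 / p.toReal) * (lpNormENN p u + lpNormENN p v)) := by
  have h0 : (0:ℝ) ≤ p.toReal := ENNReal.toReal_nonneg
  have h1 : (0:ℝ) ≤ 1 / p.toReal := by positivity
  unfold lpNormENN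
  rw [if_neg hp', if_neg hp', if_neg hp']
  calc _ ≤ (∫⁻ x, 2 ^ p.toReal * (u x ^ p.toReal + v x ^ p.toReal)) ^ (1 / p.toReal) :=
        ENNReal.rpow_le_rpow (lintegral_mono fun x => two_mul_rpow_le h0) h1
    _ = (2 ^ p.toReal) ^ (1 / p.toReal) * ((∫⁻ x, u x ^ p.toReal) + ∫⁻ x, v x ^ p.toReal) ^ (1 / p.toReal) := by
        rw [lintegral_const_mul' _ _ (ENNReal.rpow_ne_top_of_nonneg h0 (by norm_num)), lintegral_add_left (hu.pow_const _),
          ENNReal.mul_rpow_of_nonneg _ _ h1]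
    _ ≤ _ := mul_le_mul' le_rfl (two_mul_rpow_le h1)

lemma lq_ge0 {q : ℝ≥0∞} (hq : 0 < q) (a : ℕ → ℝ≥0∞) : a 0 ≤ lqSum q a := by
  unfold lqSum
  split_ifs with h
  · exact le_iSup a 0
  · have hr : 0 < q.toReal := ENNReal.toReal_pos hq.ne' h
    calc a 0 = (a 0 ^ q.toReal) ^ (1 / q.toReal) := by rw [← ENNReal.rpow_mul, mul_one_div_cancel hr.ne', ENNReal.rpow_one]
      _ ≤ _ := ENNReal.rpow_le_rpow (ENNReal.le_tsum 0) (by positivity)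

lemma lq_tail {q : ℝ≥0∞} (a : ℕ → ℝ≥0∞) : lqSum q (fun j => a (j + 1)) ≤ lqSum q a := by
  unfold lqSum
  split_ifs with h
  · exact iSup_le fun j => le_iSup a (j + 1)
  · exact ENNReal.rpow_le_rpow (ENNReal.tsum_comp_le_tsum_of_injective (add_left_injective 1) (fun j => a j ^ q.toReal)) (by positivity)

lemma lq_le (q : ℝ≥0∞) (hq : 0 < q) : ∃ C : ℝ≥0∞, C ≠ ∞ ∧ ∀ a : ℕ → ℝ≥0∞, lqSum q a ≤ C * (a 0 + lqSum q fun j => a (j + 1)) := by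
  unfold lqSum
  split_ifs with h
  · refine ⟨1, by norm_num, fun a => ?_⟩
    rw [one_mul]
    refine iSup_le fun j => ?_
    cases j with
    | zero => exact le_self_add
    | succ j => exact (le_iSup (fun j => a (j + 1)) j).trans le_add_self
  · have hr : 0 < q.toReal := ENNReal.toReal_pos hq.ne' h
    refine ⟨2 ^ (1 / q.toReal), ENNReal.rpow_ne_top_of_nonneg (by positivity) (by norm_num), fun a => ?_⟩
    rw [tsum_eq_zero_add' ENNReal.summable]
    refine (two_mul_rpow_le (by positivity)).trans (le_of_eq ?_)
    rw [← ENNReal.rpow_mul, mul_one_div_cancel hr.ne', ENNReal.rpow_one]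

lemma SF_phi {n : ℕ} {E : Type*} [NormedAddCommGroup E] [NormedSpace ℂ E] (φ : ℕ → Sch n) (f : TDist n E) (k : ℕ) (x : Rn n) :
    SF (fun k => dilate (φ k) (2 ^ k)) f k x = ‖mOp (φ k) f x‖ₑ := by
  have e : dilate (dilate (φ k) (2 ^ k)) (((2:ℝ) ^ k)⁻¹) = φ k := by
    ext y
    rw [dilate_apply _ (by positivity), dilate_apply _ (by positivity), smul_smul, mul_inv_cancel₀ (by positivity), one_smul]
  unfold SF
  rw [e]

lemma inv_four {n : ℕ} (a : Sch n) : invFourierS (fourierS a) = a := by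
  rw [invF_eq, fF_eq]; exact FourierTransform.fourierInv_fourier_eq a

lemma SF_loc0 {n : ℕ} {E : Type*} [NormedAddCommGroup E] [NormedSpace ℂ E] (a b : Sch n) (f : TDist n E) (x : Rn n) :
    SF (Lk (fourierS a) (fourierS b)) f 0 x = ‖tdConv a f x‖ₑ := by
  have e : dilate (fourierS a) (((2:ℝ) ^ 0)⁻¹) = fourierS a := by
    ext y
    rw [dilate_apply _ (by positivity)]; simp
  unfold SF Lk
  rw [if_pos rfl, e, mOp, inv_four]

lemma SF_loc1 {n : ℕ} {E : Type*} [NormedAddCommGroup E] [NormedSpace ℂ E] (a b : Sch n) (f : TDist n E) (j : ℕ) (x : Rn n) :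
    SF (Lk (fourierS a) (fourierS b)) f (j + 1) x =
      ‖tdConv (((2 : ℝ) ^ (((j : ℝ) + 1) * (n : ℝ))) • dilate b ((2 : ℝ) ^ ((j : ℝ) + 1))) f x‖ₑ := by
  have e0 : (2:ℝ) ^ ((j:ℝ) + 1) = 2 ^ (j + 1) := by
    rw [← Real.rpow_natCast]; push_cast; rfl
  have e : invFourierS (dilate (fourierS b) (((2:ℝ) ^ (j + 1))⁻¹)) =
      ((2 : ℝ) ^ (((j : ℝ) + 1) * (n : ℝ))) • dilate b ((2 : ℝ) ^ ((j : ℝ) + 1)) := by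
    ext z
    rw [invF_dilate _ (by positivity), inv_four, Real.rpow_mul (by norm_num), Real.rpow_natCast, e0]
    change _ = ((2:ℝ) ^ (j + 1)) ^ n • dilate b (2 ^ (j + 1)) z
    rw [dilate_apply _ (by positivity)]
  unfold SF Lk
  rw [if_neg (by omega), mOp, e]

lemma loc_equiv {n : ℕ} (E : Type*) [NormedAddCommGroup E] [NormedSpace ℂ E] (s : ℝ) {p q : ℝ≥0∞} (hp : 0 < p) (hp' : p ≠ ∞) (hq : 0 < q)
    (a b : Sch n) : ∃ C : ℝ≥0∞, C ≠ ∞ ∧ ∀ f : TDist n E,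
      localMeansF s p q a b f ≤ 2 * lpNormENN p (fun x => lqSum q fun j => (2:ℝ≥0∞) ^ ((j:ℝ) * s) * SF (Lk (fourierS a) (fourierS b)) f j x) ∧
      lpNormENN p (fun x => lqSum q fun j => (2:ℝ≥0∞) ^ ((j:ℝ) * s) * SF (Lk (fourierS a) (fourierS b)) f j x) ≤ C * localMeansF s p q a b f := by
  obtain ⟨Cq, hCq, hq'⟩ := lq_le q hq
  have hr : 0 < p.toReal := ENNReal.toReal_pos hp.ne' hp'
  refine ⟨Cq * ((2 ^ p.toReal) ^ (1 / p.toReal) * 2 ^ (1 / p.toReal)), ?_, fun f => ?_⟩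
  · exact ENNReal.mul_ne_top hCq (ENNReal.mul_ne_top (ENNReal.rpow_ne_top_of_nonneg (by positivity)
      (ENNReal.rpow_ne_top_of_nonneg hr.le (by norm_num))) (ENNReal.rpow_ne_top_of_nonneg (by positivity) (by norm_num)))
  let g : Rn n → ℕ → ℝ≥0∞ := fun x j => (2:ℝ≥0∞) ^ ((j:ℝ) * s) * SF (Lk (fourierS a) (fourierS b)) f j x
  have hg0 : ∀ x, g x 0 = ‖tdConv a f x‖ₑ := fun x => by simp [g, SF_loc0]
  have hX : eLpNorm (tdConv a f) p volume = lpNormENN p fun x => g x 0 := by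
    rw [eLpNorm_eq_lintegral_rpow_enorm_toReal hp.ne' hp', lpNormENN, if_neg hp']
    simp only [hg0]
  have hY : localMeansF s p q a b f = (lpNormENN p fun x => g x 0) + lpNormENN p fun x => lqSum q fun j => g x (j + 1) := by
    unfold localMeansF
    rw [hX]
    congr 2
    funext x
    congr 1
    funext j
    simp only [g, SF_loc1, Nat.cast_add, Nat.cast_one]
    rfl
  have hm : Measurable fun x => g x 0 := by
    simp only [hg0]; exact (tdConv_cont _ f).enorm.measurable
  rw [hY]
  change _ ≤ 2 * lpNormENN p (fun x => lqSum q (g x)) ∧ lpNormENN p (fun x => lqSum q (g x)) ≤ _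
  constructor
  · rw [two_mul]
    exact add_le_add (lp_mono hp' fun x => lq_ge0 hq _) (lp_mono hp' fun x => lq_tail _)
  · refine (lp_mono hp' fun x => hq' (g x)).trans ?_
    rw [lp_smul hp hp' hCq, mul_assoc, mul_assoc]
    exact mul_le_mul' le_rfl (lp_add hp' hm _)

lemma const_fix {C : ℝ≥0∞} (hC : C ≠ ∞) : ∃ c : ℝ, 0 < c ∧ C ≤ ENNReal.ofReal c :=
  ⟨C.toReal + 1, by positivity, by
    rw [← ENNReal.ofReal_toReal hC]
    exact ENNReal.ofReal_le_ofReal (by rw [ENNReal.toReal_ofReal (by positivity)]; linarith)⟩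

theorem fin_thm (n : ℕ) (E : Type*) [NormedAddCommGroup E] [NormedSpace ℂ E]
    [CompleteSpace E] (s : ℝ) (p q : ℝ≥0∞) (hp : 0 < p) (hp' : p ≠ ∞) (hq : 0 < q)
    (k0 k0' : Sch n) (hk0 : fourierS k0 0 ≠ 0) (hk0' : fourierS k0' 0 ≠ 0)
    (N : ℕ) (hN : s < 2 * N)
    (φ : ℕ → Sch n) (hφ : SmoothResolution n φ) :
    (∃ c₁ > (0 : ℝ), ∃ c₂ > (0 : ℝ), ∀ f : TDist n E, triebelNorm s p q φ f < ∞ →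
      ENNReal.ofReal c₁ * triebelNorm s p q φ f ≤ localMeansF s p q k0 (schLap^[N] k0') f ∧
        localMeansF s p q k0 (schLap^[N] k0') f ≤ ENNReal.ofReal c₂ * triebelNorm s p q φ f) ∧
    ∀ f : TDist n E,
      triebelNorm s p q φ f < ∞ ↔ localMeansF s p q k0 (schLap^[N] k0') f < ∞ := by
  have S1 := phi_Sys N hφ
  have S2 := loc_Sys N k0 k0' hk0 hk0'
  obtain ⟨C1, hC1, h1⟩ := main5 E S1 S2 hN hp hp' hq
  obtain ⟨C2, hC2, h2⟩ := main5 E S2 S1 hN hp hp' hq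
  obtain ⟨C3, hC3, h3⟩ := loc_equiv E s hp hp' hq k0 (schLap^[N] k0')
  have ht : ∀ f : TDist n E, lpNormENN p (fun x => lqSum q fun j => (2:ℝ≥0∞) ^ ((j:ℝ) * s) * SF (fun k => dilate (φ k) (2 ^ k)) f j x)
      = triebelNorm s p q φ f := fun f => by
    simp only [SF_phi]; rfl
  simp only [ht] at h1 h2
  obtain ⟨c, hc, hcC⟩ := const_fix (ENNReal.mul_ne_top hC2 hC3)
  obtain ⟨d, hd, hdC⟩ := const_fix (ENNReal.mul_ne_top (ENNReal.ofNat_ne_top (n := 2)) hC1)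
  have A : ∀ f : TDist n E, triebelNorm s p q φ f ≤ ENNReal.ofReal c * localMeansF s p q k0 (schLap^[N] k0') f := fun f =>
    ((h2 f).trans ((mul_le_mul' le_rfl (h3 f).2).trans (le_of_eq (mul_assoc _ _ _).symm))).trans (mul_le_mul' hcC le_rfl)
  have B : ∀ f : TDist n E, localMeansF s p q k0 (schLap^[N] k0') f ≤ ENNReal.ofReal d * triebelNorm s p q φ f := fun f =>
    ((h3 f).1.trans ((mul_le_mul' le_rfl (h1 f)).trans (le_of_eq (mul_assoc _ _ _).symm))).trans (mul_le_mul' hdC le_rfl)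
  refine ⟨⟨c⁻¹, inv_pos.mpr hc, d, hd, fun f _ => ⟨?_, B f⟩⟩, fun f => ⟨fun h => ?_, fun h => ?_⟩⟩
  · rw [ENNReal.ofReal_inv_of_pos hc]
    have h0 : ENNReal.ofReal c ≠ 0 := (ENNReal.ofReal_pos.mpr hc).ne'
    refine (mul_le_mul' le_rfl (A f)).trans (le_of_eq ?_)
    rw [← mul_assoc, ENNReal.inv_mul_cancel h0 ENNReal.ofReal_ne_top, one_mul]
  · exact (B f).trans_lt (ENNReal.mul_lt_top ENNReal.ofReal_lt_top h)
  · exact (A f).trans_lt (ENNReal.mul_lt_top ENNReal.ofReal_lt_top h)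

end LM

/-- the local means `k₀, k^N = Δ^N k⁰` give an equivalent norm and
characterization of `F^s_{p,q}(E)` when `2N > s`. -/
theorem statement7 (n : ℕ) (E : Type*) [NormedAddCommGroup E] [NormedSpace ℂ E]
    [CompleteSpace E] (s : ℝ) (p q : ℝ≥0∞) (hp : 0 < p) (hp' : p ≠ ∞) (hq : 0 < q)
    (k0 k0' : Sch n) (hk0 : fourierS k0 0 ≠ 0) (hk0' : fourierS k0' 0 ≠ 0)
    (N : ℕ) (hN : s < 2 * N)
    (φ : ℕ → Sch n) (hφ : SmoothResolution n φ) :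
    (∃ c₁ > (0 : ℝ), ∃ c₂ > (0 : ℝ), ∀ f : TDist n E, triebelNorm s p q φ f < ∞ →
      ENNReal.ofReal c₁ * triebelNorm s p q φ f ≤ localMeansF s p q k0 (schLap^[N] k0') f ∧
        localMeansF s p q k0 (schLap^[N] k0') f ≤ ENNReal.ofReal c₂ * triebelNorm s p q φ f) ∧
    ∀ f : TDist n E,
      triebelNorm s p q φ f < ∞ ↔ localMeansF s p q k0 (schLap^[N] k0') f < ∞ := by
  exact LM.fin_thm n E s p q hp hp' hq k0 k0' hk0 hk0' N hN φ hφ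

end
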